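/- arXiv:1601.02992 — 4 statements merged into one kernel-verified Lean document; each statement's English description precedes it below -/
import Mathlib

section
/- Let E = EuclideanSpace ℝ (Fin 3), let r > 0, and let M ⊆ E be an open set containing the closed ball of radius r centered at 0. Let 𝒜 be a set of vector fields E → E such that every Y ∈ 𝒜 is analytic on M and every two elements of 𝒜 commute on M. Suppose X ∈ 𝒜 satisfies ⟪X p, p⟫ < 0 for every p with ‖p‖ = r. Then there exists a point p with ‖p‖ < r such that Y p = 0 for every Y ∈ 𝒜. -/
open scoped RealInnerProductSpace

section AnalyticVectorFields

open Topology Filter Set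

section Division

variable {E F : Type*} [NormedAddCommGroup E] [NormedSpace ℝ E]
  [NormedAddCommGroup F] [NormedSpace ℝ F] [CompleteSpace F]

/-- Averages of an analytic map along a segment of linear reparametrizations are analytic. -/
theorem AnalyticAt.intervalIntegral_comp_linear {h : E → F} (hh : AnalyticAt ℝ h 0)
    (P Q : E →L[ℝ] E) :
    AnalyticAt ℝ (fun z => ∫ s in (0 : ℝ)..1, h ((P + s • Q) z)) 0 := by
  obtain ⟨q, R, hq⟩ := hh
  obtain ⟨ρ, hρ0, hρR⟩ := ENNReal.lt_iff_exists_nnreal_btwn.1 hq.r_pos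
  have hρ : (0 : ℝ) < ρ := by exact_mod_cast hρ0
  have hρq : (ρ : ENNReal) < q.radius := hρR.trans_le hq.r_le
  set C : ℝ := ‖P‖ + ‖Q‖ + 1 with hC
  have hC0 : 0 < C := by positivity
  have hnorm : ∀ s ∈ Set.uIoc (0 : ℝ) 1, ‖P + s • Q‖ ≤ C := by
    intro s hs
    rw [Set.uIoc_of_le zero_le_one] at hs
    calc ‖P + s • Q‖ ≤ ‖P‖ + ‖s • Q‖ := norm_add_le _ _
      _ ≤ ‖P‖ + 1 * ‖Q‖ := by
          rw [norm_smul, Real.norm_of_nonneg hs.1.le]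
          gcongr
          exact hs.2
      _ ≤ C := by rw [hC]; linarith
  let G : ∀ n : ℕ, ℝ → E [×n]→L[ℝ] F := fun n s =>
    (q n).compContinuousLinearMap (fun _ => P + s • Q)
  have hGc : ∀ n, Continuous (G n) := by
    intro n
    have h1 := (ContinuousMultilinearMap.compContinuousLinearMapContinuousMultilinear ℝ
      (fun _ : Fin n => E) (fun _ : Fin n => E) F).cont
    have h2 : Continuous fun s : ℝ => (fun _ : Fin n => P + s • Q) := by fun_prop
    exact (h1.comp h2).clm_apply continuous_const
  have hGn : ∀ n, ∀ s ∈ Set.uIoc (0 : ℝ) 1, ‖G n s‖ ≤ ‖q n‖ * C ^ n := by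
    intro n s hs
    refine (ContinuousMultilinearMap.norm_compContinuousLinearMap_le _ _).trans ?_
    simp only [Finset.prod_const, Finset.card_univ, Fintype.card_fin]
    gcongr
    exact hnorm s hs
  let k : FormalMultilinearSeries ℝ E F := fun n => ∫ s in (0 : ℝ)..1, G n s
  have hk : ∀ n, ‖k n‖ ≤ ‖q n‖ * C ^ n := by
    intro n
    have := intervalIntegral.norm_integral_le_of_norm_le_const (hGn n)
    simpa using this
  let C' : NNReal := ⟨C, hC0.le⟩
  have hCC : (C' : ℝ) = C := rfl
  refine HasFPowerSeriesAt.analyticAt (p := k) ⟨(ρ / C' : NNReal), ⟨?_, ?_, ?_⟩⟩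
  · obtain ⟨M, -, hM⟩ := q.norm_mul_pow_le_of_lt_radius hρq
    refine k.le_radius_of_bound M fun n => ?_
    refine le_trans ?_ (hM n)
    calc ‖k n‖ * ((ρ / C' : NNReal) : ℝ) ^ n ≤ ‖q n‖ * C ^ n * ((ρ / C' : NNReal) : ℝ) ^ n := by
          gcongr; exact hk n
      _ = ‖q n‖ * (ρ : ℝ) ^ n := by
          rw [NNReal.coe_div, hCC, div_pow]
          field_simp
  · have : 0 < ρ / C' := div_pos (by exact_mod_cast hρ0) (by exact_mod_cast hC0)
    exact_mod_cast this
  · intro y hy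
    have hy' : C * ‖y‖ < ρ := by
      rw [mem_eball_zero_iff] at hy
      have h1 : ‖y‖₊ < ρ / C' := by exact_mod_cast hy
      have h2 : ‖y‖ < ρ / C := by exact_mod_cast h1
      rw [lt_div_iff₀ hC0] at h2
      linarith
    have hyn : ∀ s ∈ Set.uIoc (0 : ℝ) 1, ‖(P + s • Q) y‖ ≤ C * ‖y‖ := fun s hs =>
      ((P + s • Q).le_opNorm y).trans (by gcongr; exact hnorm s hs)
    have hsummable : Summable fun n => ‖q n‖ * (C * ‖y‖) ^ n := by
      refine Summable.of_nonneg_of_le (fun n => by positivity) (fun n => ?_)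
        (q.summable_norm_mul_pow hρq)
      gcongr
    have key : HasSum (fun n => ∫ s in (0 : ℝ)..1, (G n s) fun _ => y)
        (∫ s in (0 : ℝ)..1, h ((P + s • Q) (0 + y))) := by
      refine intervalIntegral.hasSum_integral_of_dominated_convergence
        (fun n _ => ‖q n‖ * (C * ‖y‖) ^ n) ?_ ?_ ?_ ?_ ?_
      · intro n
        exact ((ContinuousMultilinearMap.apply ℝ (fun _ : Fin n => E) F
          (fun _ => y)).continuous.comp (hGc n)).aestronglyMeasurable
      · intro n
        refine Eventually.of_forall fun s hs => ?_
        refine ((q n).le_opNorm _).trans ?_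
        simp only [Finset.prod_const, Finset.card_univ, Fintype.card_fin]
        gcongr
        exact hyn s hs
      · exact Eventually.of_forall fun s hs => hsummable
      · exact intervalIntegrable_const
      · refine Eventually.of_forall fun s hs => ?_
        have hm : (P + s • Q) y ∈ Metric.eball (0 : E) R := by
          rw [mem_eball_zero_iff]
          refine lt_trans ?_ hρR
          have h1 : ‖(P + s • Q) y‖ < ρ := (hyn s hs).trans_lt hy'
          have h2 : ‖(P + s • Q) y‖₊ < ρ := by exact_mod_cast h1
          exact_mod_cast h2
        have := hq.hasSum hm
        simpa [G] using this
    convert key using 2 with n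
    exact ((ContinuousMultilinearMap.apply ℝ (fun _ : Fin n => E) F
      (fun _ => y)).intervalIntegral_comp_comm ((hGc n).intervalIntegrable 0 1)).symm

/-- An analytic map vanishing on the kernel of a linear form is divisible by it. -/
theorem AnalyticAt.exists_eq_smul_of_linear {f : E → F} {l : E →L[ℝ] ℝ} {ν : E}
    (hν : l ν = 1) (hf : AnalyticAt ℝ f 0) (h0 : ∀ᶠ z in 𝓝 0, l z = 0 → f z = 0) :
    ∃ K : E → F, AnalyticAt ℝ K 0 ∧ ∀ᶠ z in 𝓝 0, f z = l z • K z := by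
  let Q : E →L[ℝ] E := l.smulRight ν
  let P : E →L[ℝ] E := ContinuousLinearMap.id ℝ E - Q
  have hh : AnalyticAt ℝ (fun z => fderiv ℝ f z ν) 0 :=
    (ContinuousLinearMap.apply ℝ F ν).analyticAt _ |>.comp hf.fderiv
  refine ⟨_, hh.intervalIntegral_comp_linear P Q, ?_⟩
  obtain ⟨ε, hε, hball⟩ := Metric.eventually_nhds_iff_ball.1 (hf.eventually_analyticAt.and h0)
  have hPc : Tendsto (fun z => ‖P z‖ + ‖Q z‖) (𝓝 0) (𝓝 0) := by
    have : Continuous fun z => ‖P z‖ + ‖Q z‖ := by fun_prop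
    simpa using this.tendsto 0
  filter_upwards [hPc.eventually (gt_mem_nhds hε)] with z hz
  have hseg : ∀ s ∈ Set.uIcc (0 : ℝ) 1, (P + s • Q) z ∈ Metric.ball (0 : E) ε := by
    intro s hs
    rw [Set.uIcc_of_le zero_le_one] at hs
    rw [mem_ball_zero_iff]
    refine lt_of_le_of_lt ?_ hz
    simp only [_root_.add_apply, _root_.smul_apply]
    refine (norm_add_le _ _).trans ?_
    rw [norm_smul, Real.norm_of_nonneg hs.1]
    nlinarith [norm_nonneg (Q z), hs.2]
  have hder : ∀ s ∈ Set.uIcc (0 : ℝ) 1, HasDerivAt (fun s : ℝ => f ((P + s • Q) z))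
      (l z • fderiv ℝ f ((P + s • Q) z) ν) s := by
    intro s hs
    have h1 := (hball _ (hseg s hs)).1.differentiableAt.hasFDerivAt
    have h2 : HasDerivAt (fun s : ℝ => (P + s • Q) z) (Q z) s := by
      have : HasDerivAt (fun s : ℝ => P z + s • Q z) ((1 : ℝ) • Q z) s :=
        ((hasDerivAt_id s).smul_const (Q z)).const_add _
      simpa using this
    have h3 := h1.comp_hasDerivAt s h2
    simpa [Q, Function.comp_def] using h3
  have hcont : ContinuousOn (fun s : ℝ => l z • fderiv ℝ f ((P + s • Q) z) ν)
      (Set.uIcc (0 : ℝ) 1) := by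
    intro s hs
    have h1 : ContinuousAt (fderiv ℝ f) ((P + s • Q) z) :=
      (hball _ (hseg s hs)).1.fderiv.continuousAt
    have h2 : ContinuousAt (fun s : ℝ => (P + s • Q) z) s := by
      have : Continuous (fun s : ℝ => (P + s • Q) z) := by
        simp only [_root_.add_apply, _root_.smul_apply]
        fun_prop
      exact this.continuousAt
    have h3 : ContinuousAt (fun s : ℝ => fderiv ℝ f ((P + s • Q) z)) s :=
      ContinuousAt.comp (g := fderiv ℝ f) (f := fun s : ℝ => (P + s • Q) z) h1 h2
    exact ((h3.clm_apply continuousAt_const).const_smul (l z)).continuousWithinAt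
  have hftc := intervalIntegral.integral_eq_sub_of_hasDerivAt hder hcont.intervalIntegrable
  rw [intervalIntegral.integral_smul] at hftc
  have e1 : (P + (1 : ℝ) • Q) z = z := by simp [P]
  have e0 : (P + (0 : ℝ) • Q) z = P z := by simp
  have hP0 : f (P z) = 0 := by
    have := (hball _ (hseg 0 (by simp))).2
    rw [e0] at this
    exact this (by simp [P, Q, hν])
  rw [e1, e0, hP0, sub_zero] at hftc
  exact hftc.symm

end Division

section Straightening

variable {E F : Type*} [NormedAddCommGroup E] [NormedSpace ℝ E] [CompleteSpace E]
  [NormedAddCommGroup F] [NormedSpace ℝ F] [CompleteSpace F]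

/-- A regular analytic function is, up to an analytic change of coordinates which only moves points
along a fixed transverse direction, an affine function. -/
theorem exists_analytic_straightening {g : E → ℝ} {p : E} (ν : E) (hg : AnalyticAt ℝ g p)
    (hp : g p = 0) {V : Set E} (hV : V ∈ 𝓝 p) :
    ∃ e : OpenPartialHomeomorph E E, p ∈ e.source ∧ e.source ⊆ V ∧ e p = p ∧
      (∀ z, e z = z + (g z - fderiv ℝ g p (z - p)) • ν) ∧
      (∀ z ∈ e.source, AnalyticAt ℝ e z) ∧ ∀ w ∈ e.target, AnalyticAt ℝ e.symm w := by
  set l := fderiv ℝ g p with hl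
  let Θ : E → E := fun z => z + (g z - l (z - p)) • ν
  have hΘa : ∀ z, AnalyticAt ℝ g z → AnalyticAt ℝ Θ z := by
    intro z hz
    have h1 : AnalyticAt ℝ (fun z => l (z - p)) z :=
      (l.analyticAt _).comp (analyticAt_id.sub analyticAt_const)
    exact analyticAt_id.add ((hz.sub h1).smul analyticAt_const)
  have hΘd : HasStrictFDerivAt Θ (ContinuousLinearEquiv.refl ℝ E : E →L[ℝ] E) p := by
    have h1 : HasStrictFDerivAt (fun z => l (z - p)) l p :=
      l.hasStrictFDerivAt.comp p ((hasStrictFDerivAt_id p).sub_const p)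
    have h2 := (hasStrictFDerivAt_id (𝕜 := ℝ) p).add
      ((hg.hasStrictFDerivAt.sub h1).smul_const ν)
    convert! h2 using 1
    ext v
    simp [hl]
  let e₀ := hΘd.toOpenPartialHomeomorph Θ
  have he₀ : (e₀ : E → E) = Θ := hΘd.toOpenPartialHomeomorph_coe
  have hp₀ : p ∈ e₀.source := hΘd.mem_toOpenPartialHomeomorph_source
  have hΘp : Θ p = p := by simp [Θ, hp]
  have hinv : ∀ᶠ z in 𝓝 p, fderiv ℝ Θ z ∈ range ((↑) : (E ≃L[ℝ] E) → E →L[ℝ] E) := by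
    have hc : ContinuousAt (fderiv ℝ Θ) p := (hΘa p hg).fderiv.continuousAt
    have := ContinuousLinearEquiv.nhds (ContinuousLinearEquiv.refl ℝ E)
    exact hc.eventually (by rw [hΘd.hasFDerivAt.fderiv]; exact this)
  obtain ⟨U, hU, hUo, hpU⟩ := eventually_nhds_iff.1
    ((hg.eventually_analyticAt.and hinv).and hV)
  refine ⟨e₀.restrOpen U hUo, ⟨hp₀, hpU⟩, fun z hz => (hU z hz.2).2, ?_, fun z => ?_,
    fun z hz => ?_, fun w hw => ?_⟩
  · rw [OpenPartialHomeomorph.coe_restrOpen, he₀]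
    exact hΘp
  · rw [OpenPartialHomeomorph.coe_restrOpen, he₀]
  · have : (e₀.restrOpen U hUo : E → E) = Θ := by
      rw [OpenPartialHomeomorph.coe_restrOpen, he₀]
    rw [this]
    exact hΘa z (hU z hz.2).1.1
  · have hcoe : (e₀.restrOpen U hUo : E → E) = Θ := by
      rw [OpenPartialHomeomorph.coe_restrOpen, he₀]
    have hs := (e₀.restrOpen U hUo).map_target hw
    obtain ⟨i, hi⟩ := (hU _ hs.2).1.2
    refine (e₀.restrOpen U hUo).analyticAt_symm (i := i) hw ?_ ?_
    · rw [hcoe]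
      exact hΘa _ (hU _ hs.2).1.1
    · rw [hcoe]
      exact hi.symm

/-- An analytic map vanishing on a regular level set is divisible by its equation. -/
theorem AnalyticAt.exists_eq_smul_of_regular {f : E → F} {g : E → ℝ} {p : E}
    (hf : AnalyticAt ℝ f p) (hg : AnalyticAt ℝ g p) (hp : g p = 0) (hd : fderiv ℝ g p ≠ 0)
    (h0 : ∀ᶠ z in 𝓝 p, g z = 0 → f z = 0) :
    ∃ K : E → F, AnalyticAt ℝ K p ∧ ∀ᶠ z in 𝓝 p, f z = g z • K z := by
  obtain ⟨ν, hν⟩ : ∃ ν, fderiv ℝ g p ν = 1 := by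
    obtain ⟨v, hv⟩ : ∃ v, fderiv ℝ g p v ≠ 0 := by
      by_contra! h
      exact hd (ContinuousLinearMap.ext h)
    exact ⟨(fderiv ℝ g p v)⁻¹ • v, by simp [hv]⟩
  obtain ⟨e, hpe, -, hep, hez, hea, hes⟩ := exists_analytic_straightening ν hg hp univ_mem
  have hge : ∀ z, fderiv ℝ g p (e z - p) = g z := by
    intro z
    rw [hez, add_sub_right_comm, map_add, map_smul, hν]
    simp
  have hpt : p ∈ e.target := hep ▸ e.map_source hpe
  have hsp : e.symm p = p := by
    conv_lhs => rw [← hep]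
    exact e.left_inv hpe
  have htr : AnalyticAt ℝ (fun w : E => w + p) 0 := analyticAt_id.add analyticAt_const
  have hcomp : AnalyticAt ℝ (fun w => f (e.symm (w + p))) 0 := by
    have h1 : AnalyticAt ℝ e.symm (0 + p) := by simpa using hes p hpt
    have h2 := AnalyticAt.comp (g := e.symm) (f := fun w : E => w + p) h1 htr
    exact AnalyticAt.comp (g := f) (f := fun w => e.symm (w + p)) (by simpa [hsp] using hf) h2
  have hct : Tendsto (fun w : E => e.symm (w + p)) (𝓝 0) (𝓝 p) := by
    have h1 : ContinuousAt e.symm (0 + p) := by simpa using (hes p hpt).continuousAt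
    have h2 : ContinuousAt (fun w : E => e.symm (w + p)) 0 :=
      ContinuousAt.comp (g := e.symm) (f := fun w : E => w + p) h1 htr.continuousAt
    simpa [ContinuousAt, hsp] using h2
  have htt : ∀ᶠ w in 𝓝 (0 : E), w + p ∈ e.target := by
    have : Tendsto (fun w : E => w + p) (𝓝 0) (𝓝 p) := by simpa using htr.continuousAt.tendsto
    exact this.eventually (e.open_target.mem_nhds hpt)
  obtain ⟨K, hK, hKe⟩ := hcomp.exists_eq_smul_of_linear hν (by
    filter_upwards [hct.eventually h0, htt] with w hw hwt hlw
    refine hw ?_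
    rw [← hge, e.right_inv hwt]
    simpa using hlw)
  have hsub : AnalyticAt ℝ (fun z => e z - p) p := (hea p hpe).sub analyticAt_const
  have hsub0 : Tendsto (fun z => e z - p) (𝓝 p) (𝓝 0) := by
    simpa [hep] using hsub.continuousAt.tendsto
  refine ⟨fun z => K (e z - p), ?_, ?_⟩
  · exact AnalyticAt.comp (g := K) (f := fun z => e z - p) (by simpa [hep] using hK) hsub
  · filter_upwards [hsub0.eventually hKe, e.open_source.mem_nhds hpe] with z hz hze
    simpa [hge, e.left_inv hze] using hz

/-- Analytic local parametrization of a regular level set by its tangent hyperplane. -/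
theorem exists_analytic_hypersurface_chart {g : E → ℝ} {p ν : E} (hg : AnalyticAt ℝ g p)
    (hp : g p = 0) (hν : fderiv ℝ g p ν = 1) {V : Set E} (hV : V ∈ 𝓝 p) :
    ∃ (π : E →L[ℝ] (fderiv ℝ g p).ker) (Ω : Set (fderiv ℝ g p).ker)
      (σ : (fderiv ℝ g p).ker → E) (U : Set E),
      (∀ z, (π z : E) = z - fderiv ℝ g p z • ν) ∧ IsOpen Ω ∧ IsOpen U ∧ p ∈ U ∧
      (∀ x ∈ Ω, AnalyticAt ℝ σ x ∧ σ x ∈ V ∧ g (σ x) = 0 ∧ π (σ x - p) = x ∧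
        fderiv ℝ g (σ x) ν ≠ 0 ∧ ∀ w, fderiv ℝ σ x (π w) =
          w - ((fderiv ℝ g (σ x) ν)⁻¹ * fderiv ℝ g (σ x) w) • ν) ∧
      ∀ z ∈ U, g z = 0 → π (z - p) ∈ Ω ∧ σ (π (z - p)) = z := by
  have hne : ∀ᶠ z in 𝓝 p, fderiv ℝ g z ν ≠ 0 := by
    have h1 : ContinuousAt (fun z => fderiv ℝ g z ν) p :=
      ((ContinuousLinearMap.apply ℝ ℝ ν).continuous.continuousAt).comp hg.fderiv.continuousAt
    exact h1.eventually_ne (by simp [hν])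
  obtain ⟨e, hpe, heV', hep, hez, hea, hes⟩ := exists_analytic_straightening ν hg hp
    ((hg.eventually_analyticAt.and hne).and hV)
  set l := fderiv ℝ g p with hl
  let π : E →L[ℝ] l.ker := (ContinuousLinearMap.id ℝ E - l.smulRight ν).codRestrict l.ker
    (fun z => by simp [hν])
  have hπ : ∀ z, (π z : E) = z - l z • ν := fun z => rfl
  have hge : ∀ z, l (e z - p) = g z := by
    intro z
    rw [hez, add_sub_right_comm, map_add, map_smul, hν]
    simp
  have hπe : ∀ z, π (e z - p) = π (z - p) := by
    intro z
    apply Subtype.ext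
    rw [hπ, hπ, hge, hez]
    module
  have hι : ∀ x : l.ker, AnalyticAt ℝ (fun x : l.ker => p + (x : E)) x := fun x =>
    analyticAt_const.add (l.ker.subtypeL.analyticAt x)
  have heV : ∀ z ∈ e.source, z ∈ V := fun z hz => (heV' hz).2
  have hσa : ∀ x : l.ker, p + (x : E) ∈ e.target →
      AnalyticAt ℝ (fun x : l.ker => e.symm (p + x)) x := fun x hx =>
    AnalyticAt.comp (g := e.symm) (f := fun x : l.ker => p + (x : E)) (hes _ hx) (hι x)
  have hσg : ∀ x : l.ker, p + (x : E) ∈ e.target → g (e.symm (p + x)) = 0 := by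
    intro x hx
    rw [← hge, e.right_inv hx]
    simp
  have hσπ : ∀ x : l.ker, p + (x : E) ∈ e.target → π (e.symm (p + x) - p) = x := by
    intro x hx
    rw [← hπe, e.right_inv hx]
    apply Subtype.ext
    have : l (x : E) = 0 := x.2
    simp [hπ, this]
  have hΩo : IsOpen ((fun x : l.ker => p + (x : E)) ⁻¹' e.target) :=
    e.open_target.preimage (by fun_prop)
  refine ⟨π, (fun x : l.ker => p + (x : E)) ⁻¹' e.target, fun x => e.symm (p + x), e.source, hπ,
    hΩo, e.open_source, hpe, fun x hx => ⟨hσa x hx, heV _ (e.map_target hx), hσg x hx, hσπ x hx,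
      (heV' (e.map_target hx)).1.2, fun w => ?_⟩, fun z hz hgz => ?_⟩
  · set σ : l.ker → E := fun x => e.symm (p + x) with hσ
    have hd := (hσa x hx).differentiableAt.hasFDerivAt
    have hgd : HasFDerivAt g (fderiv ℝ g (σ x)) (σ x) :=
      (heV' (e.map_target hx)).1.1.differentiableAt.hasFDerivAt
    have hgν : fderiv ℝ g (σ x) ν ≠ 0 := (heV' (e.map_target hx)).1.2
    have hΩn := hΩo.mem_nhds hx
    have h1 : fderiv ℝ g (σ x) (fderiv ℝ σ x (π w)) = 0 := by
      have h2 : HasFDerivAt (fun x => g (σ x)) (0 : l.ker →L[ℝ] ℝ) x :=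
        (hasFDerivAt_const (0 : ℝ) x).congr_of_eventuallyEq (by
          filter_upwards [hΩn] with y hy using hσg y hy)
      exact DFunLike.congr_fun ((hgd.comp x hd).unique h2) (π w)
    have h3 : π (fderiv ℝ σ x (π w)) = π w := by
      have h2 : HasFDerivAt (fun x => π (σ x - p)) (ContinuousLinearMap.id ℝ l.ker) x :=
        (hasFDerivAt_id x).congr_of_eventuallyEq (by
          filter_upwards [hΩn] with y hy using hσπ y hy)
      exact DFunLike.congr_fun
        ((π.hasFDerivAt.comp x (hd.sub_const p)).unique h2) (π w)
    have h4 : fderiv ℝ σ x (π w) = w - (l (w - fderiv ℝ σ x (π w))) • ν := by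
      have h5 := congrArg (Subtype.val) h3
      rw [hπ, hπ] at h5
      rw [map_sub, sub_smul]
      exact (sub_eq_iff_eq_add.1 h5).trans (by abel)
    set c := l (w - fderiv ℝ σ x (π w)) with hc
    have h6 : fderiv ℝ g (σ x) w = c * fderiv ℝ g (σ x) ν := by
      rw [h4, map_sub, map_smul, smul_eq_mul] at h1
      linarith
    rw [h6]
    rw [show (fderiv ℝ g (σ x) ν)⁻¹ * (c * fderiv ℝ g (σ x) ν) = c by field_simp]
    exact h4
  · have : p + (π (z - p) : E) = e z := by
      rw [← hπe, hπ, hge, hgz]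
      simp
    refine ⟨?_, ?_⟩
    · rw [mem_preimage, this]
      exact e.map_source hz
    · simp only [this]
      exact e.left_inv hz

end Straightening

section NullImages

open MeasureTheory

/-- A set which is locally mapped onto null sets is mapped onto a null set. -/
theorem measure_image_null_of_locally_null {E G : Type*} [TopologicalSpace E]
    [SecondCountableTopology E] [MeasurableSpace G] (ν : Measure G) (f : E → G) (S : Set E)
    (h : ∀ p ∈ S, ∃ U ∈ 𝓝 p, ν (f '' (S ∩ U)) = 0) : ν (f '' S) = 0 := by
  choose! U hU hν using h
  obtain ⟨t, htS, htc, ht⟩ := TopologicalSpace.countable_cover_nhdsWithin (s := S)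
    (fun p hp => mem_nhdsWithin_of_mem_nhds (hU p hp))
  refine measure_mono_null (t := ⋃ p ∈ t, f '' (S ∩ U p)) ?_
    ((measure_biUnion_null_iff htc).2 fun p hp => hν p (htS hp))
  rintro _ ⟨p, hp, rfl⟩
  obtain ⟨q, hq, hpq⟩ := mem_iUnion₂.1 (ht hp)
  exact mem_iUnion₂.2 ⟨q, hq, p, ⟨hp, hpq⟩, rfl⟩

/-- Sard's theorem in equal dimensions: critical values form a null set. -/
theorem measure_image_null_of_fderiv_apply_eq_zero {H G : Type*} [NormedAddCommGroup H]
    [NormedSpace ℝ H] [FiniteDimensional ℝ H] [NormedAddCommGroup G] [NormedSpace ℝ G]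
    [FiniteDimensional ℝ G] [MeasurableSpace G] [BorelSpace G] (ν : Measure G)
    [ν.IsAddHaarMeasure] (hdim : Module.finrank ℝ H = Module.finrank ℝ G) {f : H → G} {s : Set H}
    (h : ∀ x ∈ s, DifferentiableAt ℝ f x ∧ ∃ v ≠ 0, fderiv ℝ f x v = 0) : ν (f '' s) = 0 := by
  let L : G ≃L[ℝ] H := ContinuousLinearEquiv.ofFinrankEq hdim.symm
  have himg : f '' s = (fun x => f (L x)) '' (L ⁻¹' s) := by
    ext y
    constructor
    · rintro ⟨x, hx, rfl⟩
      exact ⟨L.symm x, by simpa using hx, by simp⟩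
    · rintro ⟨x, hx, rfl⟩
      exact ⟨L x, hx, rfl⟩
  rw [himg]
  refine addHaar_image_eq_zero_of_det_fderivWithin_eq_zero ν
    (f' := fun x => (fderiv ℝ f (L x)).comp (L : G →L[ℝ] H)) (fun x hx => ?_) (fun x hx => ?_)
  · exact ((h _ hx).1.hasFDerivAt.comp x L.hasFDerivAt).hasFDerivWithinAt
  · obtain ⟨v, hv, hfv⟩ := (h _ hx).2
    change LinearMap.det (((fderiv ℝ f (L x)).comp (L : G →L[ℝ] H) : G →L[ℝ] G) : G →ₗ[ℝ] G) = 0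
    by_contra hne
    have hinj := (LinearMap.equivOfDetNeZero _ hne).injective
    have : L.symm v = 0 := by
      apply hinj
      rw [map_zero]
      simpa [LinearMap.equivOfDetNeZero] using hfv
    exact hv (by simpa using this)

end NullImages

section LinearFlow

universe u

variable {E : Type u} [NormedAddCommGroup E] [NormedSpace ℝ E]

/-- If `Φ` solves a linear equation along `Y`, so does the pair `(Φ, DΦ)`. -/
theorem exists_linear_equation_prod_fderiv [CompleteSpace E] {W : Type u} [NormedAddCommGroup W]
    [NormedSpace ℝ W] [CompleteSpace W] {T : Set E} (hT : IsOpen T) {Y : E → E} {Φ : E → W}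
    {A : E → W →L[ℝ] W} (hY : ∀ p ∈ T, AnalyticAt ℝ Y p) (hΦ : ∀ p ∈ T, AnalyticAt ℝ Φ p)
    (hA : ∀ p ∈ T, AnalyticAt ℝ A p) (hE : ∀ p ∈ T, fderiv ℝ Φ p (Y p) = A p (Φ p)) :
    ∃ A' : E → (W × (E →L[ℝ] W)) →L[ℝ] (W × (E →L[ℝ] W)), (∀ p ∈ T, AnalyticAt ℝ A' p) ∧
      ∀ p ∈ T, fderiv ℝ (fun z => (Φ z, fderiv ℝ Φ z)) p (Y p) = A' p (Φ p, fderiv ℝ Φ p) := by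
  let B₁ : (W →L[ℝ] W) →L[ℝ] (E →L[ℝ] W) →L[ℝ] (E →L[ℝ] W) := ContinuousLinearMap.compL ℝ E W W
  let B₂ : (E →L[ℝ] E) →L[ℝ] (E →L[ℝ] W) →L[ℝ] (E →L[ℝ] W) :=
    (ContinuousLinearMap.compL ℝ E E W).flip
  let B₃ : (E →L[ℝ] W →L[ℝ] W) →L[ℝ] W →L[ℝ] (E →L[ℝ] W) :=
    (ContinuousLinearMap.flipₗᵢ ℝ E W W).toContinuousLinearEquiv.toContinuousLinearMap
  let P₁ := ContinuousLinearMap.fst ℝ W (E →L[ℝ] W)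
  let P₂ := ContinuousLinearMap.snd ℝ W (E →L[ℝ] W)
  let I₁ := ContinuousLinearMap.inl ℝ W (E →L[ℝ] W)
  let I₂ := ContinuousLinearMap.inr ℝ W (E →L[ℝ] W)
  refine ⟨fun p => (I₁.comp ((A p).comp P₁)) + I₂.comp ((B₃ (fderiv ℝ A p)).comp P₁ +
    (B₁ (A p)).comp P₂ - (B₂ (fderiv ℝ Y p)).comp P₂), fun p hp => ?_, fun p hp => ?_⟩
  · have hAp := hA p hp
    have hc {U V : Type u} [NormedAddCommGroup U] [NormedSpace ℝ U] [NormedAddCommGroup V]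
        [NormedSpace ℝ V] {f : E → U} (hf : AnalyticAt ℝ f p) (P : U →L[ℝ] V) :
        AnalyticAt ℝ (fun z => P (f z)) p := (P.analyticAt _).comp hf
    have h1 : AnalyticAt ℝ (fun p => B₃ (fderiv ℝ A p)) p :=
      hc (U := E →L[ℝ] W →L[ℝ] W) (V := W →L[ℝ] E →L[ℝ] W) hAp.fderiv B₃
    have h2 : AnalyticAt ℝ (fun p => B₁ (A p)) p :=
      hc (U := W →L[ℝ] W) (V := (E →L[ℝ] W) →L[ℝ] E →L[ℝ] W) hAp B₁
    have h3 : AnalyticAt ℝ (fun p => B₂ (fderiv ℝ Y p)) p :=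
      hc (U := E →L[ℝ] E) (V := (E →L[ℝ] W) →L[ℝ] E →L[ℝ] W) (hY p hp).fderiv B₂
    have hr {U V Z : Type u} [NormedAddCommGroup U] [NormedSpace ℝ U] [NormedAddCommGroup V]
        [NormedSpace ℝ V] [NormedAddCommGroup Z] [NormedSpace ℝ Z] {f : E → V →L[ℝ] Z}
        (hf : AnalyticAt ℝ f p) (P : U →L[ℝ] V) : AnalyticAt ℝ (fun z => (f z).comp P) p :=
      (((ContinuousLinearMap.compL ℝ U V Z).flip P).analyticAt _).comp hf
    have hl {U V Z : Type u} [NormedAddCommGroup U] [NormedSpace ℝ U] [NormedAddCommGroup V]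
        [NormedSpace ℝ V] [NormedAddCommGroup Z] [NormedSpace ℝ Z] {f : E → U →L[ℝ] V}
        (hf : AnalyticAt ℝ f p) (P : V →L[ℝ] Z) : AnalyticAt ℝ (fun z => P.comp (f z)) p :=
      ((ContinuousLinearMap.compL ℝ U V Z P).analyticAt _).comp hf
    exact (hl (hr hAp P₁) I₁).add (hl (((hr h1 P₁).add (hr h2 P₂)).sub (hr h3 P₂)) I₂)
  · have hΦp := (hΦ p hp).differentiableAt.hasFDerivAt
    have hΦ'p := (hΦ p hp).fderiv.differentiableAt.hasFDerivAt
    have hYp := (hY p hp).differentiableAt.hasFDerivAt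
    have hAp := (hA p hp).differentiableAt.hasFDerivAt
    have hsymm : ∀ v w, fderiv ℝ (fderiv ℝ Φ) p v w = fderiv ℝ (fderiv ℝ Φ) p w v :=
      ((hΦ p hp).contDiffAt (n := 2)).isSymmSndFDerivAt (by simp)
    have hd := (hΦ'p.clm_apply hYp).unique ((hAp.clm_apply hΦp).congr_of_eventuallyEq (by
      filter_upwards [hT.mem_nhds hp] with z hz using hE z hz))
    rw [(hΦp.prodMk hΦ'p).fderiv]
    have hkey : fderiv ℝ (fderiv ℝ Φ) p (Y p) = (B₃ (fderiv ℝ A p)) (Φ p) +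
        (A p).comp (fderiv ℝ Φ p) - (fderiv ℝ Φ p).comp (fderiv ℝ Y p) := by
      ext e
      have := DFunLike.congr_fun hd e
      simp at this
      rw [hsymm]
      simp [B₃]
      rw [eq_sub_iff_add_eq, add_comm, this, add_comm]
    simp [hkey, hE p hp, I₁, I₂, P₁, P₂, B₁, B₂]

/-- A map into a normed space with nonvanishing derivative `DΦ p v` has a scalar component with
derivative one in that direction. -/
theorem exists_dual_apply_eq_one {W : Type*} [NormedAddCommGroup W] [NormedSpace ℝ W] {w : W}
    (hw : w ≠ 0) : ∃ l : W →L[ℝ] ℝ, l w = 1 := by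
  obtain ⟨f, hf⟩ := SeparatingDual.exists_ne_zero (R := ℝ) hw
  exact ⟨(f w)⁻¹ • f, by simp [hf]⟩

end LinearFlow

section Sard

open MeasureTheory

universe u

variable {E : Type u} [NormedAddCommGroup E] [NormedSpace ℝ E]

theorem finrank_ker_add_one_of_apply_eq_one [FiniteDimensional ℝ E] {l : E →L[ℝ] ℝ} {ν : E}
    (h : l ν = 1) : Module.finrank ℝ l.ker + 1 = Module.finrank ℝ E := by
  have hr : LinearMap.range (l : E →ₗ[ℝ] ℝ) = ⊤ := by
    rw [LinearMap.range_eq_top]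
    exact fun c => ⟨c • ν, by simp [h]⟩
  have := LinearMap.finrank_range_add_finrank_ker (l : E →ₗ[ℝ] ℝ)
  rw [hr, finrank_top, Module.finrank_self] at this
  rw [← this, add_comm]

theorem AnalyticAt.exists_iteratedFDeriv_ne_zero [CompleteSpace E] {W : Type*}
    [NormedAddCommGroup W] [NormedSpace ℝ W] [CompleteSpace W] {Φ : E → W} {p : E}
    (hΦ : AnalyticAt ℝ Φ p) (h : ¬ ∀ᶠ z in 𝓝 p, Φ z = 0) : ∃ n, iteratedFDeriv ℝ n Φ p ≠ 0 := by
  by_contra! h0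
  obtain ⟨q, R, hq⟩ := hΦ
  refine h ?_
  filter_upwards [Metric.eball_mem_nhds p hq.r_pos] with z hz
  have h1 := hq.hasSum_iteratedFDeriv (y := z - p) (by
    simpa [edist_eq_enorm_sub] using hz)
  simp only [h0, _root_.zero_apply, smul_zero, add_sub_cancel] at h1
  exact h1.unique hasSum_zero

theorem iteratedFDeriv_prod_fderiv_ne_zero [CompleteSpace E] {W : Type*} [NormedAddCommGroup W]
    [NormedSpace ℝ W] [CompleteSpace W] {Φ : E → W} {p : E} (hΦ : AnalyticAt ℝ Φ p) {n : ℕ}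
    (h : iteratedFDeriv ℝ (n + 1) Φ p ≠ 0) :
    iteratedFDeriv ℝ n (fun z => (Φ z, fderiv ℝ Φ z)) p ≠ 0 := by
  intro h0
  apply h
  have h1 : ContDiffAt ℝ n (fun z => (Φ z, fderiv ℝ Φ z)) p :=
    (hΦ.prod hΦ.fderiv).contDiffAt
  have h2 := (ContinuousLinearMap.snd ℝ W (E →L[ℝ] W)).iteratedFDeriv_comp_left h1 le_rfl
  have h3 : iteratedFDeriv ℝ n (fderiv ℝ Φ) p = 0 := by
    rw [h0] at h2
    refine h2.trans ?_
    ext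
    simp
  rw [iteratedFDeriv_succ_eq_comp_right, Function.comp_apply, h3]
  exact LinearIsometryEquiv.map_zero _

variable [FiniteDimensional ℝ E] {G : Type*} [NormedAddCommGroup G]
    [NormedSpace ℝ G] [FiniteDimensional ℝ G] [MeasurableSpace G] [BorelSpace G] (ν : Measure G)
    [ν.IsAddHaarMeasure]

/-- Local form: near a point where `DΦ ≠ 0`, the zero set of a solution `Φ` of a linear equation
along `Y` lies in a hypersurface tangent to `Y`, which a map invariant under `Y` sends to a null
set. -/
theorem exists_nhds_measure_image_null {W : Type u} [NormedAddCommGroup W]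
    [NormedSpace ℝ W] [CompleteSpace W] (hdim : Module.finrank ℝ E = Module.finrank ℝ G + 1)
    {T : Set E} (hT : IsOpen T) {Y : E → E} {Φ : E → W} {A : E → W →L[ℝ] W} {μ : E → G}
    (hΦ : ∀ p ∈ T, AnalyticAt ℝ Φ p)
    (hE : ∀ p ∈ T, fderiv ℝ Φ p (Y p) = A p (Φ p)) (hμ : ∀ p ∈ T, DifferentiableAt ℝ μ p)
    (hY0 : ∀ p ∈ T, Φ p = 0 → Y p ≠ 0) (hYμ : ∀ p ∈ T, Φ p = 0 → fderiv ℝ μ p (Y p) = 0)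
    {p : E} (hpT : p ∈ T) (hp : Φ p = 0) (hd : fderiv ℝ Φ p ≠ 0) :
    ∃ U ∈ 𝓝 p, ν (μ '' ({z ∈ T | Φ z = 0} ∩ U)) = 0 := by
  have : CompleteSpace E := FiniteDimensional.complete ℝ E
  obtain ⟨v, hv⟩ : ∃ v, fderiv ℝ Φ p v ≠ 0 := by
    by_contra! h
    exact hd (ContinuousLinearMap.ext h)
  obtain ⟨ℓ, hℓ⟩ := exists_dual_apply_eq_one hv
  have hgd : ∀ z ∈ T, fderiv ℝ (fun z => ℓ (Φ z)) z = ℓ.comp (fderiv ℝ Φ z) := fun z hz =>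
    (ℓ.hasFDerivAt.comp z (hΦ z hz).differentiableAt.hasFDerivAt).fderiv
  have hg : AnalyticAt ℝ (fun z => ℓ (Φ z)) p := (ℓ.analyticAt _).comp (hΦ p hpT)
  obtain ⟨π, Ω, σ, U, -, hΩ, hU, hpU, hσ, hUσ⟩ := exists_analytic_hypersurface_chart hg
    (by simp [hp]) (ν := v) (by simp [hgd p hpT, hℓ]) (hT.mem_nhds hpT)
  refine ⟨U, hU.mem_nhds hpU, ?_⟩
  have hdim' := finrank_ker_add_one_of_apply_eq_one (l := fderiv ℝ (fun z => ℓ (Φ z)) p) (ν := v)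
    (by simp [hgd p hpT, hℓ])
  refine measure_mono_null (t := (fun x => μ (σ x)) '' {x ∈ Ω | Φ (σ x) = 0}) ?_
    (measure_image_null_of_fderiv_apply_eq_zero ν (by omega) fun x hx => ?_)
  · rintro _ ⟨z, ⟨⟨hzT, hz0⟩, hzU⟩, rfl⟩
    obtain ⟨h1, h2⟩ := hUσ z hzU (by simp [hz0])
    exact ⟨_, ⟨h1, by rw [h2, hz0]⟩, by simp only [h2]⟩
  · obtain ⟨h1, h2, h3, h4, h5, h6⟩ := hσ x hx.1
    have hcomp := (hμ _ h2).hasFDerivAt.comp x h1.differentiableAt.hasFDerivAt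
    have hYt : fderiv ℝ σ x (π (Y (σ x))) = Y (σ x) := by
      rw [h6, hgd _ h2]
      simp [hE _ h2, hx.2]
    refine ⟨hcomp.differentiableAt, π (Y (σ x)), fun h0 => ?_, ?_⟩
    · rw [h0, map_zero] at hYt
      exact hY0 _ h2 hx.2 hYt.symm
    · rw [show fderiv ℝ (fun x => μ (σ x)) x = _ from hcomp.fderiv]
      simp [hYt, hYμ _ h2 hx.2]

theorem measure_image_null_of_iteratedFDeriv_ne_zero
    (hdim : Module.finrank ℝ E = Module.finrank ℝ G + 1)
    {T : Set E} (hT : IsOpen T) {Y : E → E} {μ : E → G} (hY : ∀ p ∈ T, AnalyticAt ℝ Y p)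
    (hμ : ∀ p ∈ T, DifferentiableAt ℝ μ p) (n : ℕ) :
    ∀ (W : Type u) [NormedAddCommGroup W] [NormedSpace ℝ W] [CompleteSpace W] (Φ : E → W)
      (A : E → W →L[ℝ] W), (∀ p ∈ T, AnalyticAt ℝ Φ p) → (∀ p ∈ T, AnalyticAt ℝ A p) →
      (∀ p ∈ T, fderiv ℝ Φ p (Y p) = A p (Φ p)) → (∀ p ∈ T, Φ p = 0 → Y p ≠ 0) →
      (∀ p ∈ T, Φ p = 0 → fderiv ℝ μ p (Y p) = 0) →
      ν (μ '' {p ∈ T | Φ p = 0 ∧ iteratedFDeriv ℝ n Φ p ≠ 0}) = 0 := by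
  have : CompleteSpace E := FiniteDimensional.complete ℝ E
  induction n with
  | zero =>
    intro W _ _ _ Φ A _ _ _ _ _
    rw [show {p ∈ T | Φ p = 0 ∧ iteratedFDeriv ℝ 0 Φ p ≠ 0} = ∅ from ?_, image_empty,
      measure_empty]
    refine eq_empty_of_forall_notMem fun p ⟨_, h0, h1⟩ => h1 ?_
    ext
    simp [h0]
  | succ n ih =>
    intro W _ _ _ Φ A hΦ hA hE hY0 hYμ
    obtain ⟨A', hA', hE'⟩ := exists_linear_equation_prod_fderiv hT hY hΦ hA hE
    have h1 := ih (W × (E →L[ℝ] W)) (fun z => (Φ z, fderiv ℝ Φ z)) A'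
      (fun p hp => (hΦ p hp).prod (hΦ p hp).fderiv) hA' hE'
      (fun p hp h0 => hY0 p hp (congrArg Prod.fst h0))
      (fun p hp h0 => hYμ p hp (congrArg Prod.fst h0))
    have h2 : ν (μ '' {p ∈ T | Φ p = 0 ∧ fderiv ℝ Φ p ≠ 0}) = 0 := by
      refine measure_image_null_of_locally_null ν μ _ ?_
      rintro p ⟨hpT, hp, hd⟩
      obtain ⟨U, hU, hUν⟩ :=
        exists_nhds_measure_image_null ν hdim hT hΦ hE hμ hY0 hYμ hpT hp hd
      refine ⟨U, hU, measure_mono_null (image_mono ?_) hUν⟩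
      exact fun z hz => ⟨⟨hz.1.1, hz.1.2.1⟩, hz.2⟩
    refine measure_mono_null ?_ (measure_union_null h2 h1)
    rw [← image_union]
    refine image_mono ?_
    rintro p ⟨hpT, hp, hd⟩
    by_cases h : fderiv ℝ Φ p = 0
    · exact Or.inr ⟨hpT, by simp [hp, h], iteratedFDeriv_prod_fderiv_ne_zero (hΦ p hpT) hd⟩
    · exact Or.inl ⟨hpT, hp, h⟩

/-- Sard-type theorem: if `Φ` solves a linear equation along `Y` and `μ` is invariant under `Y` on
`{Φ = 0}`, the image under `μ` of the points where `Φ` vanishes to finite order only is null. -/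
theorem measure_image_null_of_not_eventually_zero
    (hdim : Module.finrank ℝ E = Module.finrank ℝ G + 1)
    {T : Set E} (hT : IsOpen T) {Y : E → E} {μ : E → G} (hY : ∀ p ∈ T, AnalyticAt ℝ Y p)
    (hμ : ∀ p ∈ T, DifferentiableAt ℝ μ p)
    {W : Type u} [NormedAddCommGroup W] [NormedSpace ℝ W] [CompleteSpace W] {Φ : E → W}
    {A : E → W →L[ℝ] W} (hΦ : ∀ p ∈ T, AnalyticAt ℝ Φ p) (hA : ∀ p ∈ T, AnalyticAt ℝ A p)
    (hE : ∀ p ∈ T, fderiv ℝ Φ p (Y p) = A p (Φ p)) (hY0 : ∀ p ∈ T, Φ p = 0 → Y p ≠ 0)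
    (hYμ : ∀ p ∈ T, Φ p = 0 → fderiv ℝ μ p (Y p) = 0) :
    ν (μ '' {p ∈ T | Φ p = 0 ∧ ¬ ∀ᶠ z in 𝓝 p, Φ z = 0}) = 0 := by
  have : CompleteSpace E := FiniteDimensional.complete ℝ E
  refine measure_mono_null (t := ⋃ n : ℕ, μ '' {p ∈ T | Φ p = 0 ∧ iteratedFDeriv ℝ n Φ p ≠ 0}) ?_
    (measure_iUnion_null fun n => measure_image_null_of_iteratedFDeriv_ne_zero ν hdim hT hY hμ n W
      Φ A hΦ hA hE hY0 hYμ)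
  rintro _ ⟨p, ⟨hpT, hp, hne⟩, rfl⟩
  obtain ⟨n, hn⟩ := (hΦ p hpT).exists_iteratedFDeriv_ne_zero hne
  exact mem_iUnion.2 ⟨n, p, ⟨hpT, hp, hn⟩, rfl⟩

end Sard

section GoodZeros

universe u

theorem AnalyticAt.clm_comp {E U V : Type*} [NormedAddCommGroup E] [NormedSpace ℝ E]
    [NormedAddCommGroup U] [NormedSpace ℝ U] [NormedAddCommGroup V] [NormedSpace ℝ V] {f : E → U}
    {p : E} (L : U →L[ℝ] V) (hf : AnalyticAt ℝ f p) : AnalyticAt ℝ (fun z => L (f z)) p :=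
  (L.analyticAt _).comp hf

theorem AnalyticAt.clm_comp₂ {E U V Z : Type*} [NormedAddCommGroup E] [NormedSpace ℝ E]
    [NormedAddCommGroup U] [NormedSpace ℝ U] [NormedAddCommGroup V] [NormedSpace ℝ V]
    [NormedAddCommGroup Z] [NormedSpace ℝ Z] {f : E → U} {g : E → V} {p : E}
    (L : U →L[ℝ] V →L[ℝ] Z) (hf : AnalyticAt ℝ f p) (hg : AnalyticAt ℝ g p) :
    AnalyticAt ℝ (fun z => L (f z) (g z)) p :=
  (L.analyticAt_bilinear _).comp (hf.prod hg)

theorem AnalyticAt.clm_apply_const {E U V : Type*} [NormedAddCommGroup E] [NormedSpace ℝ E]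
    [NormedAddCommGroup U] [NormedSpace ℝ U] [NormedAddCommGroup V] [NormedSpace ℝ V]
    {f : E → U →L[ℝ] V} {p : E} (hf : AnalyticAt ℝ f p) (u : U) :
    AnalyticAt ℝ (fun z => f z u) p :=
  hf.clm_comp (ContinuousLinearMap.apply ℝ V u)

variable {E : Type u} [NormedAddCommGroup E] [NormedSpace ℝ E]

/-- Near a regular point of `g`, factors of `g` can be cancelled in continuous identities. -/
theorem eq_zero_of_pow_smul_eventually_eq_zero {W : Type*} [NormedAddCommGroup W] [NormedSpace ℝ W]
    {g : E → ℝ} {f : E → W} {z : E} (hg : fderiv ℝ g z ≠ 0) (hf : ContinuousAt f z) (k : ℕ)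
    (h : ∀ᶠ w in 𝓝 z, g w ^ k • f w = 0) : f z = 0 := by
  by_contra hne
  apply hg
  have h0 : g =ᶠ[𝓝 z] fun _ => (0 : ℝ) := by
    filter_upwards [h, hf.eventually_ne hne] with w hw hfw
    exact by_contra fun hgw => pow_ne_zero k hgw ((smul_eq_zero.1 hw).resolve_right hfw)
  rw [h0.fderiv_eq]
  simp

theorem eventually_eq_zero_of_pow_smul [CompleteSpace E] {W : Type*} [NormedAddCommGroup W]
    [NormedSpace ℝ W] [CompleteSpace W] {g : E → ℝ} {f : E → W} {p : E} (hg : AnalyticAt ℝ g p)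
    (hd : fderiv ℝ g p ≠ 0) (hf : AnalyticAt ℝ f p) (k : ℕ)
    (h : ∀ᶠ w in 𝓝 p, g w ^ k • f w = 0) : ∀ᶠ w in 𝓝 p, f w = 0 := by
  filter_upwards [h.eventually_nhds, hf.eventually_analyticAt,
    hg.fderiv.continuousAt.eventually_ne hd] with z hz hfz hgz
  exact eq_zero_of_pow_smul_eventually_eq_zero hgz hfz.continuousAt k hz

/-- `Φ` factors at `p` through a power of a regular function `g`, whose level set is tangent to `Y`
and transverse to the level set of `μ`. -/
def HasTransverseFactorization {W : Type*} [NormedAddCommGroup W] [NormedSpace ℝ W]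
    (Y : E → E) (μ : E → ℝ) (Φ : E → W) (p : E) : Prop :=
  ∃ (g : E → ℝ) (m : ℕ) (K : E → W), AnalyticAt ℝ g p ∧ AnalyticAt ℝ K p ∧ g p = 0 ∧
    fderiv ℝ g p ≠ 0 ∧ fderiv ℝ g p (Y p) = 0 ∧ (∃ w, fderiv ℝ g p w = 0 ∧ fderiv ℝ μ p w ≠ 0) ∧
    K p ≠ 0 ∧ ∀ᶠ z in 𝓝 p, Φ z = g z ^ m • K z

theorem HasTransverseFactorization.of_prod_fderiv [CompleteSpace E] {W : Type*}
    [NormedAddCommGroup W] [NormedSpace ℝ W] [CompleteSpace W] {Y : E → E} {μ : E → ℝ} {Φ : E → W}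
    {p : E} (h0 : Φ p = 0) (h1 : fderiv ℝ Φ p = 0)
    (h : HasTransverseFactorization Y μ (fun z => (Φ z, fderiv ℝ Φ z)) p) :
    HasTransverseFactorization Y μ Φ p := by
  obtain ⟨g, m, N, hg, hN, hgp, hd, hdY, hw, hNp, he⟩ := h
  obtain ⟨k, rfl⟩ : ∃ k, m = k + 1 := by
    refine Nat.exists_eq_succ_of_ne_zero ?_
    rintro rfl
    have := he.self_of_nhds
    simp only [h0, h1, pow_zero, one_smul] at this
    exact hNp this.symm
  have hN₁ : AnalyticAt ℝ (fun z => (N z).1) p := hN.clm_comp (ContinuousLinearMap.fst ℝ _ _)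
  have hN₂ : AnalyticAt ℝ (fun z => (N z).2) p := hN.clm_comp (ContinuousLinearMap.snd ℝ _ _)
  let R := ContinuousLinearMap.smulRightL ℝ E W
  have hΦ₁ : ∀ᶠ z in 𝓝 p, Φ z = g z ^ (k + 1) • (N z).1 := by
    filter_upwards [he] with z hz using congrArg Prod.fst hz
  have hΦ₂ : ∀ᶠ z in 𝓝 p, fderiv ℝ Φ z = g z ^ (k + 1) • (N z).2 := by
    filter_upwards [he] with z hz using congrArg Prod.snd hz
  have hA₁ : AnalyticAt ℝ (fun z => g z • (N z).2 - (((k + 1 : ℕ) : ℝ) •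
      R (fderiv ℝ g z) (N z).1 + g z • fderiv ℝ (fun z => (N z).1) z)) p :=
    (hg.fun_smul hN₂).fun_sub
      (((hg.fderiv.clm_comp₂ R hN₁).fun_const_smul).fun_add (hg.fun_smul hN₁.fderiv))
  have hE₁ := eventually_eq_zero_of_pow_smul hg hd hA₁ k (by
    filter_upwards [hΦ₁.eventually_nhds, hΦ₂, hg.eventually_analyticAt,
      hN₁.eventually_analyticAt] with z hz₁ hz₂ hgz hNz
    have hD := ((hgz.differentiableAt.hasFDerivAt.pow (k + 1)).smul
      hNz.differentiableAt.hasFDerivAt).congr_of_eventuallyEq hz₁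
    have := hz₂.symm.trans hD.fderiv
    ext e
    have h2 := DFunLike.congr_fun this e
    simp only [_root_.smul_apply, _root_.add_apply, ContinuousLinearMap.smulRight_apply] at h2
    change g z ^ k • (g z • (N z).2 e - (((k + 1 : ℕ) : ℝ) • (fderiv ℝ g z e • (N z).1) +
      g z • fderiv ℝ (fun z => (N z).1) z e)) = 0
    rw [← sub_eq_zero] at h2
    rw [← h2]
    simp only [Nat.add_sub_cancel, nsmul_eq_mul, smul_eq_mul]
    module)
  obtain ⟨K, hK, hKe⟩ := hN₁.exists_eq_smul_of_regular hg hgp hd (by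
    filter_upwards [hE₁, hg.fderiv.continuousAt.eventually_ne hd] with z hz hdz hgz
    obtain ⟨v, hv⟩ : ∃ v, fderiv ℝ g z v ≠ 0 := by
      by_contra! h
      exact hdz (ContinuousLinearMap.ext h)
    have h2 := DFunLike.congr_fun hz v
    simp [hgz, R, hv] at h2
    exact h2.resolve_left (by positivity))
  have hA₂ : AnalyticAt ℝ (fun z => (N z).2 - (((k + 2 : ℕ) : ℝ) •
      R (fderiv ℝ g z) (K z) + g z • fderiv ℝ K z)) p :=
    hN₂.fun_sub (((hg.fderiv.clm_comp₂ R hK).fun_const_smul).fun_add (hg.fun_smul hK.fderiv))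
  have hE₂ := eventually_eq_zero_of_pow_smul hg hd hA₂ 1 (by
    filter_upwards [hKe.eventually_nhds, hE₁, hg.eventually_analyticAt,
      hK.eventually_analyticAt] with z hz₁ hz₂ hgz hKz
    have hD := (hgz.differentiableAt.hasFDerivAt.smul
      hKz.differentiableAt.hasFDerivAt).congr_of_eventuallyEq hz₁
    rw [hD.fderiv, hz₁.self_of_nhds] at hz₂
    rw [← hz₂]
    ext e
    simp [R]
    module)
  refine ⟨g, k + 2, K, hg, hK, hgp, hd, hdY, hw, fun hK0 => hNp ?_, ?_⟩
  · have h2 := hE₂.self_of_nhds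
    have h3 := hKe.self_of_nhds
    simp [hK0, hgp] at h2 h3
    exact Prod.ext h3 h2
  · filter_upwards [hΦ₁, hKe] with z h2 h3
    rw [h2, h3, smul_smul, ← pow_succ]

end GoodZeros

section GoodZerosMeasure

open MeasureTheory

universe u

variable {E : Type u} [NormedAddCommGroup E] [NormedSpace ℝ E]

theorem measure_image_null_of_fderiv_eventually_eq_zero [SecondCountableTopology E] (μ : E → ℝ) :
    volume (μ '' {x | ∀ᶠ z in 𝓝 x, DifferentiableAt ℝ μ z ∧ fderiv ℝ μ z = 0}) = 0 := by
  refine measure_image_null_of_locally_null volume μ _ fun p hp => ?_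
  obtain ⟨ε, hε, hball⟩ := Metric.eventually_nhds_iff_ball.1 hp
  refine ⟨Metric.ball p ε, Metric.ball_mem_nhds p hε,
    measure_mono_null (t := {μ p}) ?_ (measure_singleton _)⟩
  rintro _ ⟨z, ⟨-, hz⟩, rfl⟩
  exact Metric.isOpen_ball.is_const_of_fderiv_eq_zero (𝕜 := ℝ)
    (convex_ball p ε).isPreconnected (fun w hw => (hball w hw).1.differentiableWithinAt)
    (fun w hw => (hball w hw).2) hz (Metric.mem_ball_self hε)

variable [FiniteDimensional ℝ E]

/-- The critical values of a function invariant under a nowhere vanishing planar vector field form a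
null set. -/
theorem measure_image_critical_null {H : Type u} [NormedAddCommGroup H] [NormedSpace ℝ H]
    [FiniteDimensional ℝ H] (hdim : Module.finrank ℝ H = 2) {Ω : Set H} (hΩ : IsOpen Ω)
    {y : H → H} {m : H → ℝ} (hy : ∀ x ∈ Ω, AnalyticAt ℝ y x) (hm : ∀ x ∈ Ω, AnalyticAt ℝ m x)
    (hy0 : ∀ x ∈ Ω, y x ≠ 0) (hym : ∀ x ∈ Ω, fderiv ℝ m x (y x) = 0) :
    volume (m '' {x ∈ Ω | fderiv ℝ m x = 0}) = 0 := by
  have : CompleteSpace H := FiniteDimensional.complete ℝ H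
  have hHdim : Module.finrank ℝ H = Module.finrank ℝ ℝ + 1 := by
    rw [Module.finrank_self, hdim]
  let L : (H →L[ℝ] H) →L[ℝ] (H →L[ℝ] ℝ) →L[ℝ] (H →L[ℝ] ℝ) :=
    -(ContinuousLinearMap.compL ℝ H H ℝ).flip
  have hA : ∀ x ∈ Ω, AnalyticAt ℝ (fun x => L (fderiv ℝ y x)) x := fun x hx =>
    AnalyticAt.clm_comp (U := H →L[ℝ] H) (V := (H →L[ℝ] ℝ) →L[ℝ] (H →L[ℝ] ℝ)) L (hy x hx).fderiv
  have hnull₂ := measure_image_null_of_not_eventually_zero (volume : Measure ℝ) hHdim hΩ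
    (Y := y) (Φ := fderiv ℝ m) (μ := m) (A := fun x => L (fderiv ℝ y x)) hy
    (fun x hx => (hm x hx).differentiableAt) (fun x hx => (hm x hx).fderiv) hA
    (fun x hx => by
      have h1 := (hm x hx).fderiv.differentiableAt.hasFDerivAt.clm_apply
        (hy x hx).differentiableAt.hasFDerivAt
      have h2 := h1.unique ((hasFDerivAt_const (0 : ℝ) x).congr_of_eventuallyEq (by
        filter_upwards [hΩ.mem_nhds hx] with z hz using hym z hz))
      have hsymm : ∀ a b, fderiv ℝ (fderiv ℝ m) x a b = fderiv ℝ (fderiv ℝ m) x b a :=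
        ((hm x hx).contDiffAt (n := 2)).isSymmSndFDerivAt (by simp)
      ext e
      have h3 := DFunLike.congr_fun h2 e
      have hL : L (fderiv ℝ y x) (fderiv ℝ m x) e = -fderiv ℝ m x (fderiv ℝ y x e) := rfl
      rw [hL, hsymm]
      exact eq_neg_of_add_eq_zero_right h3)
    (fun x hx _ => hy0 x hx) (fun x hx _ => hym x hx)
  have hnull₃ := measure_image_null_of_fderiv_eventually_eq_zero m
  refine measure_mono_null ?_ (measure_union_null hnull₂ hnull₃)
  rw [← image_union]
  refine image_mono ?_
  rintro x ⟨hxΩ, hc⟩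
  by_cases hcc : ∀ᶠ z in 𝓝 x, fderiv ℝ m z = 0
  · right
    filter_upwards [hcc, hΩ.mem_nhds hxΩ] with w hw hwΩ
    exact ⟨(hm w hwΩ).differentiableAt, hw⟩
  · exact Or.inl ⟨hxΩ, hc, hcc⟩

theorem exists_linear_equation_chart {H : Type u} [NormedAddCommGroup H] [NormedSpace ℝ H]
    {W : Type u} [NormedAddCommGroup W] [NormedSpace ℝ W] [CompleteSpace W]
    {T : Set E} {Y : E → E} {Φ : E → W} {A : E → W →L[ℝ] W} (hΦ : ∀ p ∈ T, AnalyticAt ℝ Φ p)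
    (hA : ∀ p ∈ T, AnalyticAt ℝ A p) (hE : ∀ p ∈ T, fderiv ℝ Φ p (Y p) = A p (Φ p))
    {ℓ : W →L[ℝ] ℝ} {v : E} {π : E →L[ℝ] H} {Ω : Set H} {σ : H → E}
    (hσa : ∀ x ∈ Ω, AnalyticAt ℝ σ x) (hσT : ∀ x ∈ Ω, σ x ∈ T)
    (hσv : ∀ x ∈ Ω, ℓ (fderiv ℝ Φ (σ x) v) ≠ 0)
    (hσd : ∀ x ∈ Ω, ∀ w, fderiv ℝ σ x (π w) =
      w - ((ℓ (fderiv ℝ Φ (σ x) v))⁻¹ * ℓ (fderiv ℝ Φ (σ x) w)) • v) :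
    ∃ A' : H → W →L[ℝ] W, (∀ x ∈ Ω, AnalyticAt ℝ A' x) ∧ ∀ x ∈ Ω,
      fderiv ℝ (fun x => Φ (σ x)) x (π (Y (σ x))) = A' x (Φ (σ x)) := by
  have : CompleteSpace E := FiniteDimensional.complete ℝ E
  refine ⟨fun x => A (σ x) - (ℓ (fderiv ℝ Φ (σ x) v))⁻¹ • ContinuousLinearMap.smulRightL ℝ W W
    (ContinuousLinearMap.compL ℝ W W ℝ ℓ (A (σ x))) (fderiv ℝ Φ (σ x) v), fun x hx => ?_,
    fun x hx => ?_⟩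
  · have h1 : AnalyticAt ℝ (fun x => A (σ x)) x :=
      AnalyticAt.comp (g := A) (f := σ) (hA _ (hσT x hx)) (hσa x hx)
    have h2 : AnalyticAt ℝ (fun x => fderiv ℝ Φ (σ x) v) x :=
      (AnalyticAt.comp (g := fderiv ℝ Φ) (f := σ) (hΦ _ (hσT x hx)).fderiv
        (hσa x hx)).clm_apply_const v
    have h3 : AnalyticAt ℝ (fun x => (ℓ (fderiv ℝ Φ (σ x) v))⁻¹) x :=
      (h2.clm_comp ℓ).fun_inv (hσv x hx)
    exact h1.fun_sub (h3.fun_smul ((h1.clm_comp (ContinuousLinearMap.compL ℝ W W ℝ ℓ)).clm_comp₂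
      (ContinuousLinearMap.smulRightL ℝ W W) h2))
  · have h1 : fderiv ℝ (fun x => Φ (σ x)) x = (fderiv ℝ Φ (σ x)).comp (fderiv ℝ σ x) :=
      ((hΦ _ (hσT x hx)).differentiableAt.hasFDerivAt.comp x
        (hσa x hx).differentiableAt.hasFDerivAt).fderiv
    rw [h1, ContinuousLinearMap.comp_apply, hσd x hx, map_sub, map_smul, hE _ (hσT x hx)]
    simp [smul_smul]

/-- On a hypersurface chart `σ` containing the zeros of a solution `Φ` of a linear equation along
`Y`, almost every value of the invariant function `μ` is regular and is attained only where `Φ`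
vanishes on the whole hypersurface. -/
theorem measure_image_chart_null {H : Type u} [NormedAddCommGroup H] [NormedSpace ℝ H]
    [FiniteDimensional ℝ H] {W : Type u}
    [NormedAddCommGroup W] [NormedSpace ℝ W] [CompleteSpace W] (hdim : Module.finrank ℝ H = 2)
    {T : Set E} {Y : E → E} {Φ : E → W} {A : E → W →L[ℝ] W} {μ : E → ℝ}
    (hY : ∀ p ∈ T, AnalyticAt ℝ Y p) (hΦ : ∀ p ∈ T, AnalyticAt ℝ Φ p)
    (hA : ∀ p ∈ T, AnalyticAt ℝ A p)
    (hE : ∀ p ∈ T, fderiv ℝ Φ p (Y p) = A p (Φ p)) (hμ : ∀ p ∈ T, AnalyticAt ℝ μ p)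
    (hY0 : ∀ p ∈ T, Φ p = 0 → Y p ≠ 0) (hYμ : ∀ p ∈ T, Φ p = 0 → fderiv ℝ μ p (Y p) = 0)
    {ℓ : W →L[ℝ] ℝ} {v : E} {π : E →L[ℝ] H} {Ω : Set H} {σ : H → E} (hΩ : IsOpen Ω)
    (hσa : ∀ x ∈ Ω, AnalyticAt ℝ σ x) (hσT : ∀ x ∈ Ω, σ x ∈ T)
    (hσv : ∀ x ∈ Ω, ℓ (fderiv ℝ Φ (σ x) v) ≠ 0)
    (hσd : ∀ x ∈ Ω, ∀ w, fderiv ℝ σ x (π w) =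
      w - ((ℓ (fderiv ℝ Φ (σ x) v))⁻¹ * ℓ (fderiv ℝ Φ (σ x) w)) • v) :
    volume ((fun x => μ (σ x)) '' {x ∈ Ω | Φ (σ x) = 0 ∧
      ¬ ((∀ᶠ z in 𝓝 x, Φ (σ z) = 0) ∧ fderiv ℝ (fun x => μ (σ x)) x ≠ 0)}) = 0 := by
  have : CompleteSpace E := FiniteDimensional.complete ℝ E
  have : CompleteSpace H := FiniteDimensional.complete ℝ H
  have hHdim : Module.finrank ℝ H = Module.finrank ℝ ℝ + 1 := by
    rw [Module.finrank_self, hdim]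
  have hm : ∀ x ∈ Ω, AnalyticAt ℝ (fun x => μ (σ x)) x := fun x hx =>
    AnalyticAt.comp (g := μ) (f := σ) (hμ _ (hσT x hx)) (hσa x hx)
  have hψ : ∀ x ∈ Ω, AnalyticAt ℝ (fun x => Φ (σ x)) x := fun x hx =>
    AnalyticAt.comp (g := Φ) (f := σ) (hΦ _ (hσT x hx)) (hσa x hx)
  have hy : ∀ x ∈ Ω, AnalyticAt ℝ (fun x => π (Y (σ x))) x := fun x hx =>
    (AnalyticAt.comp (g := Y) (f := σ) (hY _ (hσT x hx)) (hσa x hx)).clm_comp π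
  have hdσ : ∀ x ∈ Ω, Φ (σ x) = 0 → fderiv ℝ σ x (π (Y (σ x))) = Y (σ x) := by
    intro x hx h0
    rw [hσd x hx]
    simp [hE _ (hσT x hx), h0]
  have hy0 : ∀ x ∈ Ω, Φ (σ x) = 0 → π (Y (σ x)) ≠ 0 := by
    intro x hx h0 hz
    have := hdσ x hx h0
    rw [hz, map_zero] at this
    exact hY0 _ (hσT x hx) h0 this.symm
  have hDm : ∀ x ∈ Ω, fderiv ℝ (fun x => μ (σ x)) x = (fderiv ℝ μ (σ x)).comp (fderiv ℝ σ x) :=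
    fun x hx => ((hμ _ (hσT x hx)).differentiableAt.hasFDerivAt.comp x
      (hσa x hx).differentiableAt.hasFDerivAt).fderiv
  have hym : ∀ x ∈ Ω, Φ (σ x) = 0 → fderiv ℝ (fun x => μ (σ x)) x (π (Y (σ x))) = 0 := by
    intro x hx h0
    rw [hDm x hx]
    simp [hdσ x hx h0, hYμ _ (hσT x hx) h0]
  obtain ⟨A', hA', hE'⟩ := exists_linear_equation_chart hΦ hA hE hσa hσT hσv hσd
  have hnull₁ := measure_image_null_of_not_eventually_zero (volume : Measure ℝ) hHdim hΩ
    (Y := fun x => π (Y (σ x))) (Φ := fun x => Φ (σ x)) (μ := fun x => μ (σ x)) hy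
    (fun x hx => (hm x hx).differentiableAt) hψ hA' hE' hy0 hym
  have hnull₂ := measure_image_critical_null hdim
    (Ω := {x | x ∈ Ω ∧ ∀ᶠ z in 𝓝 x, Φ (σ z) = 0}) (hΩ.inter isOpen_setOfPred_eventually_nhds)
    (fun x hx => hy x hx.1) (fun x hx => hm x hx.1)
    (fun x hx => hy0 x hx.1 hx.2.self_of_nhds) (fun x hx => hym x hx.1 hx.2.self_of_nhds)
  refine measure_mono_null ?_ (measure_union_null hnull₁ hnull₂)
  rw [← image_union]
  refine image_mono ?_
  rintro x ⟨hxΩ, hx0, hx⟩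
  by_cases hev : ∀ᶠ w in 𝓝 x, Φ (σ w) = 0
  · exact Or.inr ⟨⟨hxΩ, hev⟩, by_contra fun hc => hx ⟨hev, hc⟩⟩
  · exact Or.inl ⟨hxΩ, hx0, hev⟩

theorem exists_nhds_measure_image_not_hasTransverseFactorization {W : Type u}
    [NormedAddCommGroup W] [NormedSpace ℝ W] [CompleteSpace W] (hdim : Module.finrank ℝ E = 3)
    {T : Set E} (hT : IsOpen T) {Y : E → E} {Φ : E → W} {A : E → W →L[ℝ] W} {μ : E → ℝ}
    (hY : ∀ p ∈ T, AnalyticAt ℝ Y p) (hΦ : ∀ p ∈ T, AnalyticAt ℝ Φ p)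
    (hA : ∀ p ∈ T, AnalyticAt ℝ A p)
    (hE : ∀ p ∈ T, fderiv ℝ Φ p (Y p) = A p (Φ p)) (hμ : ∀ p ∈ T, AnalyticAt ℝ μ p)
    (hY0 : ∀ p ∈ T, Φ p = 0 → Y p ≠ 0) (hYμ : ∀ p ∈ T, Φ p = 0 → fderiv ℝ μ p (Y p) = 0)
    {p : E} (hpT : p ∈ T) (hp : Φ p = 0) (hd : fderiv ℝ Φ p ≠ 0) :
    ∃ U ∈ 𝓝 p, volume
      (μ '' ({z ∈ T | Φ z = 0 ∧ ¬ HasTransverseFactorization Y μ Φ z} ∩ U)) = 0 := by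
  have : CompleteSpace E := FiniteDimensional.complete ℝ E
  obtain ⟨v, hv⟩ : ∃ v, fderiv ℝ Φ p v ≠ 0 := by
    by_contra! h
    exact hd (ContinuousLinearMap.ext h)
  obtain ⟨ℓ, hℓ⟩ := exists_dual_apply_eq_one hv
  set g : E → ℝ := fun z => ℓ (Φ z) with hgdef
  have hgd : ∀ z ∈ T, fderiv ℝ g z = ℓ.comp (fderiv ℝ Φ z) := fun z hz =>
    (ℓ.hasFDerivAt.comp z (hΦ z hz).differentiableAt.hasFDerivAt).fderiv
  have hg : ∀ z ∈ T, AnalyticAt ℝ g z := fun z hz => (hΦ z hz).clm_comp ℓ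
  have hv1 : fderiv ℝ g p v = 1 := by simp [hgd p hpT, hℓ]
  obtain ⟨π, Ω, σ, U, -, hΩ, hU, hpU, hσ, hUσ⟩ := exists_analytic_hypersurface_chart (hg p hpT)
    (by simp [hgdef, hp]) hv1 (hT.mem_nhds hpT)
  refine ⟨U, hU.mem_nhds hpU, ?_⟩
  have hdim' := finrank_ker_add_one_of_apply_eq_one hv1
  have hσT : ∀ x ∈ Ω, σ x ∈ T := fun x hx => (hσ x hx).2.1
  have hσa : ∀ x ∈ Ω, AnalyticAt ℝ σ x := fun x hx => (hσ x hx).1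
  have hnull := measure_image_chart_null (H := (fderiv ℝ g p).ker)
    (by omega) hY hΦ hA hE hμ hY0 hYμ hΩ hσa hσT (ℓ := ℓ)
    (v := v) (π := π)
    (fun x hx => by simpa [hgd _ (hσT x hx)] using (hσ x hx).2.2.2.2.1)
    (fun x hx w => by simpa [hgd _ (hσT x hx)] using (hσ x hx).2.2.2.2.2 w)
  refine measure_mono_null ?_ hnull
  rintro _ ⟨z, ⟨⟨hzT, hz0, hzg⟩, hzU⟩, rfl⟩
  obtain ⟨hxΩ, hxz⟩ := hUσ z hzU (by simp [hgdef, hz0])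
  set x := π (z - p) with hx
  refine ⟨x, ⟨hxΩ, by rw [hxz, hz0], fun ⟨hev, hDne⟩ => hzg ?_⟩, by simp only [hxz]⟩
  have hgz : fderiv ℝ g z v ≠ 0 := hxz ▸ (hσ x hxΩ).2.2.2.2.1
  have hgz' : fderiv ℝ g z ≠ 0 := fun h => hgz (by simp [h])
  have hgz0 : g z = 0 := by simp [hgdef, hz0]
  obtain ⟨K, hK, hKe⟩ := (hΦ z hzT).exists_eq_smul_of_regular (hg z hzT) hgz0 hgz' (by
    have hc : Tendsto (fun w => π (w - p)) (𝓝 z) (𝓝 x) :=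
      (π.continuous.comp (continuous_id.sub continuous_const)).tendsto z
    filter_upwards [hc.eventually hev, hU.mem_nhds hzU] with w hw hwU hgw
    rw [← (hUσ w hwU hgw).2]
    exact hw)
  have hKD : HasFDerivAt Φ (g z • fderiv ℝ K z + (fderiv ℝ g z).smulRight (K z)) z :=
    ((hg z hzT).differentiableAt.hasFDerivAt.smul
      hK.differentiableAt.hasFDerivAt).congr_of_eventuallyEq hKe
  refine ⟨g, 1, K, hg z hzT, hK, hgz0, hgz', ?_, ?_, fun hK0 => hgz ?_, ?_⟩
  · rw [hgd z hzT]
    simp [hE z hzT, hz0]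
  · obtain ⟨u, hu⟩ : ∃ u, fderiv ℝ (fun x => μ (σ x)) x u ≠ 0 := by
      by_contra! h
      exact hDne (ContinuousLinearMap.ext h)
    refine ⟨fderiv ℝ σ x u, ?_, ?_⟩
    · have h1 : HasFDerivAt (fun x => g (σ x)) (0 : (fderiv ℝ g p).ker →L[ℝ] ℝ) x :=
        (hasFDerivAt_const (0 : ℝ) x).congr_of_eventuallyEq (by
          filter_upwards [hΩ.mem_nhds hxΩ] with w hw using (hσ w hw).2.2.1)
      have h2 := ((hg _ (hσT x hxΩ)).differentiableAt.hasFDerivAt.comp x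
        (hσa x hxΩ).differentiableAt.hasFDerivAt).unique h1
      rw [hxz] at h2
      exact DFunLike.congr_fun h2 u
    · have hDm := ((hμ _ (hσT x hxΩ)).differentiableAt.hasFDerivAt.comp x
        (hσa x hxΩ).differentiableAt.hasFDerivAt).fderiv
      rw [show fderiv ℝ (fun x => μ (σ x)) x = _ from hDm, hxz] at hu
      exact hu
  · rw [hgd z hzT, hKD.fderiv]
    simp [hK0, hgz0]
  · filter_upwards [hKe] with w hw
    rw [hw, pow_one]

theorem measure_image_not_hasTransverseFactorization_of_iteratedFDeriv_ne_zero
    (hdim : Module.finrank ℝ E = 3) {T : Set E} (hT : IsOpen T) {Y : E → E} {μ : E → ℝ}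
    (hY : ∀ p ∈ T, AnalyticAt ℝ Y p) (hμ : ∀ p ∈ T, AnalyticAt ℝ μ p) (n : ℕ) :
    ∀ (W : Type u) [NormedAddCommGroup W] [NormedSpace ℝ W] [CompleteSpace W] (Φ : E → W)
      (A : E → W →L[ℝ] W), (∀ p ∈ T, AnalyticAt ℝ Φ p) → (∀ p ∈ T, AnalyticAt ℝ A p) →
      (∀ p ∈ T, fderiv ℝ Φ p (Y p) = A p (Φ p)) → (∀ p ∈ T, Φ p = 0 → Y p ≠ 0) →
      (∀ p ∈ T, Φ p = 0 → fderiv ℝ μ p (Y p) = 0) →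
      volume (μ '' {p ∈ T | Φ p = 0 ∧ iteratedFDeriv ℝ n Φ p ≠ 0 ∧
        ¬ HasTransverseFactorization Y μ Φ p}) = 0 := by
  have : CompleteSpace E := FiniteDimensional.complete ℝ E
  induction n with
  | zero =>
    intro W _ _ _ Φ A _ _ _ _ _
    rw [show {p ∈ T | Φ p = 0 ∧ iteratedFDeriv ℝ 0 Φ p ≠ 0 ∧
      ¬ HasTransverseFactorization Y μ Φ p} = ∅ from ?_, image_empty, measure_empty]
    refine eq_empty_of_forall_notMem fun p ⟨_, h0, h1, _⟩ => h1 ?_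
    ext
    simp [h0]
  | succ n ih =>
    intro W _ _ _ Φ A hΦ hA hE hY0 hYμ
    obtain ⟨A', hA', hE'⟩ := exists_linear_equation_prod_fderiv hT hY hΦ hA hE
    have h1 := ih (W × (E →L[ℝ] W)) (fun z => (Φ z, fderiv ℝ Φ z)) A'
      (fun p hp => (hΦ p hp).prod (hΦ p hp).fderiv) hA' hE'
      (fun p hp h0 => hY0 p hp (congrArg Prod.fst h0))
      (fun p hp h0 => hYμ p hp (congrArg Prod.fst h0))
    have h2 : volume (μ '' {p ∈ T | Φ p = 0 ∧ fderiv ℝ Φ p ≠ 0 ∧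
        ¬ HasTransverseFactorization Y μ Φ p}) = 0 := by
      refine measure_image_null_of_locally_null volume μ _ ?_
      rintro p ⟨hpT, hp, hd, -⟩
      obtain ⟨U, hU, hUν⟩ := exists_nhds_measure_image_not_hasTransverseFactorization hdim hT hY hΦ
        hA hE hμ hY0 hYμ hpT hp hd
      refine ⟨U, hU, measure_mono_null (image_mono ?_) hUν⟩
      exact fun z hz => ⟨⟨hz.1.1, hz.1.2.1, hz.1.2.2.2⟩, hz.2⟩
    refine measure_mono_null ?_ (measure_union_null h2 h1)
    rw [← image_union]
    refine image_mono ?_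
    rintro p ⟨hpT, hp, hd, hng⟩
    by_cases h : fderiv ℝ Φ p = 0
    · exact Or.inr ⟨hpT, by simp [hp, h], iteratedFDeriv_prod_fderiv_ne_zero (hΦ p hpT) hd,
        fun hg => hng (hg.of_prod_fderiv hp h)⟩
    · exact Or.inl ⟨hpT, hp, h, hng⟩

/-- For almost every value of a function `μ` invariant under `Y` along `{Φ = 0}`, the solution `Φ`
of a linear equation along `Y` factors transversally at its zeros of finite order. -/
theorem measure_image_not_hasTransverseFactorization
    (hdim : Module.finrank ℝ E = 3) {T : Set E} (hT : IsOpen T) {Y : E → E} {μ : E → ℝ}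
    (hY : ∀ p ∈ T, AnalyticAt ℝ Y p) (hμ : ∀ p ∈ T, AnalyticAt ℝ μ p)
    {W : Type u} [NormedAddCommGroup W] [NormedSpace ℝ W] [CompleteSpace W] {Φ : E → W}
    {A : E → W →L[ℝ] W} (hΦ : ∀ p ∈ T, AnalyticAt ℝ Φ p) (hA : ∀ p ∈ T, AnalyticAt ℝ A p)
    (hE : ∀ p ∈ T, fderiv ℝ Φ p (Y p) = A p (Φ p)) (hY0 : ∀ p ∈ T, Φ p = 0 → Y p ≠ 0)
    (hYμ : ∀ p ∈ T, Φ p = 0 → fderiv ℝ μ p (Y p) = 0) :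
    volume (μ '' {p ∈ T | Φ p = 0 ∧ (¬ ∀ᶠ z in 𝓝 p, Φ z = 0) ∧
      ¬ HasTransverseFactorization Y μ Φ p}) = 0 := by
  have : CompleteSpace E := FiniteDimensional.complete ℝ E
  refine measure_mono_null (t := ⋃ n : ℕ, μ '' {p ∈ T | Φ p = 0 ∧ iteratedFDeriv ℝ n Φ p ≠ 0 ∧
    ¬ HasTransverseFactorization Y μ Φ p}) ?_ (measure_iUnion_null fun n =>
    measure_image_not_hasTransverseFactorization_of_iteratedFDeriv_ne_zero hdim hT hY hμ n W
      Φ A hΦ hA hE hY0 hYμ)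
  rintro _ ⟨p, ⟨hpT, hp, hne, hng⟩, rfl⟩
  obtain ⟨n, hn⟩ := (hΦ p hpT).exists_iteratedFDeriv_ne_zero hne
  exact mem_iUnion.2 ⟨n, p, ⟨hpT, hp, hn, hng⟩, rfl⟩

end GoodZerosMeasure

section DeterminantPolynomial

variable {E : Type*} [NormedAddCommGroup E] [NormedSpace ℝ E] [FiniteDimensional ℝ E]

theorem ContinuousLinearMap.exists_det_one_add_smul (hdim : Module.finrank ℝ E = 3)
    (A : E →L[ℝ] E) :
    ∃ a b c : ℝ, ∀ t : ℝ, (1 + t • A).det = 1 + a * t + b * t ^ 2 + c * t ^ 3 := by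
  let B := Module.finBasisOfFinrankEq ℝ E hdim
  set m := LinearMap.toMatrix B B (A : E →ₗ[ℝ] E) with hm
  have hdet : ∀ t : ℝ, (1 + t • A).det = (1 + t • m).det := fun t => by
    rw [ContinuousLinearMap.det, ← LinearMap.det_toMatrix B, hm]
    congr 1
    rw [ContinuousLinearMap.toLinearMap_add, ContinuousLinearMap.toLinearMap_smul,
      ContinuousLinearMap.toLinearMap_one, map_add, map_smul, LinearMap.toMatrix_one]
  refine ⟨m 0 0 + m 1 1 + m 2 2,
    m 0 0 * m 1 1 - m 0 1 * m 1 0 + m 0 0 * m 2 2 - m 0 2 * m 2 0 + m 1 1 * m 2 2 - m 1 2 * m 2 1,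
    m.det, fun t => ?_⟩
  rw [hdet, Matrix.det_fin_three, Matrix.det_fin_three]
  simp
  ring

theorem ContinuousLinearMap.exists_det_one_add_eq_sum (hdim : Module.finrank ℝ E = 3) {h : ℝ}
    (hh : h ≠ 0) :
    ∃ c : Fin 4 → ℝ, ∑ k, c k = 1 ∧
      ∀ A : E →L[ℝ] E, (1 + A).det = ∑ k, c k * (1 + ((k : ℕ) * h) • A).det := by
  refine ⟨![-(h⁻¹ - 1) * (h⁻¹ - 2) * (h⁻¹ - 3) / 6, h⁻¹ * (h⁻¹ - 2) * (h⁻¹ - 3) / 2,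
    -h⁻¹ * (h⁻¹ - 1) * (h⁻¹ - 3) / 2, h⁻¹ * (h⁻¹ - 1) * (h⁻¹ - 2) / 6], ?_, fun A => ?_⟩
  · simp [Fin.sum_univ_four]
    ring
  · obtain ⟨a, b, c, habc⟩ := ContinuousLinearMap.exists_det_one_add_smul hdim A
    have h1 := habc 1
    rw [one_smul] at h1
    rw [h1]
    simp only [habc, Fin.sum_univ_four]
    simp
    field_simp
    ring

theorem ContinuousLinearMap.exists_forall_norm_lt_det_one_add_pos (E : Type*)
    [NormedAddCommGroup E] [NormedSpace ℝ E] [FiniteDimensional ℝ E] :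
    ∃ δ > 0, ∀ A : E →L[ℝ] E, ‖A‖ < δ → 0 < (1 + A).det := by
  have hc : Continuous fun A : E →L[ℝ] E => (1 + A).det :=
    ContinuousLinearMap.continuous_det.comp (continuous_const.add continuous_id)
  have h0 : 0 < (1 + (0 : E →L[ℝ] E)).det := by
    rw [add_zero, ContinuousLinearMap.det, ContinuousLinearMap.toLinearMap_one, map_one]
    exact one_pos
  obtain ⟨δ, hδ, h⟩ := Metric.eventually_nhds_iff.1
    (hc.continuousAt.eventually (lt_mem_nhds h0))
  exact ⟨δ, hδ, fun A hA => h (by simpa using hA)⟩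

end DeterminantPolynomial

section NoRetraction

open MeasureTheory Metric

variable {E : Type*} [NormedAddCommGroup E] [InnerProductSpace ℝ E]

theorem injOn_add_smul_of_norm_fderiv_le {g : E → E} {s : Set E} (hs : Convex ℝ s) {C t : ℝ}
    (hg : ∀ p ∈ s, DifferentiableAt ℝ g p) (hC : ∀ p ∈ s, ‖fderiv ℝ g p‖ ≤ C) (ht : 0 ≤ t)
    (htC : t * C < 1) : InjOn (fun p => p + t • g p) s := by
  intro x hx y hy hxy
  by_contra hne
  have hpos : 0 < ‖x - y‖ := norm_pos_iff.2 (sub_ne_zero.2 hne)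
  have hb := hs.norm_image_sub_le_of_norm_fderiv_le hg hC hy hx
  have heq : x - y = -(t • (g x - g y)) := by
    rw [smul_sub]
    have hxy' : x + t • g x = y + t • g y := hxy
    rw [← sub_eq_zero] at hxy' ⊢
    rw [← hxy']
    abel
  have hle : ‖x - y‖ ≤ t * C * ‖x - y‖ := by
    conv_lhs => rw [heq, norm_neg, norm_smul, Real.norm_of_nonneg ht]
    rw [mul_assoc]
    gcongr
  nlinarith

variable [FiniteDimensional ℝ E]

theorem image_add_smul_ball_eq_ball {g : E → E} {r t : ℝ} (hr : 0 < r)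
    (hg : ∀ p ∈ closedBall (0 : E) r, ContDiffAt ℝ 1 g p)
    (hsph : ∀ p, ‖p‖ = r → g p = 0) (hmaps : ∀ p ∈ closedBall (0 : E) r, ‖p + g p‖ ≤ r)
    (ht : 0 ≤ t) (ht1 : t < 1)
    (hdet : ∀ p ∈ closedBall (0 : E) r, (1 + t • fderiv ℝ g p).det ≠ 0) :
    (fun p => p + t • g p) '' ball 0 r = ball 0 r := by
  set f : E → E := fun p => p + t • g p with hf
  have hsub : f '' ball 0 r ⊆ ball 0 r := by
    rintro _ ⟨p, hp, rfl⟩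
    rw [mem_ball_zero_iff] at hp ⊢
    have heq : f p = (1 - t) • p + t • (p + g p) := by
      simp only [hf]; module
    have h1 := hmaps p (by simpa using hp.le)
    calc ‖f p‖ ≤ (1 - t) * ‖p‖ + t * ‖p + g p‖ := by
          rw [heq]
          refine (norm_add_le _ _).trans_eq ?_
          rw [norm_smul, norm_smul, Real.norm_of_nonneg ht,
            Real.norm_of_nonneg (sub_nonneg.2 ht1.le)]
      _ < r := by nlinarith
  have hcont : ContinuousOn f (closedBall 0 r) := fun p hp =>
    (continuousAt_id.add ((hg p hp).continuousAt.const_smul t)).continuousWithinAt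
  have hcl : IsClosed (f '' closedBall 0 r) :=
    ((isCompact_closedBall 0 r).image_of_continuousOn hcont).isClosed
  have hder : ∀ p ∈ closedBall (0 : E) r,
      HasStrictFDerivAt f (1 + t • fderiv ℝ g p : E →L[ℝ] E) p := fun p hp =>
    (hasStrictFDerivAt_id p).add (((hg p hp).hasStrictFDerivAt one_ne_zero).const_smul t)
  have hopen : IsOpen (f '' ball 0 r) := by
    rw [isOpen_iff_mem_nhds]
    rintro _ ⟨p, hp, rfl⟩
    have hpB := ball_subset_closedBall hp
    rw [← (hder p hpB).map_nhds_eq_of_surj]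
    · exact image_mem_map (isOpen_ball.mem_nhds hp)
    · exact (LinearMap.equivOfDetNeZero (1 + t • fderiv ℝ g p : E →L[ℝ] E).toLinearMap
        (hdet p hpB)).range
  refine hsub.antisymm ((convex_ball 0 r).isPreconnected.subset_left_of_subset_union hopen
    hcl.isOpen_compl ?_ ?_ ?_)
  · exact disjoint_compl_right.mono_left (image_mono ball_subset_closedBall)
  · intro q hq
    by_cases h : q ∈ f '' closedBall 0 r
    · obtain ⟨p, hp, rfl⟩ := h
      refine Or.inl ⟨p, ?_, rfl⟩
      rw [mem_ball_zero_iff]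
      refine lt_of_le_of_ne (by simpa using hp) fun h => ?_
      rw [mem_ball_zero_iff] at hq
      simp only [hf, hsph p h, smul_zero, add_zero] at hq
      exact hq.ne h
    · exact Or.inr h
  · have h0 : (0 : E) ∈ ball (0 : E) r := mem_ball_self hr
    exact ⟨f 0, hsub (mem_image_of_mem f h0), mem_image_of_mem f h0⟩

variable [MeasurableSpace E] [BorelSpace E]

theorem setIntegral_det_one_add_smul_fderiv {g : E → E} {r t C : ℝ} (hr : 0 < r)
    (hg : ∀ p ∈ closedBall (0 : E) r, ContDiffAt ℝ 1 g p)
    (hsph : ∀ p, ‖p‖ = r → g p = 0) (hmaps : ∀ p ∈ closedBall (0 : E) r, ‖p + g p‖ ≤ r)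
    (hC : ∀ p ∈ closedBall (0 : E) r, ‖fderiv ℝ g p‖ ≤ C)
    (ht : 0 ≤ t) (ht1 : t < 1) (htC : t * C < 1)
    (hdet : ∀ p ∈ closedBall (0 : E) r, 0 < (1 + t • fderiv ℝ g p).det) :
    ∫ p in ball (0 : E) r, (1 + t • fderiv ℝ g p).det = volume.real (ball (0 : E) r) := by
  have himg := image_add_smul_ball_eq_ball hr hg hsph hmaps ht ht1 fun p hp => (hdet p hp).ne'
  have hchange := integral_image_eq_integral_abs_det_fderiv_smul (f := fun p => p + t • g p)
    (f' := fun p => 1 + t • fderiv ℝ g p) (volume : Measure E) measurableSet_ball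
    (fun p hp => (((hasFDerivAt_id p).add
      ((((hg p (ball_subset_closedBall hp)).differentiableAt one_ne_zero).hasFDerivAt).const_smul
        t)).hasFDerivWithinAt : HasFDerivWithinAt _ _ _ _))
    (injOn_add_smul_of_norm_fderiv_le (convex_ball 0 r)
      (fun p hp => (hg p (ball_subset_closedBall hp)).differentiableAt one_ne_zero)
      (fun p hp => hC p (ball_subset_closedBall hp)) ht htC) (fun _ => (1 : ℝ))
  rw [himg] at hchange
  simp only [integral_const, smul_eq_mul, mul_one, measureReal_restrict_apply_univ] at hchange
  rw [hchange]
  refine setIntegral_congr_fun measurableSet_ball fun p hp => ?_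
  exact (abs_of_pos (hdet p (ball_subset_closedBall hp))).symm

theorem setIntegral_det_one_add_fderiv (hdim : Module.finrank ℝ E = 3) {g : E → E} {r : ℝ}
    (hr : 0 < r) (hg : ∀ p ∈ closedBall (0 : E) r, ContDiffAt ℝ 1 g p)
    (hsph : ∀ p, ‖p‖ = r → g p = 0) (hmaps : ∀ p ∈ closedBall (0 : E) r, ‖p + g p‖ ≤ r) :
    ∫ p in ball (0 : E) r, (1 + fderiv ℝ g p).det = volume.real (ball (0 : E) r) := by
  have hcont : ContinuousOn (fderiv ℝ g) (closedBall 0 r) := fun p hp =>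
    ((hg p hp).fderiv_right (m := 0) (by norm_num)).continuousAt.continuousWithinAt
  obtain ⟨C, hC⟩ := (isCompact_closedBall (0 : E) r).exists_bound_of_continuousOn hcont
  have hC0 : 0 ≤ C := (norm_nonneg _).trans (hC 0 (mem_closedBall_self hr.le))
  obtain ⟨δ, hδ, hpos⟩ := ContinuousLinearMap.exists_forall_norm_lt_det_one_add_pos E
  set h : ℝ := min δ 1 / (4 * (C + 1)) with hh
  have hm : 0 < min δ 1 := lt_min hδ one_pos
  have hh0 : 0 < h := by positivity
  have hhC : 4 * (h * (C + 1)) = min δ 1 := by rw [hh]; field_simp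
  have hsmall : ∀ k : Fin 4, 0 ≤ (k : ℕ) * h ∧ (k : ℕ) * h < 1 ∧ (k : ℕ) * h * C < min δ 1 := by
    intro k
    have hk : ((k : ℕ) : ℝ) ≤ 3 := by
      have := k.2
      exact_mod_cast (by lia : (k : ℕ) ≤ 3)
    have hk0 : (0 : ℝ) ≤ (k : ℕ) := Nat.cast_nonneg _
    have hm1 : min δ 1 ≤ 1 := min_le_right _ _
    refine ⟨by positivity, by nlinarith, ?_⟩
    nlinarith [mul_nonneg hh0.le hC0]
  obtain ⟨c, hc1, hc⟩ := ContinuousLinearMap.exists_det_one_add_eq_sum hdim hh0.ne'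
  have hint : ∀ t : ℝ, IntegrableOn (fun p => (1 + t • fderiv ℝ g p).det) (ball (0 : E) r) :=
    fun t => ((ContinuousLinearMap.continuous_det.comp_continuousOn
      (continuousOn_const.add (hcont.const_smul t))).integrableOn_compact
        (isCompact_closedBall 0 r)).mono_set ball_subset_closedBall
  rw [integral_congr_ae (Eventually.of_forall fun p => hc (fderiv ℝ g p)),
    integral_finsetSum _ fun k _ => (hint _).const_mul _]
  simp only [integral_const_mul]
  have hk : ∀ k : Fin 4, ∫ p in ball (0 : E) r, (1 + ((k : ℕ) * h) • fderiv ℝ g p).det =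
      volume.real (ball (0 : E) r) := fun k => by
    obtain ⟨h1, h2, h3⟩ := hsmall k
    refine setIntegral_det_one_add_smul_fderiv hr hg hsph hmaps hC h1 h2
      (h3.trans_le (min_le_right _ _)) fun p hp => hpos _ ?_
    rw [norm_smul, Real.norm_of_nonneg h1]
    exact (mul_le_mul_of_nonneg_left (hC p hp) h1).trans_lt (h3.trans_le (min_le_left _ _))
  simp only [hk, ← Finset.sum_mul, hc1, one_mul]

/-- There is no `C¹` retraction of a three-dimensional closed ball onto its boundary sphere. -/
theorem not_exists_contDiffAt_retraction (hdim : Module.finrank ℝ E = 3) {f : E → E} {r : ℝ}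
    (hr : 0 < r) (hf : ∀ p ∈ closedBall (0 : E) r, ContDiffAt ℝ 1 f p)
    (hsph : ∀ p, ‖p‖ = r → f p = p) (hnorm : ∀ p ∈ closedBall (0 : E) r, ‖f p‖ = r) : False := by
  have h := setIntegral_det_one_add_fderiv hdim (g := fun p => f p - p) hr
    (fun p hp => (hf p hp).sub contDiffAt_id) (fun p hp => by simp [hsph p hp])
    (fun p hp => by simp [hnorm p hp])
  have h0 : ∀ p ∈ ball (0 : E) r, (1 + fderiv ℝ (fun p => f p - p) p).det = 0 := by
    intro p hp
    have hpB := ball_subset_closedBall hp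
    have hd := (hf p hpB).differentiableAt one_ne_zero
    have hfd : 1 + fderiv ℝ (fun p => f p - p) p = fderiv ℝ f p := by
      rw [fderiv_fun_sub hd differentiableAt_fun_id, fderiv_fun_id]
      exact add_sub_cancel _ _
    rw [hfd]
    by_contra hdet
    have hconst : (fun z => ⟪f z, f z⟫) =ᶠ[𝓝 p] fun _ => r ^ 2 := by
      filter_upwards [isOpen_ball.mem_nhds hp] with z hz
      rw [real_inner_self_eq_norm_sq, hnorm z (ball_subset_closedBall hz)]
    obtain ⟨u, hu⟩ := (LinearMap.equivOfDetNeZero (fderiv ℝ f p).toLinearMap hdet).surjective (f p)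
    have hu' : fderiv ℝ f p u = f p := hu
    have hder := (hd.hasFDerivAt.inner ℝ hd.hasFDerivAt).fderiv
    rw [hconst.fderiv_eq, fderiv_const_apply] at hder
    have := congrArg (fun L => L u) hder
    simp [hu', hnorm p hpB] at this
    nlinarith [pow_pos hr 2]
  rw [setIntegral_congr_fun measurableSet_ball h0, integral_zero] at h
  exact (ENNReal.toReal_pos (measure_ball_pos volume (0 : E) hr).ne' measure_ball_lt_top.ne).ne h

end NoRetraction

section InwardFields

open Metric

variable {E : Type*} [NormedAddCommGroup E] [InnerProductSpace ℝ E] [FiniteDimensional ℝ E]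

theorem exists_eq_zero_of_contDiff_of_inward (hdim : Module.finrank ℝ E = 3) {F : E → E} {r : ℝ}
    (hr : 0 < r) (hF : ContDiff ℝ 1 F) (hin : ∀ p, ‖p‖ = r → ⟪F p, p⟫ < 0) :
    ∃ p ∈ closedBall (0 : E) r, F p = 0 := by
  borelize E
  by_contra! hne
  set d : E → ℝ := fun p => ⟪F p, p⟫ ^ 2 + ‖F p‖ ^ 2 * (r ^ 2 - ‖p‖ ^ 2) with hd
  have hdpos : ∀ p ∈ closedBall (0 : E) r, 0 < d p := by
    intro p hp
    rw [mem_closedBall_zero_iff] at hp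
    have hFp : 0 < ‖F p‖ := norm_pos_iff.2 (hne p (by simpa using hp))
    rcases hp.lt_or_eq with h | h
    · have : 0 < r ^ 2 - ‖p‖ ^ 2 := by nlinarith [norm_nonneg p]
      positivity
    · have hlt := hin p h
      have := pow_pos (neg_pos.2 hlt) 2
      rw [neg_sq] at this
      simp only [hd, h, sub_self, mul_zero, add_zero]
      exact this
  set s : E → ℝ := fun p => (⟪F p, p⟫ + √(d p)) / ‖F p‖ ^ 2 with hs
  refine not_exists_contDiffAt_retraction hdim (f := fun p => p - s p • F p) hr ?_ ?_ ?_
  · intro p hp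
    have hin' : ContDiffAt ℝ 1 (fun p => ⟪F p, p⟫) p := hF.contDiffAt.inner ℝ contDiffAt_id
    have hnF : ContDiffAt ℝ 1 (fun p => ‖F p‖ ^ 2) p := hF.contDiffAt.norm_sq ℝ
    have hdc : ContDiffAt ℝ 1 d p :=
      (hin'.pow 2).add (hnF.mul (contDiffAt_const.sub (contDiffAt_id.norm_sq ℝ)))
    exact contDiffAt_id.sub ((((hin'.add (hdc.sqrt (hdpos p hp).ne')).div hnF
      (by simpa using hne p hp))).smul hF.contDiffAt)
  · intro p hp
    have : s p = 0 := by
      simp only [hs, hd, hp, sub_self, mul_zero, add_zero]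
      rw [Real.sqrt_sq_eq_abs, abs_of_neg (hin p hp)]
      simp
    simp [this]
  · intro p hp
    have hFp : ‖F p‖ ^ 2 ≠ 0 := by simpa using hne p hp
    have hsq := Real.sq_sqrt (hdpos p hp).le
    have hsF : s p * ‖F p‖ ^ 2 = ⟪F p, p⟫ + √(d p) := div_mul_cancel₀ _ hFp
    have hsq2 : ‖p - s p • F p‖ ^ 2 = r ^ 2 := by
      rw [norm_sub_sq_real, norm_smul, mul_pow, Real.norm_eq_abs, sq_abs, inner_smul_right,
        real_inner_comm]
      refine mul_right_cancel₀ hFp ?_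
      simp only [hd] at hsq hsF
      rw [real_inner_comm] at hsq hsF
      rw [real_inner_comm]
      set w := √(⟪p, F p⟫ ^ 2 + ‖F p‖ ^ 2 * (r ^ 2 - ‖p‖ ^ 2))
      linear_combination (s p * ‖F p‖ ^ 2 - ⟪p, F p⟫ + w) * hsF + hsq
    exact (pow_left_inj₀ (norm_nonneg _) hr.le two_ne_zero).1 hsq2

/-- A continuous vector field on a three-dimensional closed ball pointing strictly inward on the
boundary sphere has a zero. -/
theorem exists_eq_zero_of_continuousOn_of_inward (hdim : Module.finrank ℝ E = 3) {F : E → E}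
    {r : ℝ} (hr : 0 < r) (hF : ContinuousOn F (closedBall 0 r))
    (hin : ∀ p, ‖p‖ = r → ⟪F p, p⟫ < 0) : ∃ p ∈ closedBall (0 : E) r, F p = 0 := by
  by_contra! hne
  obtain ⟨m, hm, hmF⟩ := (isCompact_closedBall (0 : E) r).exists_forall_le' hF.norm
    (a := 0) fun p hp => norm_pos_iff.2 (hne p hp)
  obtain ⟨k, hk, hkF⟩ := (isCompact_sphere (0 : E) r).exists_forall_le'
    (f := fun p => -⟪F p, p⟫) ((hF.mono sphere_subset_closedBall).inner continuousOn_id).neg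
    (a := 0) fun p hp => by simpa using hin p (by simpa using hp)
  obtain ⟨f, hf⟩ := ContinuousMap.exists_restrict_eq (isClosed_closedBall (x := (0 : E)) (ε := r))
    ⟨_, hF.domRestrict⟩
  have hfF : ∀ p ∈ closedBall (0 : E) r, f p = F p := fun p hp =>
    congrArg (fun φ => φ ⟨p, hp⟩) hf
  obtain ⟨g, hg, hfg⟩ := (mem_closure_iff_nhds_basis (nhds_basis_uniformity
    Metric.uniformity_basis_dist.compactConvergenceUniformity)).1
    (ContinuousMap.dense_setOfPred_contDiff (E := E) (F := E) f) (closedBall 0 r, min m (k / r))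
    ⟨isCompact_closedBall 0 r, lt_min hm (div_pos hk hr)⟩
  have hg1 : ContDiff ℝ 1 g := ContDiff.of_le (mem_ofPred_eq ▸ hg) (by exact_mod_cast le_top)
  have hgF : ∀ p ∈ closedBall (0 : E) r, ‖g p - F p‖ < min m (k / r) := fun p hp => by
    rw [← hfF p hp, ← dist_eq_norm]
    exact hfg p hp
  obtain ⟨p, hp, hgp⟩ := exists_eq_zero_of_contDiff_of_inward hdim (F := g) hr hg1
    fun p hp => by
      have hpB : p ∈ closedBall (0 : E) r := by simp [hp]
      have h1 := hkF p (by simpa using hp)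
      have h2 : ⟪g p, p⟫ = ⟪F p, p⟫ + ⟪g p - F p, p⟫ := by rw [inner_sub_left]; ring
      have h3 := real_inner_le_norm (g p - F p) p
      have h4 := (hgF p hpB).trans_le (min_le_right _ _)
      rw [lt_div_iff₀ hr] at h4
      rw [hp] at h3
      linarith
  have h := (hgF p hp).trans_le (min_le_left _ _)
  rw [hgp, zero_sub, norm_neg] at h
  exact (hmF p hp).not_gt h

end InwardFields

section CollinearFields

open Metric

variable {E ι : Type*} [NormedAddCommGroup E] [InnerProductSpace ℝ E] [Fintype ι]

/-- The average of the orthogonal projections onto the lines spanned by the vectors `v i`, weighted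
by the squared norms. -/
noncomputable def weightedProj (v : ι → E) : E →L[ℝ] E :=
  (∑ i, ‖v i‖ ^ 2)⁻¹ • ∑ i, (innerSL ℝ (v i)).smulRight (v i)

theorem weightedProj_apply_of_collinear {v : ι → E} {i : ι} (hi : v i ≠ 0)
    (h : ∀ j, ⟪v i, v i⟫ • v j = ⟪v i, v j⟫ • v i) (u : E) :
    weightedProj v u = (⟪v i, u⟫ / ⟪v i, v i⟫) • v i := by
  have hvi : ⟪v i, v i⟫ ≠ 0 := inner_self_ne_zero.2 hi
  set c : ι → ℝ := fun j => ⟪v i, v j⟫ / ⟪v i, v i⟫ with hc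
  have hv : ∀ j, v j = c j • v i := fun j => by
    simp only [hc]
    rw [div_eq_inv_mul, mul_smul, ← h j, inv_smul_smul₀ hvi]
  have hci : c i = 1 := div_self hvi
  have hpos : 0 < ∑ j, c j ^ 2 :=
    Finset.sum_pos' (fun j _ => sq_nonneg _) ⟨i, Finset.mem_univ _, by rw [hci]; norm_num⟩
  have hnorm : ∑ j, ‖v j‖ ^ 2 = (∑ j, c j ^ 2) * ⟪v i, v i⟫ := by
    rw [Finset.sum_mul]
    refine Finset.sum_congr rfl fun j _ => ?_
    rw [hv j, norm_smul, mul_pow, Real.norm_eq_abs, sq_abs, real_inner_self_eq_norm_sq]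
  have hsum : ∑ j, ⟪v j, u⟫ • v j = ((∑ j, c j ^ 2) * ⟪v i, u⟫) • v i := by
    rw [Finset.sum_mul, Finset.sum_smul]
    refine Finset.sum_congr rfl fun j _ => ?_
    rw [hv j, real_inner_smul_left, smul_smul]
    congr 1
    ring
  rw [weightedProj, _root_.smul_apply, _root_.sum_apply]
  simp only [ContinuousLinearMap.smulRight_apply, innerSL_apply_apply]
  rw [hnorm, hsum, smul_smul]
  congr 1
  field_simp

theorem ContinuousOn.weightedProj {α : Type*} [TopologicalSpace α] {s : Set α} {v : ι → α → E}
    (hv : ∀ i, ContinuousOn (v i) s) (hne : ∀ p ∈ s, ∃ i, v i p ≠ 0) :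
    ContinuousOn (fun p => weightedProj fun i => v i p) s := by
  refine ContinuousOn.smul (ContinuousOn.inv₀ (continuousOn_finsetSum _ fun i _ =>
    (hv i).norm.pow 2)
    fun p hp => ?_) (continuousOn_finsetSum _ fun i _ => ?_)
  · obtain ⟨i, hi⟩ := hne p hp
    simp only [Pi.pow_apply]
    exact (Finset.sum_pos' (f := fun j => ‖v j p‖ ^ 2) (fun j _ => sq_nonneg _)
      ⟨i, Finset.mem_univ _, pow_pos (norm_pos_iff.2 hi) 2⟩).ne'
  · exact ((ContinuousLinearMap.smulRightL ℝ E E).continuous.comp_continuousOn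
      ((innerSL ℝ).continuous.comp_continuousOn (hv i))).clm_apply (hv i)

/-- Over a closed ball the line field spanned by collinear continuous fields without common zero
has a continuous nonvanishing section. -/
theorem exists_continuousOn_section_of_collinear [FiniteDimensional ℝ E] [Nontrivial E] {r : ℝ}
    {Y : ι → E → E} (hY : ∀ i, ContinuousOn (Y i) (closedBall 0 r))
    (hcol : ∀ i j, ∀ p ∈ closedBall (0 : E) r, ⟪Y i p, Y i p⟫ • Y j p = ⟪Y i p, Y j p⟫ • Y i p)
    (hne : ∀ p ∈ closedBall (0 : E) r, ∃ i, Y i p ≠ 0) :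
    ∃ L : E → E, ContinuousOn L (closedBall 0 r) ∧
      ∀ p ∈ closedBall (0 : E) r, L p ≠ 0 ∧ weightedProj (fun i => Y i p) (L p) = L p := by
  rcases lt_or_ge r 0 with hr | hr
  · exact ⟨0, by simp [closedBall_eq_empty.2 hr], by simp [closedBall_eq_empty.2 hr]⟩
  set P : E → E →L[ℝ] E := fun p => weightedProj fun i => Y i p with hP
  have hPc : ContinuousOn P (closedBall 0 r) := ContinuousOn.weightedProj hY hne
  have hPP : ∀ p ∈ closedBall (0 : E) r, ∀ u, P p (P p u) = P p u := fun p hp u => by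
    obtain ⟨i, hi⟩ := hne p hp
    have hii : ⟪Y i p, Y i p⟫ ≠ 0 := inner_self_ne_zero.2 hi
    simp only [hP]
    rw [weightedProj_apply_of_collinear (v := fun i => Y i p) hi (fun j => hcol i j p hp),
      weightedProj_apply_of_collinear (v := fun i => Y i p) hi (fun j => hcol i j p hp),
        inner_smul_right,
      div_mul_cancel₀ _ hii]
  obtain ⟨u₀, hu₀, hPu₀⟩ : ∃ u₀ : E, u₀ ≠ 0 ∧ P 0 u₀ = u₀ := by
    obtain ⟨i, hi⟩ := hne 0 (mem_closedBall_self hr)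
    refine ⟨Y i 0, hi, ?_⟩
    simp only [hP]
    rw [weightedProj_apply_of_collinear (v := fun i => Y i 0) hi (fun j => hcol i j 0
      (mem_closedBall_self hr)),
      div_self (inner_self_ne_zero.2 hi), one_smul]
  obtain ⟨δ, hδ, hPδ⟩ := Metric.uniformContinuousOn_iff.1
    ((isCompact_closedBall (0 : E) r).uniformContinuousOn_of_continuous hPc) 1 one_pos
  obtain ⟨n, hn⟩ := exists_nat_gt (r / δ)
  have hn0 : (0 : ℝ) < n := (div_nonneg hr hδ.le).trans_lt hn
  have hscale : ∀ k : ℕ, k ≤ n → ∀ p ∈ closedBall (0 : E) r,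
      ((k : ℝ) / n) • p ∈ closedBall (0 : E) r := fun k hk p hp => by
    rw [mem_closedBall_zero_iff] at hp ⊢
    rw [norm_smul, Real.norm_of_nonneg (by positivity)]
    have : (k : ℝ) / n ≤ 1 := (div_le_one hn0).2 (by exact_mod_cast hk)
    exact (mul_le_of_le_one_left (norm_nonneg p) this).trans hp
  have key : ∀ k : ℕ, k ≤ n → ∃ L : E → E, ContinuousOn L (closedBall 0 r) ∧
      ∀ p ∈ closedBall (0 : E) r, L p ≠ 0 ∧ P (((k : ℝ) / n) • p) (L p) = L p := by
    intro k
    induction k with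
    | zero => exact fun _ => ⟨fun _ => u₀, continuousOn_const, fun p _ => ⟨hu₀,
      by simpa using hPu₀⟩⟩
    | succ k ih =>
      intro hk
      obtain ⟨L, hL, hLP⟩ := ih (by lia)
      refine ⟨fun p => P (((k + 1 : ℕ) / n : ℝ) • p) (L p), ContinuousOn.clm_apply
        (hPc.comp (continuousOn_id.const_smul _) fun p hp => hscale _ hk p hp) hL,
        fun p hp => ⟨fun h0 => ?_, hPP _ (hscale _ hk p hp) _⟩⟩
      obtain ⟨hLp, hPL⟩ := hLP p hp
      simp only at h0
      have hd : dist (((k + 1 : ℕ) / n : ℝ) • p) (((k : ℝ) / n) • p) < δ := by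
        rw [dist_eq_norm, ← sub_smul, norm_smul, Nat.cast_succ, ← sub_div, add_sub_cancel_left,
          Real.norm_of_nonneg (by positivity)]
        rw [mem_closedBall_zero_iff] at hp
        rw [div_lt_iff₀ hδ] at hn
        rw [one_div, inv_mul_lt_iff₀ hn0]
        exact hp.trans_lt hn
      have h1 := hPδ _ (hscale _ hk p hp) _ (hscale k (by lia) p hp) hd
      rw [dist_eq_norm] at h1
      have h2 := ContinuousLinearMap.le_opNorm
        (P (((k + 1 : ℕ) / n : ℝ) • p) - P (((k : ℝ) / n) • p)) (L p)
      rw [_root_.sub_apply, h0, hPL, zero_sub, norm_neg] at h2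
      nlinarith [norm_pos_iff.2 hLp]
  obtain ⟨L, hL, hLP⟩ := key n le_rfl
  refine ⟨L, hL, fun p hp => ?_⟩
  have := hLP p hp
  rwa [div_self hn0.ne', one_smul] at this

/-- Pairwise collinear continuous fields on a three-dimensional closed ball, one of which points
strictly inward on the boundary sphere, have a common zero. -/
theorem exists_common_zero_of_collinear (hdim : Module.finrank ℝ E = 3) {r : ℝ} (hr : 0 < r)
    {Y : ι → E → E} (hY : ∀ i, ContinuousOn (Y i) (closedBall 0 r))
    (hcol : ∀ i j, ∀ p ∈ closedBall (0 : E) r, ⟪Y i p, Y i p⟫ • Y j p = ⟪Y i p, Y j p⟫ • Y i p)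
    {i₀ : ι} (hin : ∀ p, ‖p‖ = r → ⟪Y i₀ p, p⟫ < 0) :
    ∃ p ∈ closedBall (0 : E) r, ∀ i, Y i p = 0 := by
  have : FiniteDimensional ℝ E := Module.finite_of_finrank_pos (by lia)
  have : Nontrivial E := Module.nontrivial_of_finrank_pos (R := ℝ) (by lia)
  by_contra! hne
  obtain ⟨L, hL, hLP⟩ := exists_continuousOn_section_of_collinear hY hcol hne
  have hsph : ∀ p ∈ sphere (0 : E) r, ⟪L p, p⟫ ≠ 0 := by
    intro p hp
    have hpB := sphere_subset_closedBall hp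
    have hXp := hin p (by simpa using hp)
    have hX0 : Y i₀ p ≠ 0 := fun h => by simp [h] at hXp
    obtain ⟨hLp, hPL⟩ := hLP p hpB
    rw [weightedProj_apply_of_collinear (v := fun i => Y i p) hX0 fun j => hcol i₀ j p hpB] at hPL
    rw [← hPL] at hLp ⊢
    rw [real_inner_smul_left]
    exact mul_ne_zero (left_ne_zero_of_smul hLp) hXp.ne
  have hcon : IsPreconnected (sphere (0 : E) r) :=
    isPreconnected_sphere (by rw [← Module.finrank_eq_rank, hdim]; norm_num) _ _
  have hcont : ContinuousOn (fun p => ⟪L p, p⟫) (sphere (0 : E) r) :=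
    (hL.mono sphere_subset_closedBall).inner continuousOn_id
  by_cases hneg : ∀ p, ‖p‖ = r → ⟪L p, p⟫ < 0
  · obtain ⟨p, hp, h0⟩ := exists_eq_zero_of_continuousOn_of_inward hdim hr hL hneg
    exact (hLP p hp).1 h0
  · push Not at hneg
    obtain ⟨a, ha, hLa⟩ := hneg
    obtain ⟨p, hp, h0⟩ := exists_eq_zero_of_continuousOn_of_inward hdim hr hL.neg fun p hp => by
      rw [Pi.neg_apply, inner_neg_left, neg_lt_zero]
      by_contra! hle
      obtain ⟨q, hq, hq0⟩ := hcon.intermediate_value (a := p) (b := a) (by simpa using hp)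
        (by simpa using ha) hcont ⟨hle, hLa⟩
      exact hsph q hq hq0
    exact (hLP p hp).1 (neg_eq_zero.1 h0)

end CollinearFields

section Rejection

variable {E : Type*} [NormedAddCommGroup E] [InnerProductSpace ℝ E]

/-- The coefficient `μ` for which `Q + μ Z` is orthogonal to `Z`. -/
noncomputable def rejectionCoeff (Z Q : E → E) (p : E) : ℝ := -(⟪Q p, Z p⟫ / ⟪Z p, Z p⟫)

/-- The component of the vector field `Q` orthogonal to `Z`. -/
noncomputable def rejection (Z Q : E → E) (p : E) : E := Q p + rejectionCoeff Z Q p • Z p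

theorem inner_rejection (Z Q : E → E) (p : E) : ⟪rejection Z Q p, Z p⟫ = 0 := by
  by_cases h : Z p = 0
  · rw [h, inner_zero_right]
  · rw [rejection, inner_add_left, real_inner_smul_left, rejectionCoeff, neg_mul,
      div_mul_cancel₀ _ (inner_self_ne_zero.2 h), add_neg_cancel]

theorem rejectionCoeff_of_eq_smul {Z Q : E → E} {p : E} {c : ℝ} (hZ : Z p ≠ 0)
    (h : Q p = c • Z p) : rejectionCoeff Z Q p = -c := by
  rw [rejectionCoeff, h, real_inner_smul_left, mul_div_cancel_right₀ _ (inner_self_ne_zero.2 hZ)]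

theorem rejection_of_eq_smul {Z Q : E → E} {p : E} {c : ℝ} (hZ : Z p ≠ 0)
    (h : Q p = c • Z p) : rejection Z Q p = 0 := by
  rw [rejection, rejectionCoeff_of_eq_smul hZ h, h, neg_smul, add_neg_cancel]

theorem AnalyticAt.inner_real {F : Type*} [NormedAddCommGroup F] [NormedSpace ℝ F] {f g : F → E}
    {p : F} (hf : AnalyticAt ℝ f p) (hg : AnalyticAt ℝ g p) :
    AnalyticAt ℝ (fun z => ⟪f z, g z⟫) p :=
  AnalyticAt.clm_comp₂ (innerSL ℝ) hf hg

theorem AnalyticAt.rejectionCoeff {Z Q : E → E} {p : E} (hZ : AnalyticAt ℝ Z p)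
    (hQ : AnalyticAt ℝ Q p) (h0 : Z p ≠ 0) : AnalyticAt ℝ (rejectionCoeff Z Q) p :=
  ((hQ.inner_real hZ).div (hZ.inner_real hZ) (inner_self_ne_zero.2 h0)).neg

theorem AnalyticAt.rejection {Z Q : E → E} {p : E} (hZ : AnalyticAt ℝ Z p)
    (hQ : AnalyticAt ℝ Q p) (h0 : Z p ≠ 0) : AnalyticAt ℝ (rejection Z Q) p :=
  hQ.add ((hZ.rejectionCoeff hQ h0).smul hZ)

/-- The linear form giving the derivative of `rejectionCoeff Z Q` along `Z` in terms of
`rejection Z Q`, for commuting `Z` and `Q`. -/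
noncomputable def rejectionForm (Z : E → E) (p : E) : E →L[ℝ] ℝ :=
  (-⟪Z p, Z p⟫⁻¹) • (innerSL ℝ (fderiv ℝ Z p (Z p)) + innerSL ℝ (Z p) ∘L fderiv ℝ Z p)

/-- The operator of the linear transport equation along `Z` satisfied by `rejection Z Q`, for
commuting `Z` and `Q`. -/
noncomputable def rejectionTransport (Z : E → E) (p : E) : E →L[ℝ] E :=
  fderiv ℝ Z p + (rejectionForm Z p).smulRight (Z p)

theorem AnalyticAt.rejectionTransport [CompleteSpace E] {Z : E → E} {p : E}
    (hZ : AnalyticAt ℝ Z p) (h0 : Z p ≠ 0) : AnalyticAt ℝ (rejectionTransport Z) p := by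
  have hd := hZ.fderiv
  have hform : AnalyticAt ℝ (rejectionForm Z) p :=
    ((hZ.inner_real hZ).inv (inner_self_ne_zero.2 h0)).neg.smul
      (((AnalyticAt.clm_comp₂ (ContinuousLinearMap.id ℝ (E →L[ℝ] E)) hd hZ).clm_comp
        (innerSL ℝ)).add
        (AnalyticAt.clm_comp₂ (ContinuousLinearMap.compL ℝ E E ℝ) (hZ.clm_comp (innerSL ℝ)) hd))
  exact hd.add (AnalyticAt.clm_comp₂ (ContinuousLinearMap.smulRightL ℝ E E) hform hZ)

theorem fderiv_rejection_eq_add [CompleteSpace E] {Z Q : E → E} {p : E} (hZ : AnalyticAt ℝ Z p)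
    (hQ : AnalyticAt ℝ Q p) (h0 : Z p ≠ 0) (hcomm : fderiv ℝ Q p (Z p) = fderiv ℝ Z p (Q p)) :
    fderiv ℝ (rejection Z Q) p (Z p) =
      fderiv ℝ Z p (rejection Z Q p) + fderiv ℝ (rejectionCoeff Z Q) p (Z p) • Z p := by
  have hμ := (hZ.rejectionCoeff hQ h0).differentiableAt
  have h := (hQ.differentiableAt.hasFDerivAt.add
    (hμ.hasFDerivAt.smul hZ.differentiableAt.hasFDerivAt)).fderiv
  have h' : fderiv ℝ (rejection Z Q) p = _ := h
  rw [h']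
  simp [hcomm, rejection, add_assoc]

theorem fderiv_rejectionCoeff [CompleteSpace E] {Z Q : E → E} {p : E} (hZ : AnalyticAt ℝ Z p)
    (hQ : AnalyticAt ℝ Q p) (h0 : Z p ≠ 0) (hcomm : fderiv ℝ Q p (Z p) = fderiv ℝ Z p (Q p)) :
    fderiv ℝ (rejectionCoeff Z Q) p (Z p) = rejectionForm Z p (rejection Z Q p) := by
  have hZZ : ⟪Z p, Z p⟫ ≠ 0 := inner_self_ne_zero.2 h0
  have h := ((hZ.rejection hQ h0).differentiableAt.hasFDerivAt.inner ℝ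
    hZ.differentiableAt.hasFDerivAt).fderiv
  rw [show (fun z => ⟪rejection Z Q z, Z z⟫) = fun _ => (0 : ℝ) from
    funext fun z => inner_rejection Z Q z, fderiv_const_apply] at h
  have h2 := congrArg (fun L => L (Z p)) h
  simp [fderiv_rejection_eq_add hZ hQ h0 hcomm, inner_add_left, real_inner_smul_left] at h2
  simp only [rejectionForm, _root_.smul_apply, _root_.add_apply, ContinuousLinearMap.comp_apply,
    innerSL_apply_apply, smul_eq_mul]
  rw [← real_inner_self_eq_norm_sq] at h2
  rw [real_inner_comm (rejection Z Q p) (fderiv ℝ Z p (Z p)),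
    real_inner_comm (fderiv ℝ Z p (rejection Z Q p)) (Z p)]
  field_simp
  linear_combination -h2

theorem fderiv_rejection [CompleteSpace E] {Z Q : E → E} {p : E} (hZ : AnalyticAt ℝ Z p)
    (hQ : AnalyticAt ℝ Q p) (h0 : Z p ≠ 0) (hcomm : fderiv ℝ Q p (Z p) = fderiv ℝ Z p (Q p)) :
    fderiv ℝ (rejection Z Q) p (Z p) = rejectionTransport Z p (rejection Z Q p) := by
  rw [fderiv_rejection_eq_add hZ hQ h0 hcomm, fderiv_rejectionCoeff hZ hQ h0 hcomm,
    rejectionTransport, _root_.add_apply, ContinuousLinearMap.smulRight_apply]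

end Rejection

section EventuallyCollinear

open Metric

variable {E ι : Type*} [NormedAddCommGroup E] [InnerProductSpace ℝ E] [Fintype ι]

/-- Analytic fields on a three-dimensional closed ball that are collinear near some interior point,
one of which points strictly inward on the boundary sphere, have a common zero. -/
theorem exists_common_zero_of_eventually_collinear (hdim : Module.finrank ℝ E = 3) {r : ℝ}
    (hr : 0 < r) {V : ι → E → E} (hV : ∀ i, ∀ p ∈ closedBall (0 : E) r, AnalyticAt ℝ (V i) p)
    {i₀ : ι} (hin : ∀ p, ‖p‖ = r → ⟪V i₀ p, p⟫ < 0) {p₀ : E} (hp₀ : p₀ ∈ ball (0 : E) r)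
    (hcol : ∀ᶠ z in 𝓝 p₀, ∃ w : E, ∀ i, ∃ c : ℝ, V i z = c • w) :
    ∃ p ∈ closedBall (0 : E) r, ∀ i, V i p = 0 := by
  have : FiniteDimensional ℝ E := Module.finite_of_finrank_pos (by lia)
  have : CompleteSpace E := FiniteDimensional.complete ℝ E
  refine exists_common_zero_of_collinear hdim hr
    (fun i p hp => (hV i p hp).continuousAt.continuousWithinAt) (fun i j => ?_) hin
  have han : ∀ p ∈ closedBall (0 : E) r,
      AnalyticAt ℝ (fun z => ⟪V i z, V i z⟫ • V j z - ⟪V i z, V j z⟫ • V i z) p := fun p hp =>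
    ((((hV i p hp).inner_real (hV i p hp)).smul (hV j p hp)).sub
      (((hV i p hp).inner_real (hV j p hp)).smul (hV i p hp)))
  have hev : (fun z => ⟪V i z, V i z⟫ • V j z - ⟪V i z, V j z⟫ • V i z) =ᶠ[𝓝 p₀] 0 := by
    filter_upwards [hcol] with z ⟨w, hw⟩
    obtain ⟨a, ha⟩ := hw i
    obtain ⟨b, hb⟩ := hw j
    simp only [ha, hb, real_inner_smul_left, inner_smul_right, smul_smul, ← sub_smul]
    rw [Pi.zero_apply, smul_eq_zero]
    left
    ring
  have hball := AnalyticOnNhd.eqOn_zero_of_preconnected_of_eventuallyEq_zero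
    (fun p hp => han p (ball_subset_closedBall hp)) (convex_ball (0 : E) r).isPreconnected hp₀ hev
  have hclosed := hball.of_subset_closure (t := closedBall (0 : E) r)
    (fun p hp => (han p hp).continuousAt.continuousWithinAt) continuousOn_const
    ball_subset_closedBall (closure_ball (0 : E) hr.ne').ge
  exact fun p hp => sub_eq_zero.1 (hclosed hp)

end EventuallyCollinear

section CrossProduct

/-- The cross product on `EuclideanSpace ℝ (Fin 3)`. -/
noncomputable def euclideanCross (u v : EuclideanSpace ℝ (Fin 3)) : EuclideanSpace ℝ (Fin 3) :=
  !₂[u 1 * v 2 - u 2 * v 1, u 2 * v 0 - u 0 * v 2, u 0 * v 1 - u 1 * v 0]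

theorem inner_euclideanCross_left (u v : EuclideanSpace ℝ (Fin 3)) :
    ⟪euclideanCross u v, u⟫ = 0 := by
  simp [euclideanCross, PiLp.inner_apply, Fin.sum_univ_three]
  ring

theorem inner_euclideanCross_right (u v : EuclideanSpace ℝ (Fin 3)) :
    ⟪euclideanCross u v, v⟫ = 0 := by
  simp [euclideanCross, PiLp.inner_apply, Fin.sum_univ_three]
  ring

theorem euclideanCross_smul_right (u v : EuclideanSpace ℝ (Fin 3)) (c : ℝ) :
    euclideanCross u (c • v) = c • euclideanCross u v := by
  ext i
  fin_cases i <;> simp [euclideanCross] <;> ring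

theorem inner_euclideanCross_self (u v : EuclideanSpace ℝ (Fin 3)) :
    ⟪euclideanCross u v, euclideanCross u v⟫ = ⟪u, u⟫ * ⟪v, v⟫ - ⟪u, v⟫ ^ 2 := by
  simp only [euclideanCross, PiLp.inner_apply, Fin.sum_univ_three]
  simp
  ring

theorem euclideanCross_ne_zero {u v : EuclideanSpace ℝ (Fin 3)} (hu : u ≠ 0) (hv : v ≠ 0)
    (h : ⟪u, v⟫ = 0) :
    euclideanCross u v ≠ 0 := by
  rw [← inner_self_ne_zero (𝕜 := ℝ), inner_euclideanCross_self, h, zero_pow two_ne_zero, sub_zero]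
  exact mul_ne_zero (inner_self_ne_zero.2 hu) (inner_self_ne_zero.2 hv)

theorem inner_euclideanCross_sq {a m y : EuclideanSpace ℝ (Fin 3)} (ha : ⟪a, y⟫ = 0)
    (hm : ⟪m, y⟫ = 0) :
    ⟪a, euclideanCross m y⟫ ^ 2 = ⟪y, y⟫ * (⟪a, a⟫ * ⟪m, m⟫ - ⟪a, m⟫ ^ 2) := by
  have h : ⟪a, euclideanCross m y⟫ ^ 2 = ⟪y, y⟫ * (⟪a, a⟫ * ⟪m, m⟫ - ⟪a, m⟫ ^ 2)
      + 2 * ⟪a, m⟫ * ⟪a, y⟫ * ⟪m, y⟫ - ⟪a, a⟫ * ⟪m, y⟫ ^ 2 - ⟪m, m⟫ * ⟪a, y⟫ ^ 2 := by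
    simp only [euclideanCross, PiLp.inner_apply, Fin.sum_univ_three]
    simp
    ring
  rw [h, ha, hm]
  ring

theorem inner_euclideanCross_ne_zero {a m y w : EuclideanSpace ℝ (Fin 3)} (ha0 : a ≠ 0)
    (ha : ⟪a, y⟫ = 0)
    (hm : ⟪m, y⟫ = 0) (hy : y ≠ 0) (haw : ⟪a, w⟫ = 0) (hmw : ⟪m, w⟫ ≠ 0) :
    ⟪a, euclideanCross m y⟫ ≠ 0 := by
  intro h
  have h2 := inner_euclideanCross_sq ha hm
  rw [h, zero_pow two_ne_zero, eq_comm, mul_eq_zero] at h2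
  have h3 := h2.resolve_left (inner_self_ne_zero.2 hy)
  have h4 : ⟪m, m⟫ • a - ⟪a, m⟫ • m = 0 := by
    rw [← inner_self_eq_zero (𝕜 := ℝ)]
    simp only [inner_sub_left, inner_sub_right, real_inner_smul_left, inner_smul_right]
    rw [real_inner_comm a m]
    linear_combination ⟪m, m⟫ * h3
  have h5 : ⟪⟪m, m⟫ • a - ⟪a, m⟫ • m, w⟫ = 0 := by rw [h4, inner_zero_left]
  rw [inner_sub_left, real_inner_smul_left, real_inner_smul_left, haw, mul_zero, zero_sub,
    neg_eq_zero, mul_eq_zero] at h5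
  rw [h5.resolve_right hmw, zero_smul, sub_zero, smul_eq_zero] at h4
  rcases h4 with h4 | h4
  · rw [inner_self_eq_zero.1 h4, inner_zero_left] at hmw
    exact hmw rfl
  · exact ha0 h4

theorem Continuous.euclideanCross {α : Type*} [TopologicalSpace α]
    {f g : α → EuclideanSpace ℝ (Fin 3)}
    (hf : Continuous f) (hg : Continuous g) : Continuous fun z => euclideanCross (f z) (g z) := by
  unfold _root_.euclideanCross
  fun_prop

theorem ContinuousAt.euclideanCross {α : Type*} [TopologicalSpace α]
    {f g : α → EuclideanSpace ℝ (Fin 3)} {z : α}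
    (hf : ContinuousAt f z) (hg : ContinuousAt g z) :
    ContinuousAt (fun z => euclideanCross (f z) (g z)) z :=
  (continuous_fst.euclideanCross continuous_snd).continuousAt.comp (hf.prodMk hg)

end CrossProduct

section TransverseField

/-- The field tangent to the level sets of `μ` and orthogonal to `Y`. -/
noncomputable def levelNormal (μ : EuclideanSpace ℝ (Fin 3) → ℝ)
    (Y : EuclideanSpace ℝ (Fin 3) → EuclideanSpace ℝ (Fin 3)) (p : EuclideanSpace ℝ (Fin 3)) :
    EuclideanSpace ℝ (Fin 3) :=
  euclideanCross (gradient μ p) (Y p)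

theorem AnalyticAt.continuousAt_levelNormal {μ : EuclideanSpace ℝ (Fin 3) → ℝ}
    {Y : EuclideanSpace ℝ (Fin 3) → EuclideanSpace ℝ (Fin 3)} {p : EuclideanSpace ℝ (Fin 3)}
    (hμ : AnalyticAt ℝ μ p) (hY : AnalyticAt ℝ Y p) : ContinuousAt (levelNormal μ Y) p :=
  (((InnerProductSpace.toDual ℝ (EuclideanSpace ℝ (Fin 3))).symm.continuous.continuousAt).comp
    hμ.fderiv.continuousAt).euclideanCross hY.continuousAt

theorem eventually_pos_add_smul {E : Type*} [NormedAddCommGroup E] [NormedSpace ℝ E] {g : E → ℝ}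
    {z v : E} (hg : DifferentiableAt ℝ g z) (h0 : g z = 0) (hv : 0 < fderiv ℝ g z v) :
    ∀ᶠ τ in 𝓝[>] (0 : ℝ), 0 < g (z + τ • v) := by
  have h := (hg.hasFDerivAt.hasLineDerivAt v).tendsto_slope_zero_right
  filter_upwards [h.eventually (lt_mem_nhds hv), self_mem_nhdsWithin] with τ hτ hτ0
  simp only [h0, sub_zero, smul_eq_mul] at hτ
  exact (mul_pos_iff_of_pos_left (inv_pos.2 hτ0)).1 hτ

theorem tendsto_add_smul_nhdsGT {E : Type*} [NormedAddCommGroup E] [NormedSpace ℝ E] (z v : E) :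
    Tendsto (fun τ : ℝ => z + τ • v) (𝓝[>] 0) (𝓝 z) := by
  have h : Tendsto (fun τ : ℝ => z + τ • v) (𝓝 0) (𝓝 (z + (0 : ℝ) • v)) :=
    tendsto_const_nhds.add (tendsto_id.smul_const v)
  rw [zero_smul, add_zero] at h
  exact h.mono_left nhdsWithin_le_nhds

theorem exists_smul_factorization_pos {E W : Type*} [NormedAddCommGroup E]
    [NormedSpace ℝ E] [NormedAddCommGroup W] [NormedSpace ℝ W] {Φ : E → W} {p : E}
    {g : E → ℝ} {m : ℕ} {K : E → W} (v : E) (hg : AnalyticAt ℝ g p)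
    (hK : AnalyticAt ℝ K p) (hgp : g p = 0) (hv : fderiv ℝ g p v ≠ 0) (hKp : K p ≠ 0)
    (hΦ : ∀ᶠ z in 𝓝 p, Φ z = g z ^ m • K z) :
    ∃ (g : E → ℝ) (K : E → W), AnalyticAt ℝ g p ∧ AnalyticAt ℝ K p ∧ g p = 0 ∧
      0 < fderiv ℝ g p v ∧ K p ≠ 0 ∧ ∀ᶠ z in 𝓝 p, Φ z = g z ^ m • K z := by
  rcases hv.lt_or_gt with h | h
  · refine ⟨fun z => -g z, fun z => (-1 : ℝ) ^ m • K z, hg.neg, analyticAt_const.smul hK, by simpa,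
      ?_, smul_ne_zero (pow_ne_zero _ (by norm_num)) hKp, hΦ.mono fun z hz => ?_⟩
    · rw [fderiv_fun_neg]
      simpa using h
    · rw [hz, smul_smul, ← mul_pow, neg_mul_neg, mul_one]
  · exact ⟨g, K, hg, hK, hgp, h, hKp, hΦ⟩

/-- Near a transverse factorization point of a field `Φ` orthogonal to `Y` there is a continuous
nonvanishing field orthogonal to both, positively proportional to the cross product of `Y` and `Φ`
on the positive side of every zero of `Φ`. -/
theorem HasTransverseFactorization.exists_orthogonal_field {μ : EuclideanSpace ℝ (Fin 3) → ℝ}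
    {Y Φ : EuclideanSpace ℝ (Fin 3) → EuclideanSpace ℝ (Fin 3)} {p : EuclideanSpace ℝ (Fin 3)}
    (h : HasTransverseFactorization Y μ Φ p) (hY : AnalyticAt ℝ Y p) (hμ : AnalyticAt ℝ μ p)
    (hYp : Y p ≠ 0) (hμY : fderiv ℝ μ p (Y p) = 0) (horth : ∀ z, ⟪Φ z, Y z⟫ = 0) :
    ∃ N : EuclideanSpace ℝ (Fin 3) → EuclideanSpace ℝ (Fin 3), ∀ᶠ z in 𝓝 p, ContinuousAt N z ∧
      N z ≠ 0 ∧ ⟪N z, Φ z⟫ = 0 ∧ ⟪N z, Y z⟫ = 0 ∧ (Φ z = 0 → ∀ᶠ τ in 𝓝[>] (0 : ℝ), ∃ a : ℝ, 0 < a ∧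
        euclideanCross (Y (z + τ • levelNormal μ Y z)) (Φ (z + τ • levelNormal μ Y z)) =
          a • N (z + τ • levelNormal μ Y z)) := by
  obtain ⟨g, m, K, hg, hK, hgp, hdg, hgY, ⟨w, hgw, hμw⟩, hKp, hΦ⟩ := h
  have hν : fderiv ℝ g p (levelNormal μ Y p) ≠ 0 := by
    rw [← inner_gradient_left]
    refine inner_euclideanCross_ne_zero ?_ ?_ ?_ hYp (w := w) ?_ ?_
    · simpa [gradient] using hdg
    all_goals rwa [inner_gradient_left]
  obtain ⟨g, K, hg, hK, hgp, hpos, hKp, hΦ⟩ :=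
    exists_smul_factorization_pos _ hg hK hgp hν hKp hΦ
  have hdg : fderiv ℝ g p ≠ 0 := fun h => by simp [h] at hpos
  have hKY : ∀ᶠ z in 𝓝 p, ⟪K z, Y z⟫ = 0 :=
    eventually_eq_zero_of_pow_smul hg hdg (hK.inner_real hY) m (hΦ.mono fun z hz => by
      rw [smul_eq_mul, ← real_inner_smul_left, ← hz, horth])
  have hNp : euclideanCross (Y p) (K p) ≠ 0 :=
    euclideanCross_ne_zero hYp hKp (by rw [real_inner_comm]; exact hKY.self_of_nhds)
  have hNc := hY.continuousAt.euclideanCross hK.continuousAt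
  have hposν : ∀ᶠ z in 𝓝 p, 0 < fderiv ℝ g z (levelNormal μ Y z) :=
    (hg.fderiv.continuousAt.clm_apply (hμ.continuousAt_levelNormal hY)).eventually
      (lt_mem_nhds hpos)
  refine ⟨fun z => euclideanCross (Y z) (K z), ?_⟩
  filter_upwards [hg.eventually_analyticAt, hK.eventually_analyticAt, hY.eventually_analyticAt,
    hΦ.eventually_nhds, hNc.eventually_ne hNp, hposν, hK.continuousAt.eventually_ne hKp]
    with z hgz hKz hYz hΦz hNz hνz hKz0
  refine ⟨hYz.continuousAt.euclideanCross hKz.continuousAt, hNz, ?_, inner_euclideanCross_left _ _,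
    fun hz => ?_⟩
  · rw [hΦz.self_of_nhds, inner_smul_right, inner_euclideanCross_right, mul_zero]
  · have hgz0 : g z = 0 := by
      rw [hΦz.self_of_nhds, smul_eq_zero] at hz
      exact eq_zero_of_pow_eq_zero (hz.resolve_right hKz0)
    filter_upwards [eventually_pos_add_smul hgz.differentiableAt hgz0 hνz,
      (tendsto_add_smul_nhdsGT z _).eventually hΦz] with τ hτ hΦτ
    exact ⟨_, pow_pos hτ m, by rw [hΦτ, euclideanCross_smul_right]⟩

theorem inner_pos_of_eventually_smul_eq {E : Type*} [NormedAddCommGroup E] [InnerProductSpace ℝ E]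
    {N₁ N₂ c : E → E} {z v : E} (h₁ : ContinuousAt N₁ z) (h₂ : ContinuousAt N₂ z)
    (hz₁ : N₁ z ≠ 0) (hz₂ : N₂ z ≠ 0)
    (hc₁ : ∀ᶠ τ in 𝓝[>] (0 : ℝ), ∃ a : ℝ, 0 < a ∧ c (z + τ • v) = a • N₁ (z + τ • v))
    (hc₂ : ∀ᶠ τ in 𝓝[>] (0 : ℝ), ∃ a : ℝ, 0 < a ∧ c (z + τ • v) = a • N₂ (z + τ • v)) :
    0 < ⟪N₁ z, N₂ z⟫ := by
  have ht := tendsto_add_smul_nhdsGT z v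
  have heq : ⟪N₁ z, N₂ z⟫ = ‖N₁ z‖ * ‖N₂ z‖ := by
    refine tendsto_nhds_unique_of_eventuallyEq ((h₁.tendsto.comp ht).inner (h₂.tendsto.comp ht))
      ((h₁.tendsto.comp ht).norm.mul (h₂.tendsto.comp ht).norm) ?_
    filter_upwards [hc₁, hc₂] with τ ⟨a, ha, hca⟩ ⟨b, hb, hcb⟩
    have hN : N₂ (z + τ • v) = (b⁻¹ * a) • N₁ (z + τ • v) := by
      rw [mul_smul, ← hca, hcb, inv_smul_smul₀ hb.ne']
    simp only [Function.comp_apply]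
    rw [hN, inner_smul_right, norm_smul, real_inner_self_eq_norm_mul_norm,
      Real.norm_of_nonneg (by positivity)]
    ring
  rw [heq]
  exact mul_pos (norm_pos_iff.2 hz₁) (norm_pos_iff.2 hz₂)

end TransverseField

section InwardPerturbation

open Metric

variable {E : Type*} [NormedAddCommGroup E] [InnerProductSpace ℝ E]

theorem exists_forall_abs_lt_inner_add_smul_neg [ProperSpace E] {X Y : E → E} {r : ℝ}
    (hX : ContinuousOn X (closedBall 0 r)) (hY : ContinuousOn Y (closedBall 0 r))
    (hin : ∀ p, ‖p‖ = r → ⟪X p, p⟫ < 0) :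
    ∃ δ : ℝ, 0 < δ ∧ ∀ s : ℝ, |s| < δ → ∀ p, ‖p‖ = r → ⟪X p + s • Y p, p⟫ < 0 := by
  obtain ⟨k, hk, hkX⟩ := (isCompact_sphere (0 : E) r).exists_forall_le'
    (f := fun p => -⟪X p, p⟫) ((hX.mono sphere_subset_closedBall).inner continuousOn_id).neg
    (a := 0) fun p hp => by simpa using hin p (by simpa using hp)
  obtain ⟨C, hC⟩ := (isCompact_sphere (0 : E) r).exists_bound_of_continuousOn
    (f := fun p => ⟪Y p, p⟫) ((hY.mono sphere_subset_closedBall).inner continuousOn_id)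
  refine ⟨k / (|C| + 1), by positivity, fun s hs p hp => ?_⟩
  have hpS : p ∈ sphere (0 : E) r := by simpa using hp
  have h1 := hkX p hpS
  have h2 := (hC p hpS).trans (le_abs_self C)
  rw [lt_div_iff₀ (by positivity)] at hs
  have h3 : s * ⟪Y p, p⟫ ≤ |s| * |C| := by
    refine (le_abs_self _).trans ?_
    rw [abs_mul]
    exact mul_le_mul_of_nonneg_left h2 (abs_nonneg s)
  rw [inner_add_left, real_inner_smul_left]
  nlinarith [abs_nonneg s]

/-- A continuous inward field on a three-dimensional ball cannot have, near its zeros, continuous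
orthogonal fields which agree in direction at the zeros. -/
theorem not_exists_local_orthogonal_fields (hdim : Module.finrank ℝ E = 3) {F : E → E} {r : ℝ}
    (hr : 0 < r) (hF : ContinuousOn F (closedBall 0 r)) (hin : ∀ p, ‖p‖ = r → ⟪F p, p⟫ < 0)
    (N : E → E → E) (hN : ∀ p ∈ ball (0 : E) r, F p = 0 → ∀ᶠ z in 𝓝 p, ContinuousAt (N p) z ∧
      ⟪N p z, F z⟫ = 0 ∧ (F z = 0 → 0 < ⟪N p z, N z z⟫)) : False := by
  have : FiniteDimensional ℝ E := Module.finite_of_finrank_pos (by lia)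
  have hZc : IsClosed (closedBall (0 : E) r ∩ F ⁻¹' {0}) :=
    hF.preimage_isClosed_of_isClosed isClosed_closedBall isClosed_singleton
  have hZb : ∀ p ∈ closedBall (0 : E) r ∩ F ⁻¹' {0}, p ∈ ball (0 : E) r := by
    rintro p ⟨hp, hFp⟩
    rw [mem_closedBall_zero_iff] at hp
    refine mem_ball_zero_iff.2 (hp.lt_of_ne fun h => (hin p h).ne ?_)
    rw [hFp, inner_zero_left]
  have hsel : ∃ G : C(E, E), ∀ z, G z ∈ {v : E | ⟪v, F z⟫ = 0 ∧
      (z ∈ closedBall (0 : E) r ∩ F ⁻¹' {0} → 0 < ⟪v, N z z⟫) ∧ (r ≤ ‖z‖ → v = 0)} := by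
    refine exists_continuous_forall_mem_convex_of_local (fun z => ?_) (fun p => ?_)
    · rintro v ⟨hv1, hv2, hv3⟩ w ⟨hw1, hw2, hw3⟩ a b ha hb hab
      refine ⟨?_, fun h => ?_, fun h => by rw [hv3 h, hw3 h, smul_zero, smul_zero, add_zero]⟩
      · rw [inner_add_left, real_inner_smul_left, real_inner_smul_left, hv1, hw1]
        simp
      · rw [inner_add_left, real_inner_smul_left, real_inner_smul_left]
        exact (convex_Ioi (0 : ℝ)) (hv2 h) (hw2 h) ha hb hab
    · by_cases hp : p ∈ closedBall (0 : E) r ∩ F ⁻¹' {0}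
      · have hpb := hZb p hp
        refine ⟨_, inter_mem (isOpen_ball.mem_nhds hpb) (hN p hpb hp.2), N p,
          fun z hz => hz.2.1.continuousWithinAt, fun z hz => ⟨hz.2.2.1, fun h => hz.2.2.2 h.2,
            fun h => absurd (mem_ball_zero_iff.1 hz.1) h.not_gt⟩⟩
      · exact ⟨_, hZc.isOpen_compl.mem_nhds hp, fun _ => 0, continuousOn_const,
          fun z hz => ⟨inner_zero_left _, fun h => absurd h hz, fun _ => rfl⟩⟩
  obtain ⟨G, hG⟩ := hsel
  obtain ⟨p, hp, hp0⟩ := exists_eq_zero_of_continuousOn_of_inward hdim hr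
    (F := fun z => F z + G z) (hF.add G.continuous.continuousOn) fun p hp => by
      rw [(hG p).2.2 hp.ge, add_zero]
      exact hin p hp
  obtain ⟨h1, h2, -⟩ := hG p
  have hGp : G p = 0 := by
    rw [eq_neg_of_add_eq_zero_left hp0, inner_neg_right, neg_eq_zero] at h1
    exact inner_self_eq_zero.1 h1
  rw [hGp, add_zero] at hp0
  have := h2 ⟨hp, hp0⟩
  rw [hGp, inner_zero_left] at this
  exact this.false

theorem isOpen_ball_inter_ne_zero {Y : E → E} {r : ℝ}
    (hY : ∀ p ∈ closedBall (0 : E) r, AnalyticAt ℝ Y p) :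
    IsOpen {p ∈ ball (0 : E) r | Y p ≠ 0} :=
  ContinuousOn.isOpen_inter_preimage
    (fun p hp => (hY p (ball_subset_closedBall hp)).continuousAt.continuousWithinAt) isOpen_ball
    isOpen_compl_singleton

end InwardPerturbation

section CommutingPair

open Metric MeasureTheory

/-- Two commuting analytic fields on a closed ball, one of which points strictly inward on the
boundary sphere, have a common zero. -/
theorem exists_common_zero_of_commuting_pair {r : ℝ} (hr : 0 < r)
    {X Y : EuclideanSpace ℝ (Fin 3) → EuclideanSpace ℝ (Fin 3)}
    (hX : ∀ p ∈ closedBall (0 : EuclideanSpace ℝ (Fin 3)) r, AnalyticAt ℝ X p)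
    (hY : ∀ p ∈ closedBall (0 : EuclideanSpace ℝ (Fin 3)) r, AnalyticAt ℝ Y p)
    (hcomm : ∀ p ∈ closedBall (0 : EuclideanSpace ℝ (Fin 3)) r,
      fderiv ℝ X p (Y p) = fderiv ℝ Y p (X p))
    (hin : ∀ p, ‖p‖ = r → ⟪X p, p⟫ < 0) :
    ∃ p ∈ closedBall (0 : EuclideanSpace ℝ (Fin 3)) r, X p = 0 ∧ Y p = 0 := by
  by_contra! hne
  have hdim : Module.finrank ℝ (EuclideanSpace ℝ (Fin 3)) = 3 := finrank_euclideanSpace_fin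
  have hcX : ContinuousOn X (closedBall 0 r) := fun p hp =>
    (hX p hp).continuousAt.continuousWithinAt
  have hcY : ContinuousOn Y (closedBall 0 r) := fun p hp =>
    (hY p hp).continuousAt.continuousWithinAt
  set T := {p ∈ ball (0 : EuclideanSpace ℝ (Fin 3)) r | Y p ≠ 0} with hT
  have hTB : ∀ p ∈ T, p ∈ closedBall (0 : EuclideanSpace ℝ (Fin 3)) r := fun p hp =>
    ball_subset_closedBall hp.1
  have hμ : ∀ p ∈ T, AnalyticAt ℝ (rejectionCoeff Y X) p := fun p hp =>
    (hY p (hTB p hp)).rejectionCoeff (hX p (hTB p hp)) hp.2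
  have hμY : ∀ p ∈ T, rejection Y X p = 0 → fderiv ℝ (rejectionCoeff Y X) p (Y p) = 0 :=
    fun p hp h => by
      rw [fderiv_rejectionCoeff (hY p (hTB p hp)) (hX p (hTB p hp)) hp.2 (hcomm p (hTB p hp)), h,
        map_zero]
  have hnz : ∀ p ∈ T, ¬ ∀ᶠ z in 𝓝 p, rejection Y X z = 0 := by
    intro p hp hev
    obtain ⟨q, hq, hq0⟩ := exists_common_zero_of_eventually_collinear hdim hr
      (V := fun b : Bool => if b then X else Y) (Bool.forall_bool.2 ⟨by simpa using hY,
        by simpa using hX⟩) (i₀ := true)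
      (by simpa) hp.1 (hev.mono fun z hz => ⟨Y z, by
        rintro (_ | _)
        · exact ⟨1, by simp⟩
        · exact ⟨-rejectionCoeff Y X z, by simpa [rejection, add_eq_zero_iff_eq_neg] using hz⟩⟩)
    exact hne q hq (by simpa using hq0 true) (by simpa using hq0 false)
  have hnull := measure_image_not_hasTransverseFactorization hdim (isOpen_ball_inter_ne_zero hY)
    (fun p hp => hY p (hTB p hp)) hμ
    (fun p hp => (hY p (hTB p hp)).rejection (hX p (hTB p hp)) hp.2)
    (fun p hp => (hY p (hTB p hp)).rejectionTransport hp.2)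
    (fun p hp => fderiv_rejection (hY p (hTB p hp)) (hX p (hTB p hp)) hp.2 (hcomm p (hTB p hp)))
    (fun p hp _ => hp.2) hμY
  obtain ⟨δ, hδ, hδin⟩ := exists_forall_abs_lt_inner_add_smul_neg hcX hcY hin
  obtain ⟨ε, hε, hεn⟩ : ∃ ε ∈ Ioo (-δ) δ, ε ∉ rejectionCoeff Y X '' {p ∈ T | rejection Y X p = 0 ∧
      (¬ ∀ᶠ z in 𝓝 p, rejection Y X z = 0) ∧
        ¬ HasTransverseFactorization Y (rejectionCoeff Y X) (rejection Y X) p} := by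
    by_contra h
    have := measure_mono_null (fun ε hε => of_not_not fun hn => h ⟨ε, hε, hn⟩) hnull
    rw [Real.volume_Ioo, ENNReal.ofReal_eq_zero] at this
    linarith
  have hεin := hδin ε (abs_lt.2 hε)
  have hF : ∀ z, X z + ε • Y z = rejection Y X z + (ε - rejectionCoeff Y X z) • Y z := fun z => by
    rw [rejection, sub_smul]
    abel
  have hzero : ∀ p ∈ ball (0 : EuclideanSpace ℝ (Fin 3)) r, X p + ε • Y p = 0 →
      p ∈ T ∧ rejection Y X p = 0 ∧ rejectionCoeff Y X p = ε := by
    intro p hp h0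
    have hYp : Y p ≠ 0 := fun h => by
      rw [h, smul_zero, add_zero] at h0
      exact hne p (ball_subset_closedBall hp) h0 h
    have hXp : X p = (-ε) • Y p := by rw [neg_smul, eq_neg_of_add_eq_zero_left h0]
    exact ⟨⟨hp, hYp⟩, rejection_of_eq_smul hYp hXp,
      by rw [rejectionCoeff_of_eq_smul hYp hXp, neg_neg]⟩
  have hex : ∀ p : EuclideanSpace ℝ (Fin 3),
      ∃ N : EuclideanSpace ℝ (Fin 3) → EuclideanSpace ℝ (Fin 3),
      p ∈ ball (0 : EuclideanSpace ℝ (Fin 3)) r → X p + ε • Y p = 0 → ∀ᶠ z in 𝓝 p,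
      ContinuousAt N z ∧ N z ≠ 0 ∧ ⟪N z, rejection Y X z⟫ = 0 ∧ ⟪N z, Y z⟫ = 0 ∧
      (rejection Y X z = 0 → ∀ᶠ τ in 𝓝[>] (0 : ℝ), ∃ a : ℝ, 0 < a ∧
        euclideanCross (Y (z + τ • levelNormal (rejectionCoeff Y X) Y z))
          (rejection Y X (z + τ • levelNormal (rejectionCoeff Y X) Y z)) =
          a • N (z + τ • levelNormal (rejectionCoeff Y X) Y z)) := by
    intro p
    by_cases h : p ∈ ball (0 : EuclideanSpace ℝ (Fin 3)) r ∧ X p + ε • Y p = 0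
    · obtain ⟨hpT, hΦ, hμp⟩ := hzero p h.1 h.2
      have hfac : HasTransverseFactorization Y (rejectionCoeff Y X) (rejection Y X) p := by
        by_contra hfac
        exact hεn ⟨p, ⟨hpT, hΦ, hnz p hpT, hfac⟩, hμp⟩
      obtain ⟨N, hN⟩ := hfac.exists_orthogonal_field (hY p (hTB p hpT)) (hμ p hpT) hpT.2
        (hμY p hpT hΦ) (inner_rejection Y X)
      exact ⟨N, fun _ _ => hN⟩
    · exact ⟨0, fun h1 h2 => absurd ⟨h1, h2⟩ h⟩
  choose N hN using hex
  refine not_exists_local_orthogonal_fields hdim hr (F := fun z => X z + ε • Y z)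
    (hcX.add (hcY.const_smul ε)) hεin N
    fun p hp h0 => ?_
  filter_upwards [hN p hp h0, isOpen_ball.mem_nhds hp] with z ⟨hc, hz0, hzΦ, hzY, hzc⟩ hzb
  refine ⟨hc, ?_, fun hz => ?_⟩
  · rw [hF, inner_add_right, inner_smul_right, hzΦ, hzY, mul_zero, add_zero]
  · obtain ⟨hc', hz0', -, -, hzc'⟩ := (hN z hzb hz).self_of_nhds
    have hΦ := (hzero z hzb hz).2.1
    exact inner_pos_of_eventually_smul_eq hc hc' hz0 hz0'
      (c := fun z => euclideanCross (Y z) (rejection Y X z)) (hzc hΦ) (hzc' hΦ)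

end CommutingPair

section CommutingFamily

variable {E : Type*} [NormedAddCommGroup E] [NormedSpace ℝ E]

theorem fderiv_add_smul_comm {P Q Z : E → E} {p : E} (a b : ℝ) (hP : DifferentiableAt ℝ P p)
    (hQ : DifferentiableAt ℝ Q p) (hZ : DifferentiableAt ℝ Z p)
    (hPQ : fderiv ℝ P p (Q p) = fderiv ℝ Q p (P p)) (hPZ : fderiv ℝ P p (Z p) = fderiv ℝ Z p (P p))
    (hQZ : fderiv ℝ Q p (Z p) = fderiv ℝ Z p (Q p)) :
    fderiv ℝ (fun z => P z + a • Z z) p (Q p + b • Z p) =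
      fderiv ℝ (fun z => Q z + b • Z z) p (P p + a • Z p) := by
  have h1 := (hP.hasFDerivAt.fun_add (hZ.hasFDerivAt.fun_const_smul a)).fderiv
  have h2 := (hQ.hasFDerivAt.fun_add (hZ.hasFDerivAt.fun_const_smul b)).fderiv
  rw [h1, h2]
  simp only [_root_.add_apply, _root_.smul_apply, map_add, map_smul, hPQ, hPZ, hQZ]
  module

/-- The diagonal action of an operator on finite families of vectors. -/
noncomputable def piDiagonal (ι : Type*) [Fintype ι] [DecidableEq ι] (T : E →L[ℝ] E) :
    (ι → E) →L[ℝ] (ι → E) :=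
  ∑ i, ContinuousLinearMap.single ℝ (fun _ : ι => E) i ∘L (T ∘L ContinuousLinearMap.proj i)

theorem piDiagonal_apply {ι : Type*} [Fintype ι] [DecidableEq ι] (T : E →L[ℝ] E) (v : ι → E) :
    piDiagonal ι T v = fun i => T (v i) := by
  ext i
  simp [piDiagonal, _root_.sum_apply, Finset.sum_apply, Pi.single_apply]

theorem AnalyticAt.piDiagonal {F : Type*} [NormedAddCommGroup F] [NormedSpace ℝ F]
    (ι : Type*) [Fintype ι] [DecidableEq ι] {T : F → E →L[ℝ] E} {p : F} (hT : AnalyticAt ℝ T p) :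
    AnalyticAt ℝ (fun z => piDiagonal ι (T z)) p := by
  unfold _root_.piDiagonal
  refine Finset.analyticAt_fun_sum _ fun i _ => ?_
  exact AnalyticAt.clm_comp₂ (ContinuousLinearMap.compL ℝ (ι → E) E (ι → E)) analyticAt_const
    (AnalyticAt.clm_comp₂ (ContinuousLinearMap.compL ℝ (ι → E) E E) hT analyticAt_const)

end CommutingFamily

section CommutingFamilyZero

open Metric MeasureTheory

/-- A finite commuting family of analytic fields on a closed ball, one of which points strictly
inward on the boundary sphere, has a common zero. -/
theorem exists_common_zero_of_commuting_family {r : ℝ} (hr : 0 < r) (n : ℕ) :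
    ∀ V : Fin (n + 1) → EuclideanSpace ℝ (Fin 3) → EuclideanSpace ℝ (Fin 3),
      (∀ i, ∀ p ∈ closedBall (0 : EuclideanSpace ℝ (Fin 3)) r, AnalyticAt ℝ (V i) p) →
      (∀ i j, ∀ p ∈ closedBall (0 : EuclideanSpace ℝ (Fin 3)) r,
        fderiv ℝ (V i) p (V j p) = fderiv ℝ (V j) p (V i p)) →
      (∀ p, ‖p‖ = r → ⟪V 0 p, p⟫ < 0) →
      ∃ p ∈ closedBall (0 : EuclideanSpace ℝ (Fin 3)) r, ∀ i, V i p = 0 := by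
  have hdim : Module.finrank ℝ (EuclideanSpace ℝ (Fin 3)) = 3 := finrank_euclideanSpace_fin
  induction n with
  | zero =>
    intro V hV _ hin
    obtain ⟨p, hp, hp0⟩ := exists_eq_zero_of_continuousOn_of_inward hdim hr
      (fun p hp => (hV 0 p hp).continuousAt.continuousWithinAt) hin
    exact ⟨p, hp, fun i => by
      rwa [show i = 0 from Fin.fin_one_eq_zero i]⟩
  | succ n ih =>
    intro V hV hcomm hin
    rcases n with _ | n
    · obtain ⟨p, hp, h0, h1⟩ := exists_common_zero_of_commuting_pair hr (hV 0) (hV 1)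
        (hcomm 0 1) hin
      exact ⟨p, hp, Fin.forall_fin_two.2 ⟨h0, h1⟩⟩
    by_contra! hne
    set Z := V (Fin.last (n + 2)) with hZdef
    set Q : Fin (n + 2) → EuclideanSpace ℝ (Fin 3) → EuclideanSpace ℝ (Fin 3) :=
      fun i => V i.castSucc with hQdef
    have hZ := hV (Fin.last (n + 2))
    have hQ : ∀ i, ∀ p ∈ closedBall (0 : EuclideanSpace ℝ (Fin 3)) r, AnalyticAt ℝ (Q i) p :=
      fun i => hV i.castSucc
    have hQin : ∀ p, ‖p‖ = r → ⟪Q 0 p, p⟫ < 0 := hin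
    have hQZ : ∀ i, ∀ p ∈ closedBall (0 : EuclideanSpace ℝ (Fin 3)) r,
        fderiv ℝ (Q i) p (Z p) = fderiv ℝ Z p (Q i p) := fun i => hcomm i.castSucc (Fin.last _)
    have hne' : ∀ p ∈ closedBall (0 : EuclideanSpace ℝ (Fin 3)) r, (∀ i, Q i p = 0) → Z p ≠ 0 := by
      intro p hp h hz
      obtain ⟨i, hi⟩ := hne p hp
      exact hi (Fin.lastCases hz h i)
    set T := {p ∈ ball (0 : EuclideanSpace ℝ (Fin 3)) r | Z p ≠ 0} with hT
    have hTB : ∀ p ∈ T, p ∈ closedBall (0 : EuclideanSpace ℝ (Fin 3)) r := fun p hp =>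
      ball_subset_closedBall hp.1
    set Φ : EuclideanSpace ℝ (Fin 3) → Fin (n + 2) → EuclideanSpace ℝ (Fin 3) :=
      fun p i => rejection Z (Q i) p with hΦdef
    set μ : EuclideanSpace ℝ (Fin 3) → ℝ × ℝ :=
      fun p => (rejectionCoeff Z (Q 0) p, rejectionCoeff Z (Q 1) p) with hμdef
    have hμi : ∀ i, ∀ p ∈ T, DifferentiableAt ℝ (rejectionCoeff Z (Q i)) p := fun i p hp =>
      ((hZ p (hTB p hp)).rejectionCoeff (hQ i p (hTB p hp)) hp.2).differentiableAt
    have hΦi : ∀ i, ∀ p ∈ T, AnalyticAt ℝ (rejection Z (Q i)) p := fun i p hp =>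
      (hZ p (hTB p hp)).rejection (hQ i p (hTB p hp)) hp.2
    have hnz : ∀ p ∈ T, ¬ ∀ᶠ z in 𝓝 p, Φ z = 0 := by
      intro p hp hev
      obtain ⟨q, hq, hq0⟩ := exists_common_zero_of_eventually_collinear hdim hr hV hin hp.1
        (hev.mono fun z hz => ⟨Z z, Fin.lastCases ⟨1, (one_smul ℝ (Z z)).symm⟩ fun i =>
          ⟨-rejectionCoeff Z (Q i) z, by
            rw [neg_smul]
            exact eq_neg_of_add_eq_zero_left (congrFun hz i)⟩⟩)
      obtain ⟨i, hi⟩ := hne q hq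
      exact hi (hq0 i)
    have hnull := measure_image_null_of_not_eventually_zero (volume : Measure (ℝ × ℝ))
      (E := EuclideanSpace ℝ (Fin 3)) (T := T) (Y := Z) (μ := μ) (Φ := Φ)
      (A := fun p => piDiagonal (Fin (n + 2)) (rejectionTransport Z p))
      (by simp) (isOpen_ball_inter_ne_zero hZ) (fun p hp => hZ p (hTB p hp))
      (fun p hp => (hμi 0 p hp).prodMk (hμi 1 p hp))
      (fun p hp => AnalyticAt.pi fun i => hΦi i p hp)
      (fun p hp => ((hZ p (hTB p hp)).rejectionTransport hp.2).piDiagonal _)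
      (fun p hp => by
        ext1 i
        rw [piDiagonal_apply, hΦdef, fderiv_pi fun i => (hΦi i p hp).differentiableAt]
        exact fderiv_rejection (hZ p (hTB p hp)) (hQ i p (hTB p hp)) hp.2 (hQZ i p (hTB p hp)))
      (fun p hp _ => hp.2)
      (fun p hp h => by
        have hi : ∀ i, fderiv ℝ (rejectionCoeff Z (Q i)) p (Z p) = 0 := fun i => by
          rw [fderiv_rejectionCoeff (hZ p (hTB p hp)) (hQ i p (hTB p hp)) hp.2
            (hQZ i p (hTB p hp)), show rejection Z (Q i) p = 0 from congrFun h i, map_zero]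
        rw [hμdef, (hμi 0 p hp).fderiv_prodMk (hμi 1 p hp)]
        exact Prod.ext (hi 0) (hi 1))
    obtain ⟨δ, hδ, hδin⟩ := exists_forall_abs_lt_inner_add_smul_neg
      (fun p hp => (hQ 0 p hp).continuousAt.continuousWithinAt)
      (fun p hp => (hZ p hp).continuousAt.continuousWithinAt) hQin
    refine (measure_ball_pos (volume : Measure (ℝ × ℝ)) 0 hδ).ne' (measure_mono_null ?_ hnull)
    rintro ⟨s, t⟩ hst
    have hs : |s| < δ := ((norm_fst_le (s, t)).trans_lt (mem_ball_zero_iff.1 hst))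
    set c : Fin (n + 2) → ℝ := Fin.cons s fun _ => t with hc
    obtain ⟨p, hp, hp0⟩ := ih (fun i z => Q i z + c i • Z z)
      (fun i p hp => (hQ i p hp).fun_add (analyticAt_const.fun_smul (hZ p hp)))
      (fun i j p hp => fderiv_add_smul_comm (c i) (c j) (hQ i p hp).differentiableAt
        (hQ j p hp).differentiableAt (hZ p hp).differentiableAt
        (hcomm i.castSucc j.castSucc p hp) (hQZ i p hp) (hQZ j p hp)) (hδin s hs)
    have hQp : ∀ i, Q i p = (-c i) • Z p := fun i => by
      rw [neg_smul]
      exact eq_neg_of_add_eq_zero_left (hp0 i)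
    have hZp : Z p ≠ 0 := fun hz => hne' p hp (fun i => by rw [hQp, hz, smul_zero]) hz
    have hpb : p ∈ ball (0 : EuclideanSpace ℝ (Fin 3)) r := by
      rw [mem_closedBall_zero_iff] at hp
      refine mem_ball_zero_iff.2 (hp.lt_of_ne fun h => (hδin s hs p h).ne ?_)
      rw [show Q 0 p + s • Z p = 0 from hp0 0, inner_zero_left]
    refine ⟨p, ⟨⟨hpb, hZp⟩, funext fun i => rejection_of_eq_smul hZp (hQp i), hnz p ⟨hpb, hZp⟩⟩, ?_⟩
    rw [hμdef]
    refine Prod.ext ?_ ?_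
    · exact (rejectionCoeff_of_eq_smul hZp (hQp 0)).trans (neg_neg s)
    · exact (rejectionCoeff_of_eq_smul hZp (hQp 1)).trans (neg_neg t)

end CommutingFamilyZero

end AnalyticVectorFields

/-- Example 1.3: an abelian family of analytic vector fields on an open set of ℝ³
containing a closed ball, one member of which points strictly inward on the boundary
sphere, has a common zero inside the ball. -/
theorem abelian_analytic_common_zero_in_ball
    (r : ℝ) (hr : 0 < r)
    (M : Set (EuclideanSpace ℝ (Fin 3))) (hM : IsOpen M)
    (hball : Metric.closedBall 0 r ⊆ M)
    (𝒜 : Set (EuclideanSpace ℝ (Fin 3) → EuclideanSpace ℝ (Fin 3)))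
    (hanal : ∀ Y ∈ 𝒜, ∀ p ∈ M, AnalyticAt ℝ Y p)
    (hcomm : ∀ Y ∈ 𝒜, ∀ Z ∈ 𝒜, ∀ p ∈ M,
      (fderiv ℝ Z p) (Y p) - (fderiv ℝ Y p) (Z p) = 0)
    (X : EuclideanSpace ℝ (Fin 3) → EuclideanSpace ℝ (Fin 3)) (hX : X ∈ 𝒜)
    (hin : ∀ p : EuclideanSpace ℝ (Fin 3), ‖p‖ = r → ⟪X p, p⟫ < 0) :
    ∃ p : EuclideanSpace ℝ (Fin 3), ‖p‖ < r ∧ ∀ Y ∈ 𝒜, Y p = 0 := by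
  have hcont : ∀ Y ∈ 𝒜, ContinuousOn Y (Metric.closedBall 0 r) := fun Y hY p hp =>
    (hanal Y hY p (hball hp)).continuousAt.continuousWithinAt
  have hclosed : ∀ Y : 𝒜, IsClosed (Metric.closedBall 0 r ∩ Y.1 ⁻¹' {0}) := fun Y =>
    (hcont Y.1 Y.2).preimage_isClosed_of_isClosed Metric.isClosed_closedBall isClosed_singleton
  obtain ⟨p, hp, hp0⟩ : (Metric.closedBall (0 : EuclideanSpace ℝ (Fin 3)) r ∩
      ⋂ Y : 𝒜, (Metric.closedBall 0 r ∩ Y.1 ⁻¹' {0})).Nonempty := by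
    refine (isCompact_closedBall _ _).inter_iInter_nonempty _ hclosed fun u => ?_
    let e := u.equivFin.symm
    let V : Fin (u.card + 1) → 𝒜 := Fin.cons ⟨X, hX⟩ fun i => (e i).1
    obtain ⟨p, hp, hp0⟩ := exists_common_zero_of_commuting_family hr u.card (fun i => (V i).1)
      (fun i p hp => hanal _ (V i).2 p (hball hp))
      (fun i j p hp => sub_eq_zero.1 (hcomm _ (V j).2 _ (V i).2 p (hball hp))) hin
    refine ⟨p, hp, Set.mem_iInter₂.2 fun Y hY => ⟨hp, ?_⟩⟩
    have h := hp0 (e.symm ⟨Y, hY⟩).succ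
    simpa [V] using h
  have hzero : ∀ Y ∈ 𝒜, Y p = 0 := fun Y hY => (Set.mem_iInter.1 hp0 ⟨Y, hY⟩).2
  refine ⟨p, (mem_closedBall_zero_iff.1 hp).lt_of_ne fun h => (hin p h).ne ?_, hzero⟩
  rw [hzero X hX, inner_zero_left]
end

section
/- Let E be a finite-dimensional real normed vector space, M ⊆ E an open set, and T, S : E → E vector fields that are continuously differentiable (C¹) on M and commute on M. Let I ⊆ ℝ be an open interval and γ : ℝ → E a curve with γ t ∈ M for all t ∈ I and HasDerivAt γ (T (γ t)) t for every t ∈ I. If S (γ t₀) = 0 for some t₀ ∈ I, then S (γ t) = 0 for every t ∈ I. -/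
/-- A solution of a homogeneous linear ODE with continuous coefficients on an interval vanishes
identically as soon as it vanishes at one point. -/
theorem eq_zero_of_hasDerivAt_clm_apply
    {E : Type*} [NormedAddCommGroup E] [NormedSpace ℝ E]
    {I : Set ℝ} (hI : I.OrdConnected) {A : ℝ → E →L[ℝ] E} (hA : ContinuousOn A I)
    {u : ℝ → E} (hu : ∀ t ∈ I, HasDerivAt u (A t (u t)) t)
    {t₀ : ℝ} (ht₀ : t₀ ∈ I) (hzero : u t₀ = 0) {t : ℝ} (ht : t ∈ I) : u t = 0 := by
  have lipschitz : ∀ a ∈ I, ∀ b ∈ I, ∃ K : NNReal, ∀ s ∈ Set.Icc a b,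
      LipschitzOnWith K (A s) Set.univ := by
    intro a ha b hb
    obtain ⟨C, hC⟩ := isCompact_Icc.exists_bound_of_continuousOn (hA.mono (hI.out ha hb))
    refine ⟨C.toNNReal, fun s hs => ((A s).lipschitz.weaken ?_).lipschitzOnWith⟩
    exact NNReal.le_toNNReal_of_coe_le (hC s hs)
  have hcont : ContinuousOn u I := fun s hs => (hu s hs).continuousAt.continuousWithinAt
  have hconst : ∀ s, HasDerivAt (fun _ : ℝ => (0 : E)) (A s 0) s := fun s => by
    simpa using hasDerivAt_const s (0 : E)
  rcases le_total t₀ t with h | h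
  · obtain ⟨K, hK⟩ := lipschitz t₀ ht₀ t ht
    exact ODE_solution_unique_of_mem_Icc_right (v := fun s => A s) (s := fun _ => Set.univ)
      (g := fun _ => 0) (fun s hs => hK s (Set.Ico_subset_Icc_self hs))
      (hcont.mono (hI.out ht₀ ht))
      (fun s hs => (hu s (hI.out ht₀ ht (Set.Ico_subset_Icc_self hs))).hasDerivWithinAt)
      (fun _ _ => trivial) continuousOn_const (fun s _ => (hconst s).hasDerivWithinAt)
      (fun _ _ => trivial) hzero (Set.right_mem_Icc.2 h)
  · obtain ⟨K, hK⟩ := lipschitz t ht t₀ ht₀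
    exact ODE_solution_unique_of_mem_Icc_left (v := fun s => A s) (s := fun _ => Set.univ)
      (g := fun _ => 0) (fun s hs => hK s (Set.Ioc_subset_Icc_self hs))
      (hcont.mono (hI.out ht ht₀))
      (fun s hs => (hu s (hI.out ht ht₀ (Set.Ioc_subset_Icc_self hs))).hasDerivWithinAt)
      (fun _ _ => trivial) continuousOn_const (fun s _ => (hconst s).hasDerivWithinAt)
      (fun _ _ => trivial) hzero (Set.left_mem_Icc.2 h)

/-- Invariance Lemma (Lemma 2.1), Euclidean form: if C¹ vector fields T and S commute
on an open set M and γ is an integral curve of T in M defined on an open interval I,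
then S vanishes along the whole curve as soon as it vanishes at one point of I. -/
theorem zero_set_invariant_along_integral_curve
    {E : Type*} [NormedAddCommGroup E] [NormedSpace ℝ E] [FiniteDimensional ℝ E]
    (M : Set E) (hM : IsOpen M)
    (T S : E → E)
    (hT : ContDiffOn ℝ 1 T M) (hS : ContDiffOn ℝ 1 S M)
    (hcomm : ∀ p ∈ M, (fderiv ℝ S p) (T p) - (fderiv ℝ T p) (S p) = 0)
    (I : Set ℝ) (hIopen : IsOpen I) (hIconn : I.OrdConnected)
    (γ : ℝ → E)
    (hγM : ∀ t ∈ I, γ t ∈ M)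
    (hγ : ∀ t ∈ I, HasDerivAt γ (T (γ t)) t)
    (t₀ : ℝ) (ht₀ : t₀ ∈ I) (hzero : S (γ t₀) = 0) :
    ∀ t ∈ I, S (γ t) = 0 := by
  intro t ht
  have hA : ContinuousOn (fun s => fderiv ℝ T (γ s)) I :=
    (hT.continuousOn_fderiv_of_isOpen hM le_rfl).comp
      (fun s hs => (hγ s hs).continuousAt.continuousWithinAt) hγM
  refine eq_zero_of_hasDerivAt_clm_apply hIconn hA (u := fun s => S (γ s)) ?_ ht₀ hzero ht
  intro s hs
  have hSs : DifferentiableAt ℝ S (γ s) :=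
    (hS.differentiableOn one_ne_zero).differentiableAt (hM.mem_nhds (hγM s hs))
  rw [← sub_eq_zero.1 (hcomm (γ s) (hγM s hs))]
  exact hSs.hasFDerivAt.comp_hasDerivAt s (hγ s hs)
end

section
/- Let E be a real normed vector space, T : E → E a vector field, and φ : ℝ → E → E a global flow of T, i.e., φ 0 x = x and for each x the curve t ↦ φ t x satisfies HasDerivAt (fun t => φ t x) (T (φ t x)) t for all t. Let P ⊆ E be a totally disconnected set that is invariant under φ, i.e., φ t p ∈ P for every p ∈ P and t ∈ ℝ. Then T p = 0 for every p ∈ P. -/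
/-- Proposition 2.3(b), Euclidean form: a vector field vanishes on every totally
disconnected set invariant under its flow. -/
theorem vanishes_on_totallyDisconnected_invariant_set
    {E : Type*} [NormedAddCommGroup E] [NormedSpace ℝ E]
    (T : E → E)
    (φ : ℝ → E → E)
    (hφ0 : ∀ x, φ 0 x = x)
    (hφ : ∀ x, ∀ t : ℝ, HasDerivAt (fun t => φ t x) (T (φ t x)) t)
    (P : Set E) (hPdisc : IsTotallyDisconnected P)
    (hPinv : ∀ p ∈ P, ∀ t : ℝ, φ t p ∈ P) :
    ∀ p ∈ P, T p = 0 := by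
  intro p hp
  have hcont : Continuous fun t => φ t p :=
    continuous_iff_continuousAt.2 fun t => (hφ p t).continuousAt
  have horbit : (Set.range fun t => φ t p).Subsingleton :=
    hPdisc _ (Set.range_subset_iff.2 (hPinv p hp)) (isPreconnected_range hcont)
  have hconst : (fun t => φ t p) = fun _ => p := by
    funext t
    exact (horbit ⟨t, rfl⟩ ⟨0, rfl⟩).trans (hφ0 p)
  have hderiv := hφ p 0
  rw [hconst, hφ0] at hderiv
  exact hderiv.unique (hasDerivAt_const 0 p)
end

section
/- Let n ≥ 1, E = EuclideanSpace ℝ (Fin n), and r > 0. Let X : E → E be continuous on the closed ball of radius r centered at 0, and suppose ⟪X p, p⟫ < 0 for every p with ‖p‖ = r. Then there exists a point p with ‖p‖ < r such that X p = 0. -/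
open scoped RealInnerProductSpace

section Perturbation

variable {E : Type*} [NormedAddCommGroup E]

/-- A strict contraction added to the identity gives an injective map. -/
theorem LipschitzWith.injective_id_add {K : NNReal} {g : E → E} (hg : LipschitzWith K g)
    (hK : K < 1) : Function.Injective fun x => x + g x := by
  intro x y hxy
  have h : ‖x - y‖ ≤ K * ‖x - y‖ := by
    have h₁ := hg.norm_sub_le y x
    have h₂ : g y - g x = x - y := by
      have h₃ : x + g x = y + g y := hxy
      rw [sub_eq_sub_iff_add_eq_add, add_comm (g y), ← h₃]
    rwa [h₂, norm_sub_rev y x] at h₁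
  have hK' : (K : ℝ) < 1 := by exact_mod_cast hK
  have h₀ : ‖x - y‖ = 0 := by nlinarith [norm_nonneg (x - y)]
  exact sub_eq_zero.1 (norm_eq_zero.1 h₀)

/-- A strict contraction added to the identity gives a surjective map. -/
theorem LipschitzWith.surjective_id_add [CompleteSpace E] {K : NNReal} {g : E → E}
    (hg : LipschitzWith K g) (hK : K < 1) : Function.Surjective fun x => x + g x := by
  intro y
  have hc : ContractingWith K fun z => y - g z := by
    refine ⟨hK, LipschitzWith.of_dist_le_mul fun a b => ?_⟩
    rw [dist_sub_left]
    exact hg.dist_le_mul a b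
  have hfix := hc.fixedPoint_isFixedPt
  exact ⟨_, eq_sub_iff_add_eq.1 hfix.symm⟩

/-- A contractive perturbation of the identity supported in `s` maps `s` onto `s`. -/
theorem LipschitzWith.image_id_add_eq [CompleteSpace E] {K : NNReal} {g : E → E}
    (hg : LipschitzWith K g) (hK : K < 1) {s : Set E} (hs : ∀ x ∉ s, g x = 0) :
    (fun x => x + g x) '' s = s := by
  ext y
  constructor
  · rintro ⟨x, hx, rfl⟩
    by_contra hy
    refine hy ?_
    have h : x + g x = x := hg.injective_id_add hK (by simp [hs _ hy])
    simpa only [h] using hx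
  · intro hy
    obtain ⟨x, rfl⟩ := hg.surjective_id_add hK y
    refine ⟨x, ?_, rfl⟩
    by_contra hx
    simp only [hs x hx, add_zero] at hy
    exact hx hy

/-- A Lipschitz map on a closed ball vanishing on the sphere extends by zero. -/
theorem LipschitzOnWith.lipschitzWith_indicator_closedBall [NormedSpace ℝ E] {r : ℝ}
    {K : NNReal} {g : E → E} (hg : LipschitzOnWith K g (Metric.closedBall 0 r))
    (h₀ : ∀ x, ‖x‖ = r → g x = 0) :
    LipschitzWith K ((Metric.closedBall 0 r).indicator g) := by
  have mixed : ∀ x ∈ Metric.closedBall (0 : E) r, ∀ y ∉ Metric.closedBall (0 : E) r,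
      ‖g x‖ ≤ K * ‖x - y‖ := by
    intro x hx y hy
    rw [mem_closedBall_zero_iff] at hx hy
    obtain ⟨z, hz, hzr⟩ : ∃ z ∈ segment ℝ x y, ‖z‖ = r :=
      (convex_segment x y).isPreconnected.intermediate_value (left_mem_segment ℝ x y)
        (right_mem_segment ℝ x y) continuous_norm.continuousOn ⟨hx, (not_le.1 hy).le⟩
    have h := hg.norm_sub_le (mem_closedBall_zero_iff.2 hx)
      (mem_closedBall_zero_iff.2 hzr.le)
    rw [h₀ z hzr, sub_zero] at h
    refine h.trans (mul_le_mul_of_nonneg_left ?_ K.2)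
    have hd := dist_add_dist_of_mem_segment hz
    rw [← dist_eq_norm, ← dist_eq_norm]
    linarith [dist_nonneg (x := z) (y := y)]
  refine LipschitzWith.of_dist_le_mul fun x y => ?_
  rw [dist_eq_norm, dist_eq_norm]
  by_cases hx : x ∈ Metric.closedBall (0 : E) r <;> by_cases hy : y ∈ Metric.closedBall (0 : E) r
  · simpa only [Set.indicator_of_mem hx, Set.indicator_of_mem hy] using hg.norm_sub_le hx hy
  · simpa only [Set.indicator_of_mem hx, Set.indicator_of_notMem hy, sub_zero]
      using mixed x hx y hy
  · simpa only [Set.indicator_of_notMem hx, Set.indicator_of_mem hy, zero_sub, norm_neg,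
      norm_sub_rev x y] using mixed y hy x hx
  · simp only [Set.indicator_of_notMem hx, Set.indicator_of_notMem hy, sub_zero, norm_zero]
    positivity

end Perturbation

/-- Since `det (1 + t A)` is a polynomial in `t` of bounded degree, its value at `t = 1` is a
fixed linear combination of its values at finitely many small `t`. -/
theorem exists_det_one_add_eq_sum (E : Type*) [NormedAddCommGroup E] [NormedSpace ℝ E]
    [FiniteDimensional ℝ E] {δ : ℝ} (hδ : 0 < δ) :
    ∃ (s : Finset ℝ) (w : ℝ → ℝ), (∀ t ∈ s, t ∈ Set.Ioo 0 δ) ∧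
      ∀ A : E →L[ℝ] E, (1 + A).det = ∑ t ∈ s, w t * (1 + t • A).det := by
  classical
  obtain ⟨s, hs, hcard⟩ :=
    (Set.Ioo_infinite hδ).exists_subset_card_eq (Module.finrank ℝ E + 1)
  refine ⟨s, fun t => (Lagrange.basis s id t).eval 1, fun t ht => hs ht, fun A => ?_⟩
  let b := Module.finBasis ℝ E
  let M := LinearMap.toMatrix b b (A : E →ₗ[ℝ] E)
  let p : Polynomial ℝ :=
    Matrix.det ((Polynomial.X : Polynomial ℝ) • M.map Polynomial.C
      + (1 : Matrix _ _ ℝ).map Polynomial.C)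
  have hp : ∀ t : ℝ, p.eval t = (1 + t • A).det := by
    intro t
    have h₁ : (1 + t • A).det = Matrix.det (1 + t • M) := by
      rw [ContinuousLinearMap.det, ← LinearMap.det_toMatrix b]
      congr 1
      simp [M, LinearMap.toMatrix_one]
    rw [h₁, ← Polynomial.coe_evalRingHom, RingHom.map_det]
    congr 1
    ext i j
    rcases eq_or_ne i j with rfl | hij
    · simp
      ring
    · simp [Matrix.one_apply_ne hij]
      ring
  have hdeg : p.degree < s.card := by
    refine Polynomial.degree_le_natDegree.trans_lt ?_
    have h := Polynomial.natDegree_det_X_add_C_le M 1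
    rw [Fintype.card_fin] at h
    rw [hcard]
    exact_mod_cast Nat.lt_succ_of_le h
  have h := congrArg (Polynomial.eval 1)
    (Lagrange.eq_interpolate (f := p) (s := s) (v := id) Function.injective_id.injOn hdeg)
  rw [hp, one_smul] at h
  rw [h, Lagrange.interpolate_apply, Polynomial.eval_finsetSum]
  refine Finset.sum_congr rfl fun t _ => ?_
  rw [Polynomial.eval_mul, Polynomial.eval_C, id, hp, mul_comm]

section Retraction

open MeasureTheory

variable {E : Type*} [NormedAddCommGroup E] [InnerProductSpace ℝ E] [FiniteDimensional ℝ E]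

/-- The derivative of a map into a sphere of positive radius is singular. -/
theorem det_fderiv_eq_zero_of_norm_eventuallyEq {f : E → E} {x : E} {r : ℝ} (hr : 0 < r)
    (hf : DifferentiableAt ℝ f x) (hfr : ∀ᶠ y in nhds x, ‖f y‖ = r) :
    (fderiv ℝ f x).det = 0 := by
  by_contra hdet
  have horth : ∀ v, ⟪f x, fderiv ℝ f x v⟫ = 0 := by
    intro v
    have h₁ := hf.hasFDerivAt.norm_sq
    have h₂ : HasFDerivAt (fun y => ‖f y‖ ^ 2) (0 : E →L[ℝ] ℝ) x :=
      (hasFDerivAt_const (r ^ 2) x).congr_of_eventuallyEq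
        (hfr.mono fun y hy => by simp only [hy])
    have h₃ := congrArg (fun L : E →L[ℝ] ℝ => L v) (h₁.unique h₂)
    simpa using h₃
  have hsurj : Function.Surjective (fderiv ℝ f x) :=
    (LinearMap.equivOfDetNeZero (fderiv ℝ f x : E →ₗ[ℝ] E) hdet).surjective
  obtain ⟨v, hv⟩ := hsurj (f x)
  have h := horth v
  rw [hv, real_inner_self_eq_norm_sq, hfr.self_of_nhds] at h
  exact (pow_pos hr 2).ne' h

/-- There is no `C¹` retraction of a closed ball onto its boundary sphere. -/
theorem not_exists_contDiff_retraction_closedBall {r : ℝ} (hr : 0 < r) {f : E → E}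
    (hf : ∀ x ∈ Metric.closedBall (0 : E) r, ContDiffAt ℝ 1 f x)
    (hfr : ∀ x ∈ Metric.closedBall (0 : E) r, ‖f x‖ = r)
    (hfid : ∀ x, ‖x‖ = r → f x = x) : False := by
  borelize E
  let B := Metric.closedBall (0 : E) r
  let U := Metric.ball (0 : E) r
  have hUB : U ⊆ B := Metric.ball_subset_closedBall
  have hB : IsCompact B := isCompact_closedBall 0 r
  let g : E → E := fun x => f x - x
  let g' : E → E →L[ℝ] E := fun x => fderiv ℝ f x - 1
  have hfd : ∀ x ∈ B, DifferentiableAt ℝ f x := fun x hx =>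
    (hf x hx).differentiableAt one_ne_zero
  have hg' : ∀ x ∈ B, HasFDerivAt g (g' x) x := fun x hx =>
    (hfd x hx).hasFDerivAt.sub (hasFDerivAt_id x)
  have hg'c : ContinuousOn g' B := fun x hx =>
    (((hf x hx).fderiv_right (m := 0) (by simp)).continuousAt.sub
      continuousAt_const).continuousWithinAt
  obtain ⟨C, hC⟩ := hB.exists_bound_of_continuousOn hg'c
  let K : NNReal := ⟨max C 0, le_max_right _ _⟩
  have hK : ∀ x ∈ B, ‖g' x‖ ≤ K := fun x hx => (hC x hx).trans (le_max_left _ _)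
  have hgLip : LipschitzOnWith K g B :=
    (convex_closedBall 0 r).lipschitzOnWith_of_nnnorm_hasFDerivWithin_le
      (fun x hx => (hg' x hx).hasFDerivWithinAt) hK
  have hgInd : LipschitzWith K (B.indicator g) :=
    hgLip.lipschitzWith_indicator_closedBall fun x hx => by simp [g, hfid x hx]
  have hgInd₀ : ∀ x ∉ U, B.indicator g x = 0 := by
    intro x hx
    by_cases hxB : x ∈ B
    · have hxr : ‖x‖ = r := le_antisymm (mem_closedBall_zero_iff.1 hxB)
        (not_lt.1 fun h => hx (mem_ball_zero_iff.2 h))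
      rw [Set.indicator_of_mem hxB]
      simp [g, hfid x hxr]
    · exact Set.indicator_of_notMem hxB g
  obtain ⟨ε, hε, hdet⟩ : ∃ ε > 0, ∀ A : E →L[ℝ] E, ‖A - 1‖ < ε → 0 < A.det := by
    have h : ∀ᶠ A : E →L[ℝ] E in nhds 1, 0 < A.det :=
      ContinuousLinearMap.continuous_det.continuousAt.eventually_const_lt (by
        simp [ContinuousLinearMap.det])
    obtain ⟨ε, hε, h⟩ := Metric.eventually_nhds_iff.1 h
    exact ⟨ε, hε, fun A hA => h (by rwa [dist_eq_norm])⟩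
  obtain ⟨δ, hδ, hδK⟩ : ∃ δ > 0, δ * (K : ℝ) < min ε 1 := by
    have hm : 0 < min ε 1 := lt_min hε one_pos
    refine ⟨min ε 1 / (K + 1), by positivity, ?_⟩
    rw [div_mul_eq_mul_div, div_lt_iff₀ (by positivity)]
    nlinarith
  have hvol : ∀ t ∈ Set.Ioo 0 δ,
      ∫ x in U, (1 + t • g' x).det = volume.real U := by
    intro t ht
    have htK : t * K < min ε 1 :=
      (mul_le_mul_of_nonneg_right ht.2.le K.2).trans_lt hδK
    let T : NNReal := ⟨t, ht.1.le⟩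
    have hLip : LipschitzWith (T * K) fun x => t • B.indicator g x := by
      refine LipschitzWith.of_dist_le_mul fun x y => ?_
      rw [dist_smul₀, Real.norm_of_nonneg ht.1.le, NNReal.coe_mul, mul_assoc]
      exact mul_le_mul_of_nonneg_left (hgInd.dist_le_mul x y) ht.1.le
    have hTK : T * K < 1 := by
      rw [← NNReal.coe_lt_coe]
      exact htK.trans_le (min_le_right _ _)
    have himage := hLip.image_id_add_eq hTK (s := U) fun x hx => by
      simp only [hgInd₀ x hx, smul_zero]
    have hderiv : ∀ x ∈ U, HasFDerivWithinAt (fun x => x + t • B.indicator g x)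
        (1 + t • g' x) U x := by
      intro x hx
      have h : HasFDerivWithinAt (fun x => x + t • g x) (1 + t • g' x) U x :=
        ((hasFDerivAt_id x).add ((hg' x (hUB hx)).const_smul t)).hasFDerivWithinAt
      refine h.congr (fun y hy => ?_) ?_
      · rw [Set.indicator_of_mem (hUB hy)]
      · rw [Set.indicator_of_mem (hUB hx)]
    have hcv := integral_image_eq_integral_abs_det_fderiv_smul volume
      (Metric.isOpen_ball (x := (0 : E)) (ε := r)).measurableSet hderiv
      (hLip.injective_id_add hTK).injOn fun _ => (1 : ℝ)
    rw [himage] at hcv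
    simp only [smul_eq_mul, mul_one] at hcv
    rw [setIntegral_const, smul_eq_mul, mul_one] at hcv
    rw [hcv]
    refine setIntegral_congr_fun Metric.isOpen_ball.measurableSet fun x hx => ?_
    refine (abs_of_pos (hdet _ ?_)).symm
    rw [add_sub_cancel_left, norm_smul, Real.norm_of_nonneg ht.1.le]
    exact (mul_le_mul_of_nonneg_left (hK x (hUB hx)) ht.1.le).trans_lt
      (htK.trans_le (min_le_left _ _))
  have hint : ∀ t : ℝ, IntegrableOn (fun x => (1 + t • g' x).det) U := fun t =>
    ((ContinuousLinearMap.continuous_det.comp_continuousOn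
      (continuousOn_const.add (hg'c.const_smul t))).integrableOn_compact hB).mono_set hUB
  obtain ⟨s, w, hs, hw⟩ := exists_det_one_add_eq_sum E hδ
  have hsum : ∑ t ∈ s, w t = 1 := by
    have h := hw 0
    simpa [ContinuousLinearMap.det] using h.symm
  have hzero : ∫ x in U, (1 + g' x).det = 0 := by
    refine setIntegral_eq_zero_of_forall_eq_zero fun x hx => ?_
    rw [add_sub_cancel]
    exact det_fderiv_eq_zero_of_norm_eventuallyEq hr (hfd x (hUB hx))
      ((Metric.isOpen_ball.eventually_mem hx).mono fun y hy => hfr y (hUB hy))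
  have hone : ∫ x in U, (1 + g' x).det = volume.real U := by
    rw [funext fun x => hw (g' x)]
    rw [integral_finsetSum _ fun t _ => (hint t).const_mul (w t)]
    simp_rw [integral_const_mul]
    rw [Finset.sum_congr rfl fun t ht => by rw [hvol t (hs t ht)], ← Finset.sum_mul, hsum,
      one_mul]
  have hpos : 0 < volume.real U :=
    ENNReal.toReal_pos (Metric.measure_ball_pos volume 0 hr).ne' measure_ball_lt_top.ne
  exact hpos.ne' (hone.symm.trans hzero)

/-- A `C¹` vector field pointing strictly inward on a sphere has a zero in the closed ball. -/
theorem ContDiff.exists_zero_of_inward {r : ℝ} (hr : 0 < r) {Y : E → E} (hY : ContDiff ℝ 1 Y)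
    (hin : ∀ p, ‖p‖ = r → ⟪Y p, p⟫ < 0) : ∃ p ∈ Metric.closedBall (0 : E) r, Y p = 0 := by
  by_contra! hne
  -- Push `x` along the ray in direction `-Y x` until it meets the sphere.
  let D : E → ℝ := fun x => ⟪Y x, x⟫ ^ 2 + ‖Y x‖ ^ 2 * (r ^ 2 - ‖x‖ ^ 2)
  let τ : E → ℝ := fun x => (⟪Y x, x⟫ + √(D x)) / ‖Y x‖ ^ 2
  have hpos : ∀ x ∈ Metric.closedBall (0 : E) r, 0 < ‖Y x‖ ^ 2 := fun x hx =>
    pow_pos (norm_pos_iff.2 (hne x hx)) 2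
  have hD : ∀ x ∈ Metric.closedBall (0 : E) r, 0 < D x := by
    intro x hx
    rcases (mem_closedBall_zero_iff.1 hx).eq_or_lt with h | h
    · simp only [D, h, sub_self, mul_zero, add_zero]
      exact sq_pos_of_neg (hin x h)
    · have h₁ : 0 < r ^ 2 - ‖x‖ ^ 2 := by nlinarith [norm_nonneg x]
      exact add_pos_of_nonneg_of_pos (sq_nonneg _) (mul_pos (hpos x hx) h₁)
  refine not_exists_contDiff_retraction_closedBall hr (f := fun x => x - τ x • Y x) ?_ ?_ ?_
  · intro x hx
    have hYx : ContDiffAt ℝ 1 Y x := hY.contDiffAt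
    have hinner : ContDiffAt ℝ 1 (fun x => ⟪Y x, x⟫) x := hYx.inner ℝ contDiffAt_id
    have hDx : ContDiffAt ℝ 1 D x := (hinner.pow 2).add
      ((hYx.norm_sq ℝ).mul (contDiffAt_const.sub (contDiffAt_id.norm_sq ℝ)))
    exact contDiffAt_id.sub
      (((hinner.add (hDx.sqrt (hD x hx).ne')).div (hYx.norm_sq ℝ) (hpos x hx).ne').smul hYx)
  · intro x hx
    have hsq : ‖x - τ x • Y x‖ ^ 2 = r ^ 2 := by
      have h₁ := Real.sq_sqrt (hD x hx).le
      have h₂ : ‖Y x‖ ≠ 0 := norm_ne_zero_iff.2 (hne x hx)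
      rw [norm_sub_sq_real, norm_smul, mul_pow, Real.norm_eq_abs, sq_abs, inner_smul_right,
        real_inner_comm]
      simp only [τ]
      field_simp
      simp only [D] at h₁ ⊢
      linear_combination h₁
    exact (pow_left_inj₀ (norm_nonneg _) hr.le two_ne_zero).1 hsq
  · intro x hx
    have h := hin x hx
    have hτ : τ x = 0 := by
      simp only [τ, D, hx, sub_self, mul_zero, add_zero, Real.sqrt_sq_eq_abs, abs_of_neg h,
        add_neg_cancel, zero_div]
    simp only [hτ, zero_smul, sub_zero]

end Retraction

/-- Poincaré–Hopf for a ball: a continuous vector field pointing strictly inward on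
the boundary sphere of a closed ball in ℝⁿ has a zero inside the ball. -/
theorem inward_field_has_zero_in_ball
    (n : ℕ) (hn : 1 ≤ n)
    (r : ℝ) (hr : 0 < r)
    (X : EuclideanSpace ℝ (Fin n) → EuclideanSpace ℝ (Fin n))
    (hXcont : ContinuousOn X (Metric.closedBall 0 r))
    (hin : ∀ p : EuclideanSpace ℝ (Fin n), ‖p‖ = r → ⟪X p, p⟫ < 0) :
    ∃ p : EuclideanSpace ℝ (Fin n), ‖p‖ < r ∧ X p = 0 := by
  let E := EuclideanSpace ℝ (Fin n)
  by_contra! hne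
  have hB : IsCompact (Metric.closedBall (0 : E) r) := isCompact_closedBall 0 r
  have hX₀ : ∀ p ∈ Metric.closedBall (0 : E) r, 0 < ‖X p‖ := by
    intro p hp
    rw [norm_pos_iff]
    rcases (mem_closedBall_zero_iff.1 hp).eq_or_lt with h | h
    · intro h₀
      have := hin p h
      simp [h₀] at this
    · exact hne p h
  obtain ⟨a, ha, hXa⟩ := hB.exists_forall_le' hXcont.norm hX₀
  have hS : IsCompact (Metric.sphere (0 : E) r) := isCompact_sphere 0 r
  obtain ⟨b, hb, hXb⟩ : ∃ b, 0 < b ∧ ∀ p ∈ Metric.sphere (0 : E) r, b ≤ -⟪X p, p⟫ :=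
    hS.exists_forall_le'
      ((hXcont.mono Metric.sphere_subset_closedBall).inner continuousOn_id).neg
      fun p hp => neg_pos.2 (hin p (mem_sphere_zero_iff_norm.1 hp))
  obtain ⟨Z, hZ⟩ := ContinuousMap.exists_restrict_eq
    (Y := E) Metric.isClosed_closedBall ⟨_, hXcont.domRestrict⟩
  have hZX : ∀ p ∈ Metric.closedBall (0 : E) r, Z p = X p := fun p hp =>
    DFunLike.congr_fun hZ ⟨p, hp⟩
  have hε : 0 < min a (b / r) := lt_min ha (div_pos hb hr)
  obtain ⟨Y, hY, hYZ, -⟩ :=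
    Z.continuous.exists_contDiff_approx 1 (continuous_const (y := min a (b / r))) fun _ => hε
  have hYX : ∀ p ∈ Metric.closedBall (0 : E) r, ‖Y p - X p‖ < min a (b / r) := by
    intro p hp
    rw [← hZX p hp, ← dist_eq_norm]
    exact hYZ p
  obtain ⟨p, hp, hp₀⟩ := ContDiff.exists_zero_of_inward hr (Y := Y) (by exact_mod_cast hY) <| by
    intro p hp
    have hpB : p ∈ Metric.closedBall (0 : E) r := mem_closedBall_zero_iff.2 hp.le
    have h₁ := real_inner_le_norm (Y p - X p) p
    have h₂ := hXb p (mem_sphere_zero_iff_norm.2 hp)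
    have h₃ := (lt_div_iff₀ hr).1 ((hYX p hpB).trans_le (min_le_right _ _))
    rw [inner_sub_left, hp] at h₁
    linarith
  have h₁ := (hYX p hp).trans_le (min_le_left _ _)
  rw [hp₀, zero_sub, norm_neg] at h₁
  exact absurd (hXa p hp) (not_le.2 h₁)
end
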